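/- The family T_1 is helpful; that is, for every t > 0 there exists c = c(t) such that every T_1-free graph with treewidth more than c contains K_t, K_{t,t}, a subdivision of the t-by-t wall W_{t×t}, or the line graph of a subdivision of W_{t×t} as an induced subgraph. -/

import Mathlib

open SimpleGraph Set List

namespace Paper

variable {V : Type} {W : Type}

/-- The closed neighborhood `N[v]` of a vertex. -/
def closedNbhd (G : SimpleGraph V) (v : V) : Set V := insert v (G.neighborSet v)

/-- The degree of a vertex (as the number of its neighbors). -/
noncomputable def deg (G : SimpleGraph V) (v : V) : ℕ := (G.neighborSet v).ncard

/-- `G` contains `H` as an induced subgraph, i.e. some induced subgraph of `G` is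
isomorphic to `H`. -/
def ContainsInduced (G : SimpleGraph V) (H : SimpleGraph W) : Prop :=
  ∃ s : Set V, Nonempty (H ≃g G.induce s)

/-- `(A, C, B)` is a separation of `G`. -/
def IsSeparation (G : SimpleGraph V) (A C B : Set V) : Prop :=
  A ∪ C ∪ B = Set.univ ∧ Disjoint A C ∧ Disjoint A B ∧ Disjoint C B ∧
    ∀ a ∈ A, ∀ b ∈ B, ¬G.Adj a b

/-- `G` admits a star cutset. -/
def HasStarCutset (G : SimpleGraph V) : Prop :=
  ∃ A C B : Set V, IsSeparation G A C B ∧ A.Nonempty ∧ B.Nonempty ∧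
    ∃ v ∈ C, C ⊆ closedNbhd G v

/-- `G` admits a clique cutset. -/
def HasCliqueCutset (G : SimpleGraph V) : Prop :=
  ∃ A C B : Set V, IsSeparation G A C B ∧ A.Nonempty ∧ B.Nonempty ∧ G.IsClique C

/-- `D` is a connected component of `G \ X`: a maximal connected subset of `Xᶜ`. -/
def IsComponentOf (G : SimpleGraph V) (X : Set V) (D : Set V) : Prop :=
  D.Nonempty ∧ D ⊆ Xᶜ ∧ (G.induce D).Connected ∧
    ∀ D' : Set V, D ⊆ D' → D' ⊆ Xᶜ → (G.induce D').Connected → D' = D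

/-- An induced path in `G` ("path" in the paper always means induced path). -/
def IsIPath (G : SimpleGraph V) {u v : V} (P : G.Walk u v) : Prop :=
  P.IsPath ∧ P.toSubgraph.IsInduced

/-- A hole: an induced cycle of length at least four. -/
def IsHole (G : SimpleGraph V) {v : V} (c : G.Walk v v) : Prop :=
  c.IsCycle ∧ 4 ≤ c.length ∧ c.toSubgraph.IsInduced

/-- `G` is sparse: for every hole and every vertex not in it, there is an edge `ab` of the
hole containing all neighbors of the vertex in the hole. -/
def Sparse (G : SimpleGraph V) : Prop :=
  ∀ (v : V) (c : G.Walk v v), IsHole G c → ∀ x, x ∉ c.support →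
    ∃ a b, c.toSubgraph.Adj a b ∧ ∀ y ∈ c.support, G.Adj x y → y = a ∨ y = b

/-- `G` contains a pyramid (necessarily as an induced subgraph). -/
def ContainsPyramid (G : SimpleGraph V) : Prop :=
  ∃ (a b₁ b₂ b₃ : V) (P₁ : G.Walk a b₁) (P₂ : G.Walk a b₂) (P₃ : G.Walk a b₃),
    G.Adj b₁ b₂ ∧ G.Adj b₂ b₃ ∧ G.Adj b₁ b₃ ∧
    IsIPath G P₁ ∧ IsIPath G P₂ ∧ IsIPath G P₃ ∧
    1 ≤ P₁.length ∧ 1 ≤ P₂.length ∧ 1 ≤ P₃.length ∧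
    ¬(P₁.length = 1 ∧ P₂.length = 1) ∧ ¬(P₁.length = 1 ∧ P₃.length = 1) ∧
    ¬(P₂.length = 1 ∧ P₃.length = 1) ∧
    (∀ p ∈ P₁.support, p ≠ a → ∀ q ∈ P₂.support, q ≠ a →
      p ≠ q ∧ (G.Adj p q → p = b₁ ∧ q = b₂)) ∧
    (∀ p ∈ P₁.support, p ≠ a → ∀ q ∈ P₃.support, q ≠ a →
      p ≠ q ∧ (G.Adj p q → p = b₁ ∧ q = b₃)) ∧
    (∀ p ∈ P₂.support, p ≠ a → ∀ q ∈ P₃.support, q ≠ a →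
      p ≠ q ∧ (G.Adj p q → p = b₂ ∧ q = b₃))

/-- `G` contains a prism (necessarily as an induced subgraph). -/
def ContainsPrism (G : SimpleGraph V) : Prop :=
  ∃ (a₁ a₂ a₃ b₁ b₂ b₃ : V) (P₁ : G.Walk a₁ b₁) (P₂ : G.Walk a₂ b₂) (P₃ : G.Walk a₃ b₃),
    G.Adj a₁ a₂ ∧ G.Adj a₂ a₃ ∧ G.Adj a₁ a₃ ∧
    G.Adj b₁ b₂ ∧ G.Adj b₂ b₃ ∧ G.Adj b₁ b₃ ∧
    IsIPath G P₁ ∧ IsIPath G P₂ ∧ IsIPath G P₃ ∧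
    1 ≤ P₁.length ∧ 1 ≤ P₂.length ∧ 1 ≤ P₃.length ∧
    (∀ p ∈ P₁.support, ∀ q ∈ P₂.support,
      p ≠ q ∧ (G.Adj p q → (p = a₁ ∧ q = a₂) ∨ (p = b₁ ∧ q = b₂))) ∧
    (∀ p ∈ P₁.support, ∀ q ∈ P₃.support,
      p ≠ q ∧ (G.Adj p q → (p = a₁ ∧ q = a₃) ∨ (p = b₁ ∧ q = b₃))) ∧
    (∀ p ∈ P₂.support, ∀ q ∈ P₃.support,
      p ≠ q ∧ (G.Adj p q → (p = a₂ ∧ q = a₃) ∨ (p = b₂ ∧ q = b₃)))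

/-- `G` is very sparse: sparse, pyramid-free and prism-free. -/
def VerySparse (G : SimpleGraph V) : Prop :=
  Sparse G ∧ ¬ContainsPyramid G ∧ ¬ContainsPrism G

/-- `G ∈ 𝓕_t`: `G` is very sparse with no clique of size at least `t+1`. -/
def MemF (t : ℕ) (G : SimpleGraph V) : Prop :=
  VerySparse G ∧ ∀ s : Set V, G.IsClique s → s.ncard ≤ t

/-- `G` has a tree decomposition of width at most `k`. -/
def HasTreewidthAtMost (G : SimpleGraph V) (k : ℕ) : Prop :=
  ∃ (ι : Type) (T : SimpleGraph ι) (χ : ι → Finset V),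
    T.IsTree ∧
    (∀ v : V, ∃ t, v ∈ χ t) ∧
    (∀ u v : V, G.Adj u v → ∃ t, u ∈ χ t ∧ v ∈ χ t) ∧
    (∀ v : V, (T.induce {t | v ∈ χ t}).Connected) ∧
    ∀ t, (χ t).card ≤ k + 1

/-- The `n`-by-`n` wall, as a brick wall graph: `n` rows of `2n` vertices each,
with horizontal path edges in each row, and vertical edges between consecutive
rows placed alternately. -/
def Wall (n : ℕ) : SimpleGraph (Fin n × Fin (2 * n)) :=
  SimpleGraph.fromRel (fun a b =>
    (a.1 = b.1 ∧ a.2.val + 1 = b.2.val) ∨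
    (a.2 = b.2 ∧ a.1.val + 1 = b.1.val ∧ (a.1.val + a.2.val) % 2 = 0))

/-- The graph obtained from `G` by subdividing the edge `uv` once (the new vertex
is `none`). -/
def subdivideEdge (G : SimpleGraph V) (u v : V) : SimpleGraph (Option V) :=
  SimpleGraph.fromRel (fun a b =>
    (∃ x y : V, a = some x ∧ b = some y ∧ G.Adj x y ∧ ¬(x = u ∧ y = v) ∧ ¬(x = v ∧ y = u)) ∨
    (a = none ∧ (b = some u ∨ b = some v)))

/-- `IsSubdivision G H`: `G` is (isomorphic to) a graph obtained from `H` by repeatedly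
subdividing edges. -/
inductive IsSubdivision : {α : Type} → SimpleGraph α → {β : Type} → SimpleGraph β → Prop where
  | base {α β : Type} {G : SimpleGraph α} {H : SimpleGraph β} :
      Nonempty (G ≃g H) → IsSubdivision G H
  | step {α β : Type} {G : SimpleGraph α} {H : SimpleGraph β} (u v : β) :
      H.Adj u v → IsSubdivision G (subdivideEdge H u v) → IsSubdivision G H

/-- `G` contains a subdivision of the `t`-by-`t` wall as an induced subgraph. -/
def ContainsWallSubdiv (G : SimpleGraph V) (t : ℕ) : Prop :=
  ∃ (α : Type) (S : SimpleGraph α), IsSubdivision S (Wall t) ∧ ContainsInduced G S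

/-- `G` contains the line graph of a subdivision of the `t`-by-`t` wall as an induced
subgraph. -/
def ContainsLineWallSubdiv (G : SimpleGraph V) (t : ℕ) : Prop :=
  ∃ (α : Type) (S : SimpleGraph α), IsSubdivision S (Wall t) ∧
    ContainsInduced G S.lineGraph

/-- `G` is `𝓣₁`-free: no vertex has two or more neighbors in a hole not containing it. -/
def T1Free (G : SimpleGraph V) : Prop :=
  ∀ (v : V) (c : G.Walk v v), IsHole G c → ∀ x, x ∉ c.support →
    ∀ y z, y ∈ c.support → z ∈ c.support → G.Adj x y → G.Adj x z → y = z

/-- `G` is `𝓣₂`-free: no vertex has two non-adjacent neighbors in a hole not containing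
it, and `G` is pyramid-free and prism-free. -/
def T2Free (G : SimpleGraph V) : Prop :=
  (∀ (v : V) (c : G.Walk v v), IsHole G c → ∀ x, x ∉ c.support →
    ∀ y z, y ∈ c.support → z ∈ c.support → G.Adj x y → G.Adj x z → y ≠ z → G.Adj y z) ∧
  ¬ContainsPyramid G ∧ ¬ContainsPrism G

/-- The weight `w(X)` of a set of vertices. -/
noncomputable def setW (w : V → ℝ) (X : Set V) : ℝ := ∑ᶠ x ∈ X, w x

/-- `w` is a weight function on `G`: values in `[0,1]` with total weight `1`. -/
def IsWeightFn (w : V → ℝ) : Prop :=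
  (∀ v, 0 ≤ w v ∧ w v ≤ 1) ∧ setW w Set.univ = 1

/-- `X` is a `(w, c)`-balanced separator. -/
def IsBalSep (G : SimpleGraph V) (w : V → ℝ) (c : ℝ) (X : Set V) : Prop :=
  ∀ D, IsComponentOf G X D → setW w D ≤ c

/-- `(G, w)` is `d`-unbalanced: `w` is a weight function and there is no
`(w, 1/2)`-balanced separator of size at most `d`. -/
def Unbalanced (G : SimpleGraph V) (w : V → ℝ) (d : ℕ) : Prop :=
  IsWeightFn w ∧ ∀ X : Set V, X.ncard ≤ d → ¬IsBalSep G w (1 / 2 : ℝ) X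

/-- `B = B(K₁,K₂)` is the (unique) component of `G ∖ (K₁ ∪ K₂)` of weight more
than `1/2`.  Then `A(K₁,K₂) = (B ∪ K₁ ∪ K₂)ᶜ` and `S(K₁,K₂) = (A, K₁ ∪ K₂, B)` is the
canonical two-clique-separation for `{K₁, K₂}`. -/
def IsCanonicalB (G : SimpleGraph V) (w : V → ℝ) (K₁ K₂ B : Set V) : Prop :=
  IsComponentOf G (K₁ ∪ K₂) B ∧ (1 / 2 : ℝ) < setW w B

/-- The open neighborhood `N(D)` of a set of vertices. -/
def nbhdOfSet (G : SimpleGraph V) (D : Set V) : Set V :=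
  {v | v ∉ D ∧ ∃ d ∈ D, G.Adj v d}

/-- The canonical two-clique-separation `S(K₁,K₂)` (with big side `B`) is proper. -/
def ProperPair (G : SimpleGraph V) (w : V → ℝ) (K₁ K₂ B : Set V) : Prop :=
  IsCanonicalB G w K₁ K₂ B ∧
  (∃ D, IsComponentOf G (K₁ ∪ K₂) D ∧ D ⊆ (B ∪ K₁ ∪ K₂)ᶜ ∧
    K₁ ∪ K₂ ⊆ nbhdOfSet G D) ∧
  (K₁.ncard = 1 → K₂.ncard = 1 →
    ¬∃ (x y : V) (P : G.Walk x y), K₁ = {x} ∧ K₂ = {y} ∧ IsIPath G P ∧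
      {v | v ∈ P.support} = (B ∪ K₁ ∪ K₂)ᶜ ∪ K₁ ∪ K₂)

/-- The canonical two-clique-separation `S(K₁,K₂)` (with big side `B`) is active,
where `K` bounds the size of the cliques considered. -/
def ActivePair (G : SimpleGraph V) (w : V → ℝ) (K : ℕ) (K₁ K₂ B : Set V) : Prop :=
  ProperPair G w K₁ K₂ B ∧
  ∀ K₁' K₂' B' : Set V, G.IsClique K₁' → G.IsClique K₂' →
    K₁'.ncard ≤ K → K₂'.ncard ≤ K → ProperPair G w K₁' K₂' B' →
    K₁ ∪ K₂ ≠ K₁' ∪ K₂' →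
      ¬(B' ∪ K₁' ∪ K₂' ⊂ B ∪ K₁ ∪ K₂) ∧
      (B' ∪ K₁' ∪ K₂' = B ∪ K₁ ∪ K₂ → B' ⊂ B)

/-- The interiors of two paths from `a` to `b` are disjoint and anticomplete. -/
def IntDisjAnti (G : SimpleGraph V) {a b : V} (P Q : G.Walk a b) : Prop :=
  ∀ x ∈ P.support, x ≠ a → x ≠ b → ∀ y ∈ Q.support, y ≠ a → y ≠ b → x ≠ y ∧ ¬G.Adj x y

/-- `Q₁, Q₂, Q₃` form a theta (as an induced subgraph of `G`) with ends `a, b`. -/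
def ThetaCfg (G : SimpleGraph V) {a b : V} (Q₁ Q₂ Q₃ : G.Walk a b) : Prop :=
  ¬G.Adj a b ∧
  IsIPath G Q₁ ∧ IsIPath G Q₂ ∧ IsIPath G Q₃ ∧
  2 ≤ Q₁.length ∧ 2 ≤ Q₂.length ∧ 2 ≤ Q₃.length ∧
  IntDisjAnti G Q₁ Q₂ ∧ IntDisjAnti G Q₁ Q₃ ∧ IntDisjAnti G Q₂ Q₃

/-- There is a theta through the seagull `a-v-u` in `G`: a theta one of whose ends is
`a` or `u` and which contains the seagull. -/
def ThetaThroughSeagull (G : SimpleGraph V) (a v u : V) : Prop :=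
  (∃ (b : V) (Q₁ Q₂ Q₃ : G.Walk a b), ThetaCfg G Q₁ Q₂ Q₃ ∧ [a, v, u] <+: Q₁.support) ∨
  (∃ (b : V) (Q₁ Q₂ Q₃ : G.Walk u b), ThetaCfg G Q₁ Q₂ Q₃ ∧ [u, v, a] <+: Q₁.support)

/-- `a-v-u` is a heavy seagull in `G`: an induced three-vertex path whose ends both
have degree at least three. -/
def HeavySeagull (G : SimpleGraph V) (a v u : V) : Prop :=
  a ≠ u ∧ G.Adj a v ∧ G.Adj v u ∧ ¬G.Adj a u ∧ 3 ≤ deg G a ∧ 3 ≤ deg G u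

end Paper
namespace Paper
variable {V : Type}

def RR (G : SimpleGraph V) (s : Set V) (x y : V) : Prop :=
  x ∈ s ∧ Relation.ReflTransGen (fun a b => G.Adj a b ∧ b ∈ s) x y
def Cn (G : SimpleGraph V) (s : Set V) : Prop := ∀ x ∈ s, ∀ y ∈ s, RR G s x y
def comp (G : SimpleGraph V) (s : Set V) (x : V) : Set V := {y | RR G s x y}
def Att (G : SimpleGraph V) (x : V) (s : Set V) : Prop := ∃ y ∈ s, G.Adj x y
def Touch (G : SimpleGraph V) (s t : Set V) : Prop := ∃ x ∈ s, ∃ y ∈ t, x = y ∨ G.Adj x y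
def Anti (G : SimpleGraph V) (s t : Set V) : Prop := ∀ x ∈ s, ∀ y ∈ t, ¬ G.Adj x y

variable {G Ga : SimpleGraph V} {s t : Set V} {x y z : V}

theorem RR.left (h : RR G s x y) : x ∈ s := h.1
theorem RR.right (h : RR G s x y) : y ∈ s := by
  rcases h.2.cases_tail with ac | ⟨c, _, ac⟩
  · rw [ac]; exact h.1
  · exact ac.2
theorem RR.refl (h : x ∈ s) : RR G s x x := ⟨h, .refl⟩
theorem RR.trans (h : RR G s x y) (ad : RR G s y z) : RR G s x z := ⟨h.1, h.2.trans ad.2⟩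
theorem RR.adj (hx : x ∈ s) (hy : y ∈ s) (h : G.Adj x y) : RR G s x y :=
  ⟨hx, .single ⟨h, hy⟩⟩
theorem RR.tail (h : RR G s x y) (hz : z ∈ s) (ha : G.Adj y z) : RR G s x z :=
  h.trans (.adj h.right hz ha)
theorem RR.mono (h : RR G s x y) (hst : s ⊆ t) : RR G t x y :=
  ⟨hst h.1, Relation.ReflTransGen.mono (fun _ _ hab => ⟨hab.1, hst hab.2⟩) _ _ h.2⟩
theorem RR.monoG (h : RR G s x y) (hst : G ≤ Ga) : RR Ga s x y :=
  ⟨h.1, Relation.ReflTransGen.mono (fun _ _ hab => ⟨hst hab.1, hab.2⟩) _ _ h.2⟩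
theorem RR.ind {P : V → Prop} (h : RR G s x y) (bb : P x)
    (aa : ∀ a b, RR G s x a → P a → b ∈ s → G.Adj a b → P b) : P y := by
  obtain ⟨hx, h⟩ := h
  induction h with
  | refl => exact bb
  | tail hab hbc ih => exact aa _ _ ⟨hx, hab⟩ ih hbc.2 hbc.1
theorem RR.symm (h : RR G s x y) : RR G s y x := by
  refine h.ind (P := fun y => RR G s y x) (RR.refl h.left) ?_
  intro a b ha hp hb hab
  exact (RR.adj hb ha.right hab.symm).trans hp
theorem RR.exit (h : RR G s x y) {T : Set V} (hx : x ∈ T) (hy : y ∉ T) :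
    ∃ a b, a ∈ T ∧ a ∈ s ∧ b ∈ s ∧ b ∉ T ∧ G.Adj a b ∧ RR G (s ∩ T) x a := by
  by_contra hc
  refine hy ?_
  have : y ∈ T ∧ RR G (s ∩ T) x y := by
    refine h.ind (P := fun y => y ∈ T ∧ RR G (s ∩ T) x y) ⟨hx, RR.refl ⟨h.left, hx⟩⟩ ?_
    intro a b ha hp hb hab
    have hbT : b ∈ T := by
      by_contra ak
      exact hc ⟨a, b, hp.1, ha.right, hb, ak, hab, hp.2⟩
    exact ⟨hbT, hp.2.tail ⟨hb, hbT⟩ hab⟩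
  exact this.1

theorem RR.closed (h : RR G s x y) {T : Set V} (hx : x ∈ T)
    (hT : ∀ a ∈ T, a ∈ s → ∀ b ∈ s, G.Adj a b → b ∈ T) : y ∈ T := by
  by_contra hy
  obtain ⟨a, b, aa, ac, ah, aj, am, _⟩ := h.exit hx hy
  grind

theorem RR.inComp (h : RR G s x y) : RR G (comp G s x) x y := by
  refine h.ind (P := fun y => RR G (comp G s x) x y) (RR.refl (RR.refl h.left)) ?_
  intro a b ha hp hb hab
  exact hp.tail (ha.tail hb hab) hab

theorem Cn.of_center (h : ∀ y ∈ s, RR G s x y) : Cn G s :=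
  fun a ha b hb => (h a ha).symm.trans (h b hb)
theorem Cn_singleton (x : V) : Cn G {x} := by
  intro a ha b hb; rw [mem_singleton_iff] at ha hb; subst ha; subst hb; exact RR.refl rfl
theorem Cn_comp : Cn G (comp G s x) := Cn.of_center (x := x) fun _ h => RR.inComp h
theorem comp_sub : comp G s x ⊆ s := fun _ h => h.right
theorem mem_comp (h : x ∈ s) : x ∈ comp G s x := RR.refl h
theorem comp_step (hy : y ∈ comp G s x) (hz : z ∈ s) (h : G.Adj y z) : z ∈ comp G s x :=
  RR.tail hy hz h
theorem Cn.sub_comp (h : Cn G t) (hts : t ⊆ s) (hy : y ∈ t) (hyc : y ∈ comp G s x) :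
    t ⊆ comp G s x := fun z hz => RR.trans hyc ((h y hy z hz).mono hts)
theorem comp_eq (h : y ∈ comp G s x) : comp G s y = comp G s x := by
  ext z; exact ⟨fun hz => RR.trans h hz, fun hz => (RR.symm h).trans hz⟩
theorem Cn.monoG (h : Cn G s) (hg : G ≤ Ga) : Cn Ga s := fun a ha b hb => (h a ha b hb).monoG hg
theorem Cn.union (hs : Cn G s) (ht : Cn G t) (h : Touch G s t) : Cn G (s ∪ t) := by
  obtain ⟨a, ha, b, hb, hab⟩ := h
  have cz : RR G (s ∪ t) a b := by
    rcases hab with rfl | hab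
    · exact RR.refl (.inl ha)
    · exact RR.adj (.inl ha) (.inr hb) hab
  refine Cn.of_center (x := a) ?_
  rintro y (hy | hy)
  · exact (hs a ha y hy).mono subset_union_left
  · exact cz.trans ((ht b hb y hy).mono subset_union_right)
theorem Cn.insert (hs : Cn G s) (h : Att G x s) : Cn G (insert x s) := by
  obtain ⟨y, hy, hxy⟩ := h
  rw [← Set.singleton_union]
  exact (Cn_singleton x).union hs ⟨x, rfl, y, hy, .inr hxy⟩
theorem Touch.symm (h : Touch G s t) : Touch G t s := by
  obtain ⟨a, ha, b, hb, hab⟩ := h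
  exact ⟨b, hb, a, ha, hab.imp Eq.symm (fun h => h.symm)⟩
theorem Touch.mono {sa tb : Set V} (h : Touch G s t) (aa : s ⊆ sa) (ac : t ⊆ tb) : Touch G sa tb := by
  obtain ⟨a, ha, b, hb, hab⟩ := h
  exact ⟨a, aa ha, b, ac hb, hab⟩
theorem Att.mono (h : Att G x s) (hst : s ⊆ t) : Att G x t := by
  obtain ⟨y, hy, h⟩ := h; exact ⟨y, hst hy, h⟩
theorem Anti.symm (h : Anti G s t) : Anti G t s := fun x hx y hy hxy => h y hy x hx hxy.symm
theorem Anti.mono {sa tb : Set V} (h : Anti G s t) (aa : sa ⊆ s) (ac : tb ⊆ t) : Anti G sa tb :=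
  fun x hx y hy => h x (aa hx) y (ac hy)

def IsP (G : SimpleGraph V) (s : Set V) (n : ℕ) (g : ℕ → V) : Prop :=
  (∀ i ≤ n, g i ∈ s) ∧ ∀ i < n, G.Adj (g i) (g (i + 1))

theorem IsP.rr {n : ℕ} {g : ℕ → V} (h : IsP G s n g) {i j : ℕ} (hij : i ≤ j) (hj : j ≤ n) :
    RR G (g '' Set.Icc i j) (g i) (g j) := by
  induction j, hij using Nat.le_induction with
  | base => exact RR.refl ⟨i, by simp, rfl⟩
  | succ k hk ih =>
    refine ((ih (by omega)).mono (Set.image_mono (Set.Icc_subset_Icc_right (by omega)))).tail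
      ⟨k+1, ⟨by omega, le_rfl⟩, rfl⟩ (h.2 k (by omega))

theorem IsP.cn {n : ℕ} {g : ℕ → V} (h : IsP G s n g) {i j : ℕ} (hj : j ≤ n) :
    Cn G (g '' Set.Icc i j) := by
  refine Cn.of_center (x := g i) ?_
  rintro _ ⟨k, hk, rfl⟩
  exact (h.rr hk.1 (hk.2.trans hj)).mono (Set.image_mono (Set.Icc_subset_Icc_right hk.2))

theorem RR.toP (h : RR G s x y) : ∃ n g, IsP G s n g ∧ g 0 = x ∧ g n = y := by
  refine h.ind (P := fun y => ∃ n g, IsP G s n g ∧ g 0 = x ∧ g n = y) ?_ ?_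
  · exact ⟨0, fun _ => x, ⟨fun _ _ => h.left, by simp⟩, rfl, rfl⟩
  · rintro a b - ⟨n, g, ⟨aa, ac⟩, ah, aj⟩ hb hab
    refine ⟨n+1, fun i => if i ≤ n then g i else b, ⟨?_, ?_⟩, by simpa using ah, by simp⟩
    all_goals grind

def IsSP (G : SimpleGraph V) (s X Y : Set V) (n : ℕ) (g : ℕ → V) : Prop :=
  IsP G s n g ∧ g 0 ∈ X ∧ g n ∈ Y ∧ (∀ i ≤ n, ∀ j ≤ n, G.Adj (g i) (g j) → i + 1 = j ∨ j + 1 = i) ∧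
  (∀ i ≤ n, g i ∈ X → i = 0) ∧ (∀ i ≤ n, g i ∈ Y → i = n) ∧ ∀ i ≤ n, ∀ j ≤ n, g i = g j → i = j

theorem exists_SP {X Y : Set V} (hx : x ∈ X) (hy : y ∈ Y) (h : RR G s x y) :
    ∃ n g, IsSP G s X Y n g := by
  classical
  have hex : ∃ n, ∃ g, IsP G s n g ∧ g 0 ∈ X ∧ g n ∈ Y := by
    obtain ⟨n, g, aa, ac, ah⟩ := h.toP
    grind
  set n := Nat.find hex with hn
  obtain ⟨g, hg, hX, hY⟩ := Nat.find_spec hex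
  have hmin : ∀ m gd, IsP G s m gd → gd 0 ∈ X → gd m ∈ Y → n ≤ m :=
    fun m gd aa ac ah => Nat.find_min' hex ⟨gd, aa, ac, ah⟩
  rw [← hn] at hg hY
  have hinj : ∀ i j, i < j → j ≤ n → g i ≠ g j := by
    intro i j hij hj he
    have := hmin (n-(j-i)) (fun k => if k ≤ i then g k else g (k+(j-i))) ⟨?_, ?_⟩ (by simpa using hX) ?_
    · omega
    · intro k hk; dsimp only; split_ifs
      · exact hg.1 k (by omega)
      · exact hg.1 _ (by omega)
    · intro k hk; dsimp only
      rcases lt_trichotomy k i with h | h | h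
      · rw [if_pos h.le, if_pos (by omega)]; exact hg.2 k (by omega)
      · rw [if_pos h.le, if_neg (by omega), h, he]
        rw [(by omega : i + 1 + (j-i) = j + 1)]; exact hg.2 j (by omega)
      · rw [if_neg (by omega), if_neg (by omega)]
        rw [(by omega : k + 1 + (j-i) = k + (j - i) + 1)]; exact hg.2 _ (by omega)
    grind
  have hind : ∀ i j, i + 1 < j → j ≤ n → ¬ G.Adj (g i) (g j) := by
    intro i j hij hj he
    have := hmin (n-(j-i-1)) (fun k => if k ≤ i then g k else g (k+(j-i-1))) ⟨?_, ?_⟩ (by simpa using hX) ?_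
    · omega
    · intro k hk; dsimp only; split_ifs
      · exact hg.1 k (by omega)
      · exact hg.1 _ (by omega)
    · intro k hk; dsimp only
      rcases lt_trichotomy k i with h | h | h
      · rw [if_pos h.le, if_pos (by omega)]; exact hg.2 k (by omega)
      · grind
      · rw [if_neg (by omega), if_neg (by omega)]
        rw [(by omega : k + 1 + (j-i-1) = k + (j - i-1) + 1)]; exact hg.2 _ (by omega)
    grind
  refine ⟨n, g, hg, hX, hY, ?_, ?_, ?_, ?_⟩
  · intro i hi j hj hij
    by_contra hc
    rcases lt_trichotomy i j with h | h | h
    · exact hind i j (by omega) hj hij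
    · subst h; exact hij.ne rfl
    · exact hind j i (by omega) hi hij.symm
  · intro i hi hiX
    by_contra hc
    have := hmin (n - i) (fun k => g (k + i)) ⟨fun k hk => hg.1 _ (by omega), ?_⟩ (by simpa using hiX) ?_
    · omega
    · intro k hk; dsimp only
      rw [(by omega : k + 1 + i = k + i + 1)]; exact hg.2 _ (by omega)
    grind
  · intro i hi hiY
    have := hmin i g ⟨fun k hk => hg.1 _ (by omega), fun k hk => hg.2 _ (by omega)⟩ hX hiY
    omega
  grind

theorem Cn.connected (h : Cn G s) (hne : s.Nonempty) : (G.induce s).Connected := by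
  have : Nonempty s := hne.to_subtype
  rw [SimpleGraph.connected_iff]
  refine ⟨?_, inferInstance⟩
  rintro ⟨a, ha⟩ ⟨b, hb⟩
  refine (h a ha b hb).ind (P := fun b => ∀ hb : b ∈ s, (G.induce s).Reachable ⟨a, ha⟩ ⟨b, hb⟩)
    (fun _ => Reachable.refl _) ?_ hb
  intro c d hc hp hd hcd _
  exact (hp hc.right).trans (Adj.reachable (by simpa using hcd))

theorem RR_of_reachable {a b : s} (h : (G.induce s).Reachable a b) : RR G s a b := by
  rw [SimpleGraph.reachable_iff_reflTransGen] at h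
  induction h with
  | refl => exact RR.refl a.2
  | tail _ h ih => exact ih.tail (Subtype.property _) (by simpa using h)


end Paper

namespace Paper
variable {V : Type} {G : SimpleGraph V}

theorem walk_of_fun (h : ℕ → V) (n : ℕ) (hadj : ∀ i < n, G.Adj (h i) (h (i + 1))) :
    ∃ p : G.Walk (h 0) (h n), p.support = (List.range (n + 1)).map h ∧
      p.edges = (List.range n).map (fun i => s(h i, h (i + 1))) := by
  induction n with
  | zero => exact ⟨Walk.nil, by simp⟩
  | succ n ih =>
    obtain ⟨p, hp, he⟩ := ih (fun i hi => hadj i (by omega))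
    refine ⟨p.concat (hadj n (by omega)), ?_, ?_⟩
    · rw [Walk.support_concat, hp, List.range_succ (n := n + 1)]; simp
    · rw [Walk.edges_concat, he, List.range_succ]; simp

theorem hole_of_fun (hT : T1Free G) (N : ℕ) (hN : 4 ≤ N) (h : ℕ → V)
    (inj : ∀ i < N, ∀ j < N, h i = h j → i = j)
    (hadj : ∀ i, i + 1 < N → G.Adj (h i) (h (i + 1))) (hlast : G.Adj (h (N - 1)) (h 0))
    (ind : ∀ i j, i < j → j < N → G.Adj (h i) (h j) → j = i + 1 ∨ (i = 0 ∧ j + 1 = N))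
    (v : V) (hv : ∀ i < N, v ≠ h i) (i j : ℕ) (hi : i < N) (hj : j < N)
    (hvi : G.Adj v (h i)) (hvj : G.Adj v (h j)) : h i = h j := by
  obtain ⟨p, hp, he⟩ := walk_of_fun h (N - 1) (fun i hi => hadj i (by omega))
  rw [(by omega : N - 1 + 1 = N)] at hp
  have hmem : ∀ x, x ∈ p.support ↔ ∃ i < N, h i = x := by
    intro x; rw [hp]; simp
  have hpath : p.IsPath := by
    rw [Walk.isPath_def, hp]
    refine List.Nodup.map_on ?_ List.nodup_range
    grind
  have hcyc : (Walk.cons hlast p).IsCycle := by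
    rw [Walk.cons_isCycle_iff]
    refine ⟨hpath, ?_⟩
    rw [he]
    intro hm
    obtain ⟨k, hk, bw⟩ := List.mem_map.1 hm
    rw [List.mem_range] at hk
    rw [Sym2.eq_iff] at bw
    grind
  have hedge : ∀ i j, i < j → j < N → G.Adj (h i) (h j) →
      (Walk.cons hlast p).toSubgraph.Adj (h i) (h j) := by
    intro i j hij hj hadj
    rw [Walk.adj_toSubgraph_iff_mem_edges, Walk.edges_cons, he]
    rcases ind i j hij hj hadj with rfl | ⟨rfl, ac⟩
    · refine List.mem_cons_of_mem _ (List.mem_map.2 ⟨i, ?_, rfl⟩)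
      simp; omega
    · rw [(by omega : j = N - 1), Sym2.eq_swap]; exact List.mem_cons_self
  have hhole : IsHole G (Walk.cons hlast p) := by
    refine ⟨hcyc, ?_, ?_⟩
    · have := congrArg List.length hp
      simp at this
      simp; omega
    · intro a ha b hb hab
      rw [Walk.mem_verts_toSubgraph] at ha hb
      have key : ∀ a, a ∈ (Walk.cons hlast p).support → ∃ i < N, h i = a := by
        intro a ha
        rw [Walk.support_cons, List.mem_cons] at ha
        rcases ha with rfl | ha
        · exact ⟨N-1, by omega, rfl⟩
        · exact (hmem a).1 ha
      obtain ⟨i, hi, rfl⟩ := key a ha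
      obtain ⟨j, hj, rfl⟩ := key b hb
      rcases lt_trichotomy i j with h | h | h
      · exact hedge i j h hj hab
      · subst h; exact absurd rfl hab.ne
      · exact (hedge j i h hi hab.symm).symm
  have hsup : ∀ i < N, h i ∈ (Walk.cons hlast p).support := by
    grind
  refine hT _ _ hhole v ?_ _ _ (hsup i hi) (hsup j hj) hvi hvj
  rw [Walk.support_cons, List.mem_cons, hmem]
  rintro (aa | ⟨k, hk, rfl⟩)
  all_goals grind

def HP (G : SimpleGraph V) : Prop := ∀ (Zb Za : Set V) (a b : V), Cn G Zb → Cn G Za →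
  Anti G Zb Za → Disjoint Zb Za → a ≠ b → ¬ G.Adj a b → a ∉ Zb → a ∉ Za → b ∉ Zb → b ∉ Za →
  Att G a Zb → Att G a Za → Att G b Zb → Att G b Za →
  ∃ Zc ⊆ Zb, ∃ Zd ⊆ Za, Cn G Zc ∧ Cn G Zd ∧ Att G a Zc ∧ Att G a Zd ∧ Att G b Zc ∧ Att G b Zd ∧
    ∀ v, v ∉ Zc → v ∉ Zd → v ≠ a → v ≠ b → ∀ p q, (p ∈ Zc ∨ p ∈ Zd ∨ p = a ∨ p = b) →
      (q ∈ Zc ∨ q ∈ Zd ∨ q = a ∨ q = b) → G.Adj v p → G.Adj v q → p = q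

theorem hp_path {Z : Set V} {a b : V} (hZ : Cn G Z) (ha : Att G a Z) (hb : Att G b Z) :
    ∃ n g, IsSP G Z {x | G.Adj a x} {x | G.Adj b x} n g := by
  obtain ⟨x, hx, hax⟩ := ha
  obtain ⟨y, hy, hby⟩ := hb
  exact exists_SP (x := x) (y := y) hax hby (hZ x hx y hy)

theorem hp_of_T1Free (hT : T1Free G) : HP G := by
  intro Zb Za a b c1 c2 anti disj hab nab a1 a2 bo bx bc bz bj au
  obtain ⟨n, g, ⟨pe, pk⟩, gc, gn, gind, ga, gb, ginj⟩ := hp_path c1 bc bj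
  obtain ⟨m, f, ⟨ph, pl⟩, fc, fm, find, fa, fb, finj⟩ := hp_path c2 bz au
  refine ⟨g '' Set.Icc 0 n, ?_, f '' Set.Icc 0 m, ?_, IsP.cn ⟨pe, pk⟩ le_rfl, IsP.cn ⟨ph, pl⟩ le_rfl,
    ⟨g 0, ⟨0, by simp, rfl⟩, gc⟩, ⟨f 0, ⟨0, by simp, rfl⟩, fc⟩, ⟨g n, ⟨n, by simp, rfl⟩, gn⟩,
    ⟨f m, ⟨m, by simp, rfl⟩, fm⟩, ?_⟩
  · rintro _ ⟨i, hi, rfl⟩; exact pe i hi.2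
  · rintro _ ⟨i, hi, rfl⟩; exact ph i hi.2
  intro v vd ve va vb
  simp only [Set.mem_ofPred_eq] at gc gn fc fm ga gb fa fb
  have gne : ∀ i ≤ n, ∀ j ≤ m, g i ≠ f j := fun i hi j hj h =>
    Set.disjoint_left.1 disj (pe i hi) (h ▸ ph j hj)
  have gna : ∀ i ≤ n, ∀ j ≤ m, ¬ G.Adj (g i) (f j) := fun i hi j hj => anti _ (pe i hi) _ (ph j hj)
  have ag : ∀ i ≤ n, g i ≠ a := fun i hi h => a1 (h ▸ pe i hi)
  have af : ∀ i ≤ m, f i ≠ a := fun i hi h => a2 (h ▸ ph i hi)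
  have bg : ∀ i ≤ n, g i ≠ b := fun i hi h => bo (h ▸ pe i hi)
  have bf : ∀ i ≤ m, f i ≠ b := fun i hi h => bx (h ▸ ph i hi)
  set h : ℕ → V := fun i => if i = 0 then a else if i ≤ n + 1 then g (i - 1) else
    if i = n + 2 then b else f (m - (i - n - 3)) with hh
  have h_a : h 0 = a := by simp [hh]
  have h_g : ∀ i ≤ n, h (i + 1) = g i := by intro i hi; simp [hh, hi]
  have h_b : h (n + 2) = b := by simp [hh]
  have h_f : ∀ i ≤ m, h (n + 3 + (m - i)) = f i := by
    intro i hi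
    simp only [hh]
    rw [if_neg (by omega), if_neg (by omega), if_neg (by omega)]
    congr 1; omega
  have cases4 : ∀ i < n + m + 4, i = 0 ∨ (∃ k ≤ n, i = k + 1) ∨ i = n + 2 ∨ ∃ k ≤ m, i = n + 3 + (m - k) := by
    intro i hi
    by_cases aa : i = 0
    · exact .inl aa
    by_cases ac : i ≤ n + 1
    · exact .inr (.inl ⟨i - 1, by omega, by omega⟩)
    by_cases ah : i = n + 2
    · exact .inr (.inr (.inl ah))
    · exact .inr (.inr (.inr ⟨m - (i - n - 3), by omega, by omega⟩))
  have hk := hole_of_fun hT (n + m + 4) (by omega) h ?_ ?_ ?_ ?_ v ?_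
  · have hidx : ∀ p, (p ∈ g '' Set.Icc 0 n ∨ p ∈ f '' Set.Icc 0 m ∨ p = a ∨ p = b) →
        ∃ i < n + m + 4, h i = p := by
      rintro p (⟨i, hi, rfl⟩ | ⟨i, hi, rfl⟩ | rfl | rfl)
      · exact ⟨i + 1, by have := hi.2; omega, h_g i hi.2⟩
      · exact ⟨n + 3 + (m - i), by omega, h_f i hi.2⟩
      · exact ⟨0, by omega, h_a⟩
      · exact ⟨n + 2, by omega, h_b⟩
    intro p q hp hq hvp hvq
    obtain ⟨i, hi, rfl⟩ := hidx p hp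
    obtain ⟨j, hj, rfl⟩ := hidx q hq
    exact hk i j hi hj hvp hvq
  · intro i hi j hj hij
    clear_value h
    rcases cases4 i hi with rfl | ⟨k, hk, rfl⟩ | rfl | ⟨k, hk, rfl⟩ <;>
    rcases cases4 j hj with rfl | ⟨l, hl, rfl⟩ | rfl | ⟨l, hl, rfl⟩ <;>
    grind
  · intro i hi
    rcases cases4 i (by omega) with rfl | ⟨k, hk, rfl⟩ | rfl | ⟨k, hk, rfl⟩
    · grind
    · rw [h_g k hk]
      by_cases hkn : k = n
      · subst hkn; rw [h_b]; exact gn.symm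
      · rw [h_g (k+1) (by omega)]; exact pk k (by omega)
    · grind
    · have := h_f (k - 1) (by omega)
      rw [h_f k hk, (by omega : n + 3 + (m - k) + 1 = n + 3 + (m - (k - 1))), this]
      have := pl (k - 1) (by omega)
      rw [(by omega : k - 1 + 1 = k)] at this
      exact this.symm
  · grind [adj_comm]
  · intro i j hij hj hadj
    clear_value h
    rcases cases4 i (by omega) with rfl | ⟨k, hk, rfl⟩ | rfl | ⟨k, hk, rfl⟩ <;>
    rcases cases4 j hj with rfl | ⟨l, hl, rfl⟩ | rfl | ⟨l, hl, rfl⟩ <;>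
    grind [SimpleGraph.Adj.symm]
  · intro i hi
    rcases cases4 i (by omega) with rfl | ⟨k, hk, rfl⟩ | rfl | ⟨k, hk, rfl⟩
    · rw [h_a]; exact va
    · rw [h_g _ hk]; rintro rfl; exact vd ⟨k, ⟨by omega, hk⟩, rfl⟩
    · rw [h_b]; exact vb
    · rw [h_f _ hk]; rintro rfl; exact ve ⟨k, ⟨by omega, hk⟩, rfl⟩

theorem HP.false (hG : HP G) {Zb Za : Set V} {a b v : V} (c1 : Cn G Zb) (c2 : Cn G Za)
    (anti : Anti G Zb Za) (disj : Disjoint Zb Za) (hab : a ≠ b) (nab : ¬ G.Adj a b) (a1 : a ∉ Zb)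
    (a2 : a ∉ Za) (bo : b ∉ Zb) (bx : b ∉ Za) (bc : Att G a Zb) (bz : Att G a Za)
    (bj : Att G b Zb) (au : Att G b Za) (vd : v ∉ Zb) (ve : v ∉ Za) (hva : G.Adj v a)
    (hvb : G.Adj v b) : False := by
  obtain ⟨Zc, aa, Zd, ac, -, -, -, -, -, -, h⟩ :=
    hG Zb Za a b c1 c2 anti disj hab nab a1 a2 bo bx bc bz bj au
  exact hab (h v (fun h => vd (aa h)) (fun h => ve (ac h)) hva.ne hvb.ne a b (by tauto) (by tauto) hva hvb)

end Paper

namespace Paper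
variable {V : Type} {G : SimpleGraph V}

structure IsLk (G : SimpleGraph V) (A B : Set V) (n : ℕ) (len : Fin n → ℕ) (p : Fin n → ℕ → V) : Prop where
  st : ∀ i, p i 0 ∈ A
  en : ∀ i, p i (len i) ∈ B
  adj : ∀ i, ∀ k < len i, G.Adj (p i k) (p i (k + 1))
  inj : ∀ i j k l, k ≤ len i → l ≤ len j → p i k = p j l → i = j ∧ k = l

def Lk (G : SimpleGraph V) (A B : Set V) (n : ℕ) : Prop := ∃ len p, IsLk G A B n len p

def Sep (G : SimpleGraph V) (A B : Set V) (S : Finset V) : Prop :=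
  ∀ a ∈ A, ∀ b ∈ B, ¬ RR G (↑S : Set V)ᶜ a b

theorem IsLk.rev {A B : Set V} {n : ℕ} {len : Fin n → ℕ} {p : Fin n → ℕ → V} (h : IsLk G A B n len p) :
    IsLk G B A n len (fun i k => p i (len i - k)) where
  st i := h.en i
  en i := by simpa using h.st i
  adj i k hk := by
    have := h.adj i (len i - k - 1) (by omega)
    grind [adj_comm]
  inj i j k l hk hl he := by
    obtain ⟨rfl, ac⟩ := h.inj i j _ _ (by omega) (by omega) he
    exact ⟨rfl, by omega⟩

theorem Lk.symm {A B : Set V} {n : ℕ} (h : Lk G A B n) : Lk G B A n := by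
  obtain ⟨len, p, h⟩ := h; exact ⟨_, _, h.rev⟩

theorem IsLk.mono {Ga : SimpleGraph V} {A B Aa B' : Set V} {n : ℕ} {len : Fin n → ℕ} {p : Fin n → ℕ → V}
    (h : IsLk G A B n len p)
    (hG : G ≤ Ga) (hA : A ⊆ Aa) (hB : B ⊆ B') : IsLk Ga Aa B' n len p :=
  ⟨fun i => hA (h.st i), fun i => hB (h.en i), fun i k hk => hG (h.adj i k hk), h.inj⟩

theorem Lk.mono {Ga : SimpleGraph V} {A B Aa B' : Set V} {n : ℕ} (h : Lk G A B n)
    (hG : G ≤ Ga) (hA : A ⊆ Aa) (hB : B ⊆ B') : Lk Ga Aa B' n := by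
  obtain ⟨len, p, h⟩ := h
  exact ⟨len, p, h.mono hG hA hB⟩

theorem IsLk.isP {A B : Set V} {n : ℕ} {len : Fin n → ℕ} {p : Fin n → ℕ → V}
    (h : IsLk G A B n len p) (i : Fin n) : IsP G Set.univ (len i) (p i) :=
  ⟨fun _ _ => trivial, h.adj i⟩

theorem IsLk.rr {A B : Set V} {n : ℕ} {len : Fin n → ℕ} {p : Fin n → ℕ → V}
    (h : IsLk G A B n len p) (i : Fin n) {j k : ℕ} (hjk : j ≤ k) (hk : k ≤ len i) :
    RR G (p i '' Set.Icc j k) (p i j) (p i k) := (h.isP i).rr hjk hk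

theorem IsLk.reindex {A B : Set V} {n m : ℕ} {len : Fin n → ℕ} {p : Fin n → ℕ → V}
    (h : IsLk G A B n len p) (f : Fin m → Fin n) (hf : Function.Injective f) :
    IsLk G A B m (fun i => len (f i)) (fun i => p (f i)) :=
  ⟨fun i => h.st _, fun i => h.en _, fun i => h.adj _, fun i j k l hk hl he => by
    obtain ⟨aa, ac⟩ := h.inj _ _ k l hk hl he
    exact ⟨hf aa, ac⟩⟩

theorem Lk.of_le {A B : Set V} {n m : ℕ} (h : Lk G A B n) (hm : m ≤ n) : Lk G A B m := by
  obtain ⟨len, p, h⟩ := h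
  exact ⟨_, _, h.reindex (Fin.castLE hm) (Fin.castLE_injective hm)⟩


theorem adj_delete {x y u w : V} (h : G.Adj u w) (ad : ¬ (G.deleteEdges {s(x, y)}).Adj u w) :
    (u = x ∧ w = y) ∨ (u = y ∧ w = x) := by
  rw [SimpleGraph.deleteEdges_adj] at ad
  grind

theorem menger_half [DecidableEq V] {A B : Set V} {x y : V} {S : Finset V}
    (hS : Sep (G.deleteEdges {s(x, y)}) A B S)
    (hy : ∃ b ∈ B, RR (G.deleteEdges {s(x, y)}) (↑S : Set V)ᶜ y b) {X : Finset V}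
    (hX : Sep (G.deleteEdges {s(x, y)}) A ((insert x S : Finset V) : Set V) X) : Sep G A B X := by
  set Ga := G.deleteEdges {s(x, y)}
  intro a ha b hb hab
  have hT : ∀ v, RR Ga (↑X : Set V)ᶜ a v → v ∉ S ∧ v ≠ x := by
    intro v hv
    have := fun h => hX a ha v h hv
    simp at this
    tauto
  have hTS : ∀ v, RR Ga (↑X : Set V)ᶜ a v → RR Ga (↑S : Set V)ᶜ a v := by
    intro v hv
    refine hv.inComp.mono ?_
    intro w hw
    exact (hT w hw).1
  by_cases hbT : RR Ga (↑X : Set V)ᶜ a b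
  · exact hS a ha b hb (hTS b hbT)
  · obtain ⟨u, w, hu, -, hw, hwT, huw, -⟩ := hab.exit (T := comp Ga (↑X : Set V)ᶜ a)
      (RR.refl hab.left) hbT
    have := adj_delete (x := x) (y := y) huw (fun h => hwT (comp_step hu hw h))
    rcases this with ⟨aa, ac⟩ | ⟨aa, ac⟩
    · exact (hT u hu).2 aa
    · subst aa
      obtain ⟨ba, ak, hyb⟩ := hy
      exact hS a ha ba ak ((hTS _ hu).trans hyb)

theorem menger [Finite V] (G : SimpleGraph V) (A B : Set V) (n : ℕ)
    (h : ∀ S : Finset V, Sep G A B S → n ≤ S.card) : Lk G A B n := by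
  classical
  induction G using WellFoundedLT.induction generalizing A B with
  | ind G ih =>
  have := Fintype.ofFinite V
  by_cases hG : ∀ x y, ¬ G.Adj x y
  · have := h ((A ∩ B).toFinset) (by
      intro a ha b hb hab
      have : b = a := hab.closed (T := {a}) rfl (fun c _ _ d _ hcd => absurd hcd (hG c d))
      subst this
      have := hab.left
      simp [ha, hb] at this)
    obtain ⟨f⟩ : Nonempty (Fin n ↪ (A ∩ B).toFinset) := by
      rw [Function.Embedding.nonempty_iff_card_le]; rw [Fintype.card_fin, Fintype.card_coe]; exact this
    have hm : ∀ i, (f i : V) ∈ A ∩ B := fun i => by have := (f i).2; rwa [Set.mem_toFinset] at this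
    refine ⟨fun _ => 0, fun i _ => f i, fun i => (hm i).1, fun i => (hm i).2, by simp, ?_⟩
    grind
  push Not at hG
  obtain ⟨xc, yd, fv⟩ := hG
  set Ga := G.deleteEdges {s(xc, yd)} with bs
  have hle : Ga ≤ G := SimpleGraph.deleteEdges_le _
  have hlt : Ga < G := by
    refine lt_of_le_of_ne hle ?_
    simp_all
  by_cases hS : ∀ S : Finset V, Sep Ga A B S → n ≤ S.card
  · exact (ih Ga hlt A B hS).mono hle subset_rfl subset_rfl
  push Not at hS
  obtain ⟨S, hS, hSn⟩ := hS
  have hnS : ¬ Sep G A B S := fun hc => by have := h S hc; omega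
  unfold Sep at hnS
  push Not at hnS
  obtain ⟨a, ha, b, hb, hab⟩ := hnS
  have hxy : ∃ x y, s(xc, yd) = s(x, y) ∧ G.Adj x y ∧ (∃ a ∈ A, RR Ga (↑S : Set V)ᶜ x a) ∧
      ∃ b ∈ B, RR Ga (↑S : Set V)ᶜ y b := by
    obtain ⟨u, w, ⟨a1, bc, hu⟩, -, hw, hwT, huw, -⟩ := hab.exit (T := {v | ∃ a ∈ A, RR Ga (↑S : Set V)ᶜ v a})
      ⟨a, ha, RR.refl hab.left⟩ (by rintro ⟨ai, ao, ad⟩; exact hS ai ao b hb ad.symm)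
    obtain ⟨ua, wc, ⟨bo, bj, ce⟩, -, dd, fw, fx, -⟩ := hab.symm.exit (T := {v | ∃ a ∈ B, RR Ga (↑S : Set V)ᶜ v a})
      ⟨b, hb, RR.refl hab.right⟩ (by rintro ⟨ai, ao, ad⟩; exact hS a ha ai ao ad)
    have ea := adj_delete (x := xc) (y := yd) huw (fun h => hwT ⟨a1, bc, (RR.adj hw hu.left h.symm).trans hu⟩)
    have eb := adj_delete (x := xc) (y := yd) fx (fun h => fw ⟨bo, bj, (RR.adj dd ce.left h.symm).trans ce⟩)
    have hne : u ≠ ua := by rintro rfl; exact hS a1 bc bo bj (hu.symm.trans ce)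
    grind
  obtain ⟨x, y, hexy, hadj, hxA, hyB⟩ := hxy
  rw [hexy] at bs
  clear hexy fv
  have hG'2 : Ga = G.deleteEdges {s(y, x)} := by rw [bs, Sym2.eq_swap]
  have hSs : ∀ {A B : Set V}, Sep Ga A B S → Sep Ga B A S := fun h a ha b hb hab => h b hb a ha hab.symm
  have La : Lk Ga A ((insert x S : Finset V) : Set V) n := by
    refine ih Ga hlt _ _ fun X hX => h X ?_
    rw [bs] at hS hyB hX
    exact menger_half hS hyB hX
  have Lb : Lk Ga ((insert y S : Finset V) : Set V) B n := by
    refine Lk.symm (ih Ga hlt _ _ fun X hX => h X ?_)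
    have em := hSs hS
    rw [hG'2] at em hxA hX
    have := menger_half em hxA hX
    exact fun a ha b hb hab => this b hb a ha hab.symm
  obtain ⟨la, P, hP⟩ := La
  obtain ⟨lb, Q, hQ⟩ := Lb
  obtain ⟨jg, jh, fy⟩ := hxA
  obtain ⟨eo, dp, fz⟩ := hyB
  have hxS : x ∉ S := fy.left
  have hyS : y ∉ S := fz.left
  have surP : ∀ s ∈ insert x S, ∃ i, P i (la i) = s := by
    have hinj : Function.Injective fun i => P i (la i) := fun i j he => (hP.inj i j _ _ le_rfl le_rfl he).1
    have := Finset.eq_of_subset_of_card_le (s := Finset.univ.image fun i => P i (la i)) (t := insert x S)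
      (by intro s hs; obtain ⟨i, -, rfl⟩ := Finset.mem_image.1 hs; exact_mod_cast hP.en i)
      (by rw [Finset.card_image_of_injective _ hinj]; have := Finset.card_insert_le x S; simp; omega)
    grind
  have surQ : ∀ s ∈ insert y S, ∃ i, Q i 0 = s := by
    have hinj : Function.Injective fun i => Q i 0 := fun i j he => (hQ.inj i j _ _ (Nat.zero_le _) (Nat.zero_le _) he).1
    have := Finset.eq_of_subset_of_card_le (s := Finset.univ.image fun i => Q i 0) (t := insert y S)
      (by intro s hs; obtain ⟨i, -, rfl⟩ := Finset.mem_image.1 hs; exact_mod_cast hQ.st i)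
      (by rw [Finset.card_image_of_injective _ hinj]; have := Finset.card_insert_le y S; simp; omega)
    grind
  have onlyP : ∀ i k, k ≤ la i → P i k ∈ insert x S → k = la i := by
    intro i k hk hm
    obtain ⟨j, hj⟩ := surP _ hm
    obtain ⟨rfl, ac⟩ := hP.inj _ _ _ _ le_rfl hk hj
    exact ac.symm
  have onlyQ : ∀ i k, k ≤ lb i → Q i k ∈ insert y S → k = 0 := by
    intro i k hk hm
    obtain ⟨j, hj⟩ := surQ _ hm
    obtain ⟨rfl, ac⟩ := hQ.inj _ _ _ _ (Nat.zero_le _) hk hj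
    exact ac.symm
  have cross : ∀ i j k l, k ≤ la i → l ≤ lb j → P i k = Q j l → P i k ∈ S := by
    intro i j k l hk hl he
    by_contra hc
    refine hS _ (hP.st i) _ (hQ.en j) (RR.trans (y := P i k)
      ((hP.rr i (Nat.zero_le k) hk).mono ?_) (he ▸ (hQ.rr j hl le_rfl).mono ?_))
    all_goals grind
  have hσ : ∀ i, ∃ j, ∃ δ : ℕ, (P i (la i) = x ∧ Q j 0 = y ∧ δ = 1) ∨ (P i (la i) ∈ S ∧ Q j 0 = P i (la i) ∧ δ = 0) := by
    intro i
    have := hP.en i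
    rw [Finset.mem_coe, Finset.mem_insert] at this
    rcases this with h | h
    · obtain ⟨j, hj⟩ := surQ y (by simp)
      grind
    · obtain ⟨j, hj⟩ := surQ _ (Finset.mem_insert_of_mem h)
      exact ⟨j, 0, .inr ⟨h, hj, rfl⟩⟩
  choose σ δ hσ using hσ
  have σinj : ∀ i j, σ i = σ j → i = j := by
    intro i j hij
    refine (hP.inj i j _ _ le_rfl le_rfl ?_).1
    grind
  have crossσ : ∀ i j k l, k ≤ la i → l ≤ lb (σ j) → P i k = Q (σ j) l → i = j ∧ k = la i ∧ l = 0 ∧ δ j = 0 := by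
    intro i j k l hk hl he
    have hs := cross i (σ j) k l hk hl he
    have aa := onlyP i k hk (Finset.mem_insert_of_mem hs)
    have ac := onlyQ (σ j) l hl (Finset.mem_insert_of_mem (he ▸ hs))
    subst aa; subst ac
    rcases hσ j with ⟨bp, bk, co⟩ | ⟨bp, bk, co⟩
    · grind
    · rw [bk] at he
      exact ⟨(hP.inj _ _ _ _ le_rfl le_rfl he).1, rfl, rfl, co⟩
  refine ⟨fun i => la i + δ i + lb (σ i), fun i k => if k ≤ la i then P i k else Q (σ i) (k - la i - δ i), ?_, ?_, ?_, ?_⟩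
  · intro i; simpa using hP.st i
  · intro i
    try dsimp only
    split_ifs with aa
    · have bb : δ i = 0 := by omega
      have ac : lb (σ i) = 0 := by omega
      have := hQ.en (σ i)
      grind
    · rw [(by omega : la i + δ i + lb (σ i) - la i - δ i = lb (σ i))]; exact hQ.en _
  · intro i k hk
    try dsimp only at hk ⊢
    rcases lt_trichotomy k (la i) with aa | aa | aa
    · rw [if_pos aa.le, if_pos (by omega)]; exact hle (hP.adj i k aa)
    · rw [if_pos aa.le, if_neg (by omega), aa]
      rcases hσ i with ⟨bp, bk, co⟩ | ⟨bp, bk, co⟩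
      · grind
      · rw [← bk, co, (by omega : la i + 1 - la i - 0 = 0 + 1)]; exact hle (hQ.adj _ 0 (by omega))
    · have : δ i ≤ 1 := by rcases hσ i with ⟨_, _, h⟩ | ⟨_, _, h⟩ <;> omega
      rw [if_neg (by omega), if_neg (by omega)]
      rw [(by omega : k + 1 - la i - δ i = k - la i - δ i + 1)]; exact hle (hQ.adj _ _ (by omega))
  · intro i j k l hk hl he
    have db : ∀ i, δ i ≤ 1 := by intro i; rcases hσ i with ⟨_, _, h⟩ | ⟨_, _, h⟩ <;> omega
    have := db i
    have := db j
    try dsimp only at hk hl he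
    split_ifs at he with aa ac ac
    · exact hP.inj i j k l aa ac he
    · have := crossσ i j k _ aa (by omega) he
      omega
    · have := crossσ j i l _ ac (by omega) he.symm
      omega
    · obtain ⟨ah, aj⟩ := hQ.inj _ _ _ _ (by omega) (by omega) he
      grind

end Paper

namespace Paper
variable {V : Type} {G : SimpleGraph V}

structure Br (G : SimpleGraph V) (𝓑 : Set (Set V)) : Prop where
  cn : ∀ B ∈ 𝓑, Cn G B
  ne : ∀ B ∈ 𝓑, B.Nonempty
  touch : ∀ B ∈ 𝓑, ∀ C ∈ 𝓑, Touch G B C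

def Ord (𝓑 : Set (Set V)) (k : ℕ) : Prop :=
  ∀ X : Finset V, X.card < k → ∃ B ∈ 𝓑, Disjoint B (↑X : Set V)

theorem sum_acyclic {α β : Type} {S : SimpleGraph α} {T : SimpleGraph β} (hS : S.IsAcyclic) (hT : T.IsAcyclic) :
    (S ⊕g T).IsAcyclic := by
  rw [isAcyclic_iff_forall_adj_isBridge] at *
  rintro (a | a) (b | b) hab
  · rw [sum_adj_inl] at hab
    have := hS hab
    rw [isBridge_iff] at this ⊢
    refine fun hr => this ?_
    rw [reachable_iff_reflTransGen] at hr
    have : ∀ c, Relation.ReflTransGen ((S ⊕g T).deleteEdges {s(Sum.inl a, Sum.inl b)}).Adj (Sum.inl a) c →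
        ∃ ca, c = Sum.inl ca ∧ (S.deleteEdges {s(a, b)}).Reachable a ca := by
      intro c hc
      induction hc with
      | refl => exact ⟨a, rfl, Reachable.refl _⟩
      | tail _ h ih =>
        obtain ⟨ca, rfl, cc⟩ := ih
        rename_i d _
        rcases d with d | d
        · refine ⟨d, rfl, cc.trans (Adj.reachable ?_)⟩
          simpa [deleteEdges_adj] using h
        · simp [deleteEdges_adj] at h
    grind
  · simp at hab
  · simp at hab
  · rw [sum_adj_inr] at hab
    have := hT hab
    rw [isBridge_iff] at this ⊢
    refine fun hr => this ?_
    rw [reachable_iff_reflTransGen] at hr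
    have : ∀ c, Relation.ReflTransGen ((S ⊕g T).deleteEdges {s(Sum.inr a, Sum.inr b)}).Adj (Sum.inr a) c →
        ∃ ca, c = Sum.inr ca ∧ (T.deleteEdges {s(a, b)}).Reachable a ca := by
      intro c hc
      induction hc with
      | refl => exact ⟨a, rfl, Reachable.refl _⟩
      | tail _ h ih =>
        obtain ⟨ca, rfl, cc⟩ := ih
        rename_i d _
        rcases d with d | d
        · simp [deleteEdges_adj] at h
        · refine ⟨d, rfl, cc.trans (Adj.reachable ?_)⟩
          simpa [deleteEdges_adj] using h
    grind

theorem sum_tree {α β : Type} {S : SimpleGraph α} {T : SimpleGraph β} (hS : S.IsTree) (hT : T.IsTree) (a : α) (b : β) :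
    ((S ⊕g T) ⊔ edge (Sum.inl a) (Sum.inr b)).IsTree := by
  refine ⟨?_, ?_⟩
  · exact Connected.sum_sup_edge hS.1 hT.1
  · exact (sum_acyclic hS.2 hT.2).sup_edge_of_not_reachable (not_reachable_sum_inl_inr _ _)

def TD (G : SimpleGraph V) (U W : Finset V) (k : ℕ) : Prop :=
  ∃ (ι : Type) (T : SimpleGraph ι) (χ : ι → Finset V) (r : ι), T.IsTree ∧
    (∀ v ∈ U, ∃ t, v ∈ χ t) ∧ (∀ t, χ t ⊆ U) ∧
    (∀ u ∈ U, ∀ v ∈ U, G.Adj u v → ∃ t, u ∈ χ t ∧ v ∈ χ t) ∧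
    (∀ v ∈ U, Cn T {t | v ∈ χ t}) ∧ (∀ t, (χ t).card ≤ k) ∧ W ⊆ χ r

theorem TD.single {U : Finset V} {k : ℕ} (h : U.card ≤ k) : TD G U U k :=
  ⟨Unit, ⊥, fun _ => U, (), IsTree.of_subsingleton, fun v hv => ⟨(), hv⟩, fun _ => subset_rfl,
    fun u hu v hv _ => ⟨(), hu, hv⟩, fun v hv a ha b hb => RR.refl ha, fun _ => h, subset_rfl⟩

theorem RR.map {α β : Type} {S : SimpleGraph α} {T : SimpleGraph β} {s : Set α} {t : Set β} {x y : α}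
    (f : α → β) (hf : ∀ a b, S.Adj a b → T.Adj (f a) (f b)) (hst : ∀ a ∈ s, f a ∈ t)
    (h : RR S s x y) : RR T t (f x) (f y) := by
  refine h.ind (P := fun y => RR T t (f x) (f y)) (RR.refl (hst _ h.left)) ?_
  intro a b ha hp hb hab
  exact hp.tail (hst b hb) (hf _ _ hab)

theorem TD.glue [DecidableEq V] {Ua Ub Wa Wb : Finset V} {k : ℕ} (aa : TD G Ua Wa k) (ac : TD G Ub Wb k)
    (gf : Ua ∩ Ub ⊆ Wa) (gg : Ua ∩ Ub ⊆ Wb)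
    (hno : ∀ u ∈ Ua, u ∉ Ub → ∀ v ∈ Ub, v ∉ Ua → ¬ G.Adj u v) : TD G (Ua ∪ Ub) Wa k := by
  obtain ⟨ι1, Ta, χ1, rc, tc, gh, sc, ji, gj, c1, wd⟩ := aa
  obtain ⟨ι2, Tb, χ2, rb, td, gk, sd, gl, gm, c2, we⟩ := ac
  refine ⟨ι1 ⊕ ι2, _, Sum.elim χ1 χ2, Sum.inl rc, sum_tree tc td rc rb, ?_, ?_, ?_, ?_, ?_, wd⟩
  · intro v hv
    rcases Finset.mem_union.1 hv with h | h
    · obtain ⟨t, ht⟩ := gh v h; exact ⟨.inl t, ht⟩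
    · obtain ⟨t, ht⟩ := gk v h; exact ⟨.inr t, ht⟩
  · grind
  · intro u hu v hv huv
    have kb : u ∈ Ua → v ∈ Ua → ∃ t, u ∈ Sum.elim χ1 χ2 t ∧ v ∈ Sum.elim χ1 χ2 t := by
      simp_all
    have kc : u ∈ Ub → v ∈ Ub → ∃ t, u ∈ Sum.elim χ1 χ2 t ∧ v ∈ Sum.elim χ1 χ2 t := by
      intro h ad; obtain ⟨t, ht⟩ := gl u h v ad huv; exact ⟨.inr t, ht⟩
    grind [adj_comm]
  · intro v hv
    have rl : ∀ t tb, v ∈ χ1 t → v ∈ χ1 tb → RR ((Ta ⊕g Tb) ⊔ edge (Sum.inl rc) (Sum.inr rb))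
        {t | v ∈ Sum.elim χ1 χ2 t} (.inl t) (.inl tb) := by
      intro t tb h ad
      exact RR.map Sum.inl (fun a b hab => by left; simpa using hab) (fun a ha => ha) (gj v (sc t h) t h tb ad)
    have rr : ∀ t tb, v ∈ χ2 t → v ∈ χ2 tb → RR ((Ta ⊕g Tb) ⊔ edge (Sum.inl rc) (Sum.inr rb))
        {t | v ∈ Sum.elim χ1 χ2 t} (.inr t) (.inr tb) := by
      intro t tb h ad
      exact RR.map Sum.inr (fun a b hab => by left; simpa using hab) (fun a ha => ha) (gm v (sd t h) t h tb ad)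
    have rm : ∀ t tb, v ∈ χ1 t → v ∈ χ2 tb → RR ((Ta ⊕g Tb) ⊔ edge (Sum.inl rc) (Sum.inr rb))
        {t | v ∈ Sum.elim χ1 χ2 t} (.inl t) (.inr tb) := by
      intro t tb h ad
      have hv : v ∈ Ua ∩ Ub := Finset.mem_inter.2 ⟨sc t h, sd tb ad⟩
      have a1 := wd (gf hv)
      have a2 := we (gg hv)
      refine (rl t rc h a1).trans ((RR.adj (x := Sum.inl rc) (y := Sum.inr rb) a1 a2 ?_).trans (rr rb tb a2 ad))
      right; simp [edge_adj]
    rintro (t | t) ht (tb | tb) di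
    · exact rl t tb ht di
    · exact rm t tb ht di
    · exact (rm tb t di ht).symm
    · exact rr t tb ht di
  grind

theorem balanced [Finite V] {k : ℕ} (hno : ∀ 𝓑, Br G 𝓑 → ¬ Ord 𝓑 k) (W : Finset V) :
    ∃ X : Finset V, X.card < k ∧ ∀ x ∉ X, 2 * (comp G (↑X : Set V)ᶜ x ∩ W).ncard ≤ W.card := by
  classical
  by_contra hc
  push Not at hc
  choose f go ep using hc
  refine hno {B | ∃ X : Finset V, ∃ h : X.card < k, B = comp G (↑X : Set V)ᶜ (f X h)} ⟨?_, ?_, ?_⟩ ?_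
  · rintro _ ⟨X, h, rfl⟩; exact Cn_comp
  · rintro _ ⟨X, h, rfl⟩; exact ⟨_, mem_comp (go X h)⟩
  · rintro _ ⟨X, h, rfl⟩ _ ⟨Y, ad, rfl⟩
    have aa := ep X h
    have ac := ep Y ad
    by_contra hnt
    have hd : Disjoint (comp G (↑X : Set V)ᶜ (f X h) ∩ ↑W) (comp G (↑Y : Set V)ᶜ (f Y ad) ∩ ↑W) := by
      rw [Set.disjoint_left]
      intro z hz ap
      exact hnt ⟨z, hz.1, z, ap.1, .inl rfl⟩
    have ah := Set.ncard_union_eq hd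
    have aj : ((comp G (↑X : Set V)ᶜ (f X h) ∩ ↑W) ∪ (comp G (↑Y : Set V)ᶜ (f Y ad) ∩ ↑W)).ncard ≤ (W : Set V).ncard :=
      Set.ncard_le_ncard (by intro z hz; rcases hz with h | h <;> exact h.2)
    rw [Set.ncard_coe_finset] at aj
    omega
  · intro X hX
    refine ⟨_, ⟨X, hX, rfl⟩, ?_⟩
    rw [Set.disjoint_left]
    intro z hz
    exact comp_sub hz

theorem tw_main [Finite V] {k : ℕ} (hk : 1 ≤ k) (hno : ∀ 𝓑, Br G 𝓑 → ¬ Ord 𝓑 k) (n : ℕ) :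
    ∀ U W : Finset V, U.card = n → W ⊆ U → W.card ≤ 2 * k → TD G U W (3 * k) := by
  classical
  induction n using Nat.strong_induction_on with
  | _ n ih =>
  intro U Wc hU er hWk
  by_cases hsmall : U.card ≤ 3 * k
  · obtain ⟨ι, T, χ, r, aa, ac, ah, aj, am, aq, ci⟩ := TD.single (G := G) hsmall
    exact ⟨ι, T, χ, r, aa, ac, ah, aj, am, aq, er.trans ci⟩
  obtain ⟨W, hW0W, hWU, hWc⟩ := Finset.exists_subsuperset_card_eq er hWk (by omega)
  suffices TD G U W (3 * k) by
    obtain ⟨ι, T, χ, r, aa, ac, ah, aj, am, aq, ci⟩ := this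
    exact ⟨ι, T, χ, r, aa, ac, ah, aj, am, aq, hW0W.trans ci⟩
  obtain ⟨X, hX, hbal⟩ := balanced hno W
  set R := W ∪ (X ∩ U) with hR
  have hXU : (X ∩ U).card ≤ X.card := Finset.card_le_card Finset.inter_subset_left
  have hRc : R.card ≤ 3 * k := by
    grind
  set M : Set V := ↑U \ ↑X with hM
  have hMX : M ⊆ (↑X : Set V)ᶜ := fun z hz => hz.2
  suffices H : ∀ m, ∀ A : Finset V, (U \ A).card = m → R ⊆ A → A ⊆ U → TD G A R (3 * k) →
      (∀ a ∈ A, a ∉ R → comp G M a ⊆ A) → TD G U R (3 * k) by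
    obtain ⟨ι, T, χ, r, aa, ac, ah, aj, am, aq, ci⟩ := H _ R rfl subset_rfl
      (Finset.union_subset hWU Finset.inter_subset_right) (TD.single hRc) (fun a h ad => absurd h ad)
    exact ⟨ι, T, χ, r, aa, ac, ah, aj, am, aq, Finset.subset_union_left.trans ci⟩
  intro m
  induction m using Nat.strong_induction_on with
  | _ m ihm =>
  intro A hA hRA hAU hTD hclo
  by_cases es : A = U
  · rw [es] at hTD; exact hTD
  obtain ⟨y, hyU, hyA⟩ : ∃ y ∈ U, y ∉ A := by
    by_contra hc; push Not at hc; exact es (Finset.Subset.antisymm hAU hc)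
  have hyR : y ∉ R := fun h => hyA (hRA h)
  have hyX : y ∉ X := fun h => hyR (Finset.mem_union_right _ (Finset.mem_inter.2 ⟨h, hyU⟩))
  have hyM : y ∈ M := ⟨hyU, hyX⟩
  have := Fintype.ofFinite V
  set D : Finset V := (comp G M y).toFinset with hD
  have memD : ∀ z, z ∈ D ↔ z ∈ comp G M y := fun z => by rw [hD, Set.mem_toFinset]
  have hDU : D ⊆ U := fun z hz => (comp_sub ((memD z).1 hz)).1
  have hDX : ∀ z ∈ D, z ∉ X := fun z hz => (comp_sub ((memD z).1 hz)).2
  have hDW : (D ∩ W).card ≤ k := by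
    have aa := hbal y hyX
    have ac : (D ∩ W).card ≤ (comp G (↑X : Set V)ᶜ y ∩ ↑W).ncard := by
      rw [← Set.ncard_coe_finset]
      refine Set.ncard_le_ncard ?_
      intro z hz
      rw [Finset.coe_inter] at hz
      exact ⟨RR.mono ((memD z).1 hz.1) hMX, hz.2⟩
    omega
  have hWDc : (D ∩ W ∪ (X ∩ U)).card < 2 * k := by
    have := Finset.card_union_le (D ∩ W) (X ∩ U)
    omega
  have hDTD : TD G (D ∪ (X ∩ U)) (D ∩ W ∪ (X ∩ U)) (3 * k) := by
    refine ih _ ?_ _ _ rfl ?_ hWDc.le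
    · rw [← hU]
      refine Finset.card_lt_card (Finset.ssubset_iff_subset_ne.2
        ⟨Finset.union_subset hDU Finset.inter_subset_right, ?_⟩)
      intro he
      have : W ⊆ D ∩ W ∪ (X ∩ U) := by
        intro w hw
        have := hWU hw
        rw [← he] at this
        simp only [Finset.mem_union, Finset.mem_inter] at this ⊢
        tauto
      have := Finset.card_le_card this
      omega
    · exact Finset.union_subset_union Finset.inter_subset_left subset_rfl
  have hint : A ∩ (D ∪ (X ∩ U)) ⊆ D ∩ W ∪ (X ∩ U) := by
    intro z hz
    rw [Finset.mem_inter, Finset.mem_union] at hz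
    rcases hz with ⟨hzA, hzD | hzX⟩
    · by_cases hzR : z ∈ R
      · grind
      · have aa := hclo z hzA hzR
        rw [comp_eq ((memD z).1 hzD)] at aa
        exact absurd (aa (mem_comp hyM)) hyA
    · exact Finset.mem_union_right _ hzX
  have et := hTD.glue hDTD (hint.trans (Finset.union_subset_union Finset.inter_subset_right subset_rfl)) hint (by
    intro u hu ce v hv bd huv
    have huU := hAU hu
    simp only [Finset.mem_union, Finset.mem_inter, not_or, not_and] at ce hv
    have hvD : v ∈ D := by
      grind
    have huX : u ∉ X := fun h => ce.2 h huU
    exact ce.1 ((memD u).2 (comp_step ((memD v).1 hvD) ⟨huU, huX⟩ huv.symm)))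
  have hAX : A ∪ (D ∪ (X ∩ U)) = A ∪ D := by
    ext z
    have := @hRA z
    simp only [hR, Finset.mem_union, Finset.mem_inter] at this ⊢
    tauto
  rw [hAX] at et
  refine ihm _ ?_ (A ∪ D) rfl (hRA.trans Finset.subset_union_left) (Finset.union_subset hAU hDU) et ?_
  · rw [← hA]
    refine Finset.card_lt_card (Finset.ssubset_iff_subset_ne.2 ⟨Finset.sdiff_subset_sdiff subset_rfl Finset.subset_union_left, ?_⟩)
    intro he
    have : y ∈ U \ A := Finset.mem_sdiff.2 ⟨hyU, hyA⟩
    rw [← he, Finset.mem_sdiff, Finset.mem_union] at this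
    exact this.2 (.inr ((memD y).2 (mem_comp hyM)))
  · intro a ha haR
    rcases Finset.mem_union.1 ha with h | h
    · exact (hclo a h haR).trans (by simp)
    · rw [comp_eq ((memD a).1 h)]
      intro z hz
      exact Finset.mem_coe.2 (Finset.mem_union_right _ ((memD z).2 hz))

theorem tw_bramble [Finite V] {k : ℕ} (hk : 1 ≤ k) (h : ¬ HasTreewidthAtMost G (3 * k)) :
    ∃ 𝓑, Br G 𝓑 ∧ Ord 𝓑 k := by
  classical
  by_contra hno
  push Not at hno
  have := Fintype.ofFinite V
  obtain ⟨ι, T, χ, r, aa, ac, ah, aj, am, aq, ci⟩ := tw_main hk hno _ Finset.univ ∅ rfl (by simp) (by simp)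
  refine h ⟨ι, T, χ, aa, fun v => ac v (Finset.mem_univ v),
    fun u v => aj u (Finset.mem_univ u) v (Finset.mem_univ v), fun v => ?_, fun t => (aq t).trans (by omega)⟩
  exact (am v (Finset.mem_univ v)).connected (ac v (Finset.mem_univ v))

end Paper

namespace Paper
variable {V : Type} {G : SimpleGraph V}

theorem RR_induce {U : Set V} {s : Set U} {a b : U} :
    RR (G.induce U) s a b ↔ RR G (Subtype.val '' s) a b := by
  constructor
  · exact RR.map Subtype.val (fun a b hab => by simpa using hab) (fun a ha => ⟨a, ha, rfl⟩)
  · intro h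
    have key : ∀ c : V, RR G (Subtype.val '' s) a c → ∃ hc : c ∈ U, RR (G.induce U) s a ⟨c, hc⟩ := by
      intro c hc
      refine hc.ind (P := fun c => ∃ hc : c ∈ U, RR (G.induce U) s a ⟨c, hc⟩) ⟨a.2, ?_⟩ ?_
      · obtain ⟨ai, ao, he⟩ := h.left
        rw [Subtype.val_injective he] at ao
        exact RR.refl ao
      · rintro c _ - ⟨hc, hp⟩ ⟨d, hd, rfl⟩ hcd
        exact ⟨d.2, hp.tail hd (by simpa using hcd)⟩
    grind

theorem Cn_induce {U : Set V} {s : Set U} : Cn (G.induce U) s ↔ Cn G (Subtype.val '' s) := by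
  constructor
  · rintro h _ ⟨a, ha, rfl⟩ _ ⟨b, hb, rfl⟩
    exact RR_induce.1 (h a ha b hb)
  · intro h a ha b hb
    exact RR_induce.2 (h a ⟨a, ha, rfl⟩ b ⟨b, hb, rfl⟩)

theorem Att_induce {U : Set V} {s : Set U} {a : U} : Att (G.induce U) a s ↔ Att G a (Subtype.val '' s) := by
  constructor
  · rintro ⟨y, hy, h⟩; exact ⟨y, ⟨y, hy, rfl⟩, by simpa using h⟩
  · rintro ⟨_, ⟨y, hy, rfl⟩, h⟩; exact ⟨y, hy, by simpa using h⟩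

theorem HP.induce (h : HP G) (U : Set V) : HP (G.induce U) := by
  intro Zb Za a b c1 c2 anti disj hab nab a1 a2 bo bx bc bz bj au
  obtain ⟨Yb, aa, Ya, ac, db, dc, ea, eb, ec, ef, h⟩ := h (Subtype.val '' Zb) (Subtype.val '' Za) a b (Cn_induce.1 c1) (Cn_induce.1 c2)
    (by rintro _ ⟨x, hx, rfl⟩ _ ⟨y, hy, rfl⟩ hxy; exact anti x hx y hy (by simpa using hxy))
    ((Set.disjoint_image_iff Subtype.val_injective).2 disj)
    (fun h => hab (Subtype.ext h)) (by simpa using nab) (by simpa using a1) (by simpa using a2)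
    (by simpa using bo) (by simpa using bx) (Att_induce.1 bc) (Att_induce.1 bz)
    (Att_induce.1 bj) (Att_induce.1 au)
  have im : ∀ Y ⊆ U, (Subtype.val '' (Subtype.val ⁻¹' Y : Set U)) = Y := by
    intro Y hY; rw [Subtype.image_preimage_coe]; exact Set.inter_eq_right.2 hY
  have yc := im Yb (aa.trans (by rintro _ ⟨x, _, rfl⟩; exact x.2))
  have yb := im Ya (ac.trans (by rintro _ ⟨x, _, rfl⟩; exact x.2))
  refine ⟨Subtype.val ⁻¹' Yb, ?_, Subtype.val ⁻¹' Ya, ?_, ?_, ?_, ?_, ?_, ?_, ?_, ?_⟩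
  · intro z hz; obtain ⟨za, ap, he⟩ := aa hz; rwa [← Subtype.val_injective he]
  · intro z hz; obtain ⟨za, ap, he⟩ := ac hz; rwa [← Subtype.val_injective he]
  · rw [Cn_induce, yc]; exact db
  · rw [Cn_induce, yb]; exact dc
  · rw [Att_induce, yc]; exact ea
  · rw [Att_induce, yb]; exact eb
  · rw [Att_induce, yc]; exact ec
  · rw [Att_induce, yb]; exact ef
  · intro v vd ve va vb p q hp hq hvp hvq
    refine Subtype.ext (h v vd ve (fun h => va (Subtype.ext h)) (fun h => vb (Subtype.ext h)) p q ?_ ?_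
      (by simpa using hvp) (by simpa using hvq))
    · rcases hp with h | h | h | h
      · exact .inl h
      · exact .inr (.inl h)
      · subst h; simp
      · subst h; simp
    · grind

theorem contains_induce {U : Set V} {t : ℕ} (h : ContainsWallSubdiv (G.induce U) t) : ContainsWallSubdiv G t := by
  obtain ⟨α, S, hS, s, ⟨e⟩⟩ := h
  refine ⟨α, S, hS, Subtype.val '' s, ⟨e.trans ?_⟩⟩
  refine ⟨Equiv.Set.image _ s Subtype.val_injective, ?_⟩
  intro a b
  simp

theorem stepC_clique [Finite V] {k : ℕ} {𝓑 : Set (Set V)} (h𝓑 : Br G 𝓑) (hord : Ord 𝓑 k) {U : Set V}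
    (hU : ∀ B ∈ 𝓑, B ⊆ U) {K D : Set V} (hK : G.IsClique K) (hKU : K ⊆ U) (hDU : D ⊆ U \ K)
    (hD : ∀ a ∈ D, ∀ b ∈ U \ K, G.Adj a b → b ∈ D) {Ba : Set V} (cv : Ba ∈ 𝓑) (hB0D : Ba ⊆ D) :
    ∃ 𝓑', Br G 𝓑' ∧ Ord 𝓑' k ∧ ∀ B ∈ 𝓑', B ⊆ K ∪ D := by
  have hmeet : ∀ B ∈ 𝓑, (B ∩ (K ∪ D)).Nonempty := by
    intro B hB
    obtain ⟨b, hb, c, hc, h⟩ := h𝓑.touch B hB Ba cv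
    rcases h with rfl | h
    · exact ⟨b, hb, .inr (hB0D hc)⟩
    · by_cases hbK : b ∈ K
      · exact ⟨b, hb, .inl hbK⟩
      · exact ⟨b, hb, .inr (hD c (hB0D hc) b ⟨hU B hB hb, hbK⟩ h.symm)⟩
  have hmK : ∀ B ∈ 𝓑, ∀ b ∈ B, b ∉ K ∪ D → (B ∩ K).Nonempty := by
    intro B hB b hb hbK
    obtain ⟨z, hzB, hz⟩ := hmeet B hB
    obtain ⟨p, q, hp, hpB, hqB, hq, hpq, -⟩ := (h𝓑.cn B hB z hzB b hb).exit hz hbK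
    rcases hp with hp | hp
    · exact ⟨p, hpB, hp⟩
    grind
  refine ⟨(fun B => B ∩ (K ∪ D)) '' 𝓑, ⟨?_, ?_, ?_⟩, ?_, ?_⟩
  · rintro _ ⟨B, hB, rfl⟩ p hp q hq
    have := (h𝓑.cn B hB p hp.1 q hq.1).ind
      (P := fun v => v ∈ B ∧ (v ∈ K ∪ D → RR G (B ∩ (K ∪ D)) p v) ∧
        (v ∉ K ∪ D → ∃ κ ∈ K, RR G (B ∩ (K ∪ D)) p κ)) ⟨hp.1, fun _ => RR.refl hp, fun h => absurd hp.2 h⟩ ?_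
    · exact this.2.1 hq.2
    · rintro a b - ⟨haB, bc, bz⟩ hbB hab
      refine ⟨hbB, fun hb => ?_, fun hb => ?_⟩
      · by_cases ha : a ∈ K ∪ D
        · exact (bc ha).tail ⟨hbB, hb⟩ hab
        · obtain ⟨κ, hκ, hr⟩ := bz ha
          have hbK : b ∈ K := by
            grind [adj_comm]
          by_cases he : κ = b
          · subst he; exact hr
          · exact hr.tail ⟨hbB, hb⟩ (hK hκ hbK he)
      grind
  · grind
  · rintro _ ⟨B, hB, rfl⟩ _ ⟨C, hC, rfl⟩
    obtain ⟨b, hb, c, hc, hbc⟩ := h𝓑.touch B hB C hC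
    have hbot : (B ∩ K).Nonempty → (C ∩ K).Nonempty → Touch G (B ∩ (K ∪ D)) (C ∩ (K ∪ D)) := by
      rintro ⟨x, hx, hxK⟩ ⟨y, hy, hyK⟩
      refine ⟨x, ⟨hx, .inl hxK⟩, y, ⟨hy, .inl hyK⟩, ?_⟩
      tauto
    by_cases ak : b ∈ K ∪ D <;> by_cases cc : c ∈ K ∪ D
    · exact ⟨b, ⟨hb, ak⟩, c, ⟨hc, cc⟩, hbc⟩
    · refine hbot ⟨b, hb, ?_⟩ (hmK C hC c hc cc)
      grind
    · refine hbot (hmK B hB b hb ak) ⟨c, hc, ?_⟩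
      grind [adj_comm]
    grind
  · intro X hX
    obtain ⟨B, hB, hd⟩ := hord X hX
    exact ⟨_, ⟨B, hB, rfl⟩, hd.mono_left Set.inter_subset_left⟩
  grind

theorem stepC [Finite V] {k t : ℕ} (hHP : HP G) (hkt : t ≤ k) (hcl : ∀ K : Finset V, G.IsClique ↑K → K.card < t)
    {𝓑 : Set (Set V)} (h𝓑 : Br G 𝓑) (hord : Ord 𝓑 k) :
    ∃ U : Set V, (∃ 𝓑, Br G 𝓑 ∧ Ord 𝓑 k ∧ ∀ B ∈ 𝓑, B ⊆ U) ∧ (∀ K ⊆ U, G.IsClique K → Cn G (U \ K)) ∧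
      ∀ x ∈ U, ∀ y ∈ U, ∀ z ∈ U, G.Adj x y → G.Adj y z → G.Adj x z → False := by
  classical
  have := Fintype.ofFinite V
  have hex : ∃ n, ∃ U : Finset V, U.card = n ∧ ∃ 𝓑, Br G 𝓑 ∧ Ord 𝓑 k ∧ ∀ B ∈ 𝓑, B ⊆ ↑U :=
    ⟨_, Finset.univ, rfl, 𝓑, h𝓑, hord, by simp⟩
  obtain ⟨U, hUc, 𝓑, h𝓑, hord, hU⟩ := Nat.find_spec hex
  have hmin : ∀ Uc : Finset V, Uc.card < U.card → ¬ ∃ 𝓑, Br G 𝓑 ∧ Ord 𝓑 k ∧ ∀ B ∈ 𝓑, B ⊆ ↑Uc :=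
    fun Uc hlt h => Nat.find_min hex (hUc ▸ hlt) ⟨Uc, rfl, h⟩
  have hcut : ∀ K : Set V, K ⊆ ↑U → G.IsClique K → Cn G (↑U \ K) := by
    intro K hKU hK
    by_contra hc
    obtain ⟨Ba, cv, hd⟩ := hord K.toFinset (lt_of_lt_of_le (hcl _ (by simpa using hK)) hkt)
    obtain ⟨eo, dp⟩ := h𝓑.ne Ba cv
    have hB0U : Ba ⊆ ↑U \ K := fun z hz => ⟨hU Ba cv hz, fun h => Set.disjoint_left.1 hd hz (by simpa using h)⟩
    set D := comp G (↑U \ K) eo with hD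
    have gp : ∃ z ∈ (↑U \ K : Set V), z ∉ D := by
      by_contra h; push Not at h; exact hc (Cn.of_center h)
    obtain ⟨z, hz, hzD⟩ := gp
    have := stepC_clique h𝓑 hord hU hK hKU (D := D) comp_sub (fun a ha b hb hab => comp_step ha hb hab) cv
      ((h𝓑.cn Ba cv).sub_comp hB0U dp (mem_comp (hB0U dp)))
    refine hmin (K ∪ D).toFinset ?_ (by simpa using this)
    refine Finset.card_lt_card (Finset.ssubset_iff_subset_ne.2 ⟨?_, ?_⟩)
    · intro y hy
      rw [Set.mem_toFinset] at hy
      rcases hy with h | h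
      · exact hKU h
      · exact (comp_sub h).1
    grind
  have hUnc : ¬ G.IsClique (↑U : Set V) := by
    intro hc
    obtain ⟨B, hB, hd⟩ := hord U (lt_of_lt_of_le (hcl U hc) hkt)
    obtain ⟨b, hb⟩ := h𝓑.ne B hB
    grind
  refine ⟨↑U, ⟨𝓑, h𝓑, hord, hU⟩, hcut, ?_⟩
  intro p hp q hq r hr hpq hqr hpr
  obtain ⟨K, hKmem, hKmax⟩ := Finset.exists_max_image
    (Finset.univ.filter fun K : Finset V => G.IsClique (↑K : Set V) ∧ K ⊆ U ∧ 3 ≤ K.card) Finset.card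
    ⟨{p, q, r}, by
      rw [Finset.mem_filter]
      refine ⟨Finset.mem_univ _, ?_, ?_, ?_⟩
      · intro a ha b hb hab
        grind [adj_comm]
      · grind
      · rw [Finset.card_insert_of_notMem (by simp [hpq.ne, hpr.ne]), Finset.card_insert_of_notMem (by simp [hqr.ne])]; simp⟩
  simp only [Finset.mem_filter, Finset.mem_univ, true_and] at hKmem hKmax
  obtain ⟨hKc, hKU, jj⟩ := hKmem
  have hne : (U \ K).Nonempty := by
    grind
  obtain ⟨d, hd, hdmax⟩ := Finset.exists_max_image (U \ K) (fun d => (K.filter fun y => G.Adj d y).card) hne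
  rw [Finset.mem_sdiff] at hd
  obtain ⟨x, hxK, hxd⟩ : ∃ x ∈ K, ¬ G.Adj d x := by
    by_contra hc
    push Not at hc
    have := hKmax (insert d K) ⟨?_, ?_, ?_⟩
    · grind
    · rw [Finset.coe_insert]
      exact hKc.insert (fun b hb _ => hc b hb)
    all_goals grind
  have jk : x ≠ d := by rintro rfl; exact hd.2 hxK
  set Za := comp G {v | v ∈ U ∧ v ∉ K ∧ ¬ G.Adj x v} d with eu
  have hdm : d ∈ {v | v ∈ U ∧ v ∉ K ∧ ¬ G.Adj x v} := ⟨hd.1, hd.2, fun h => hxd h.symm⟩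
  have hZs : ∀ v ∈ Za, v ∈ U ∧ v ∉ K ∧ ¬ G.Adj x v := fun v hv => by have h := comp_sub hv; exact h
  have hcn := hcut (↑K \ {x}) (fun z hz => hKU hz.1) (hKc.subset Set.diff_subset)
  obtain ⟨e, da, heZ, -, hd'1, hd'2, dr, -⟩ := (hcn d ⟨hd.1, fun h => hd.2 h.1⟩ x ⟨hKU hxK, fun h => h.2 rfl⟩).exit
    (T := Za) (mem_comp hdm) (fun h => (hZs x h).2.1 hxK)
  have hd'x : da ≠ x := by rintro rfl; exact (hZs e heZ).2.2 dr.symm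
  have hd'K : da ∉ K := fun h => hd'1.2 ⟨h, hd'x⟩
  have hxd'a : G.Adj x da := by
    by_contra h
    exact hd'2 (comp_step heZ ⟨hd'1.1, hd'K, h⟩ dr)
  have key : ∀ y ∈ K, G.Adj d y → G.Adj da y := by
    intro y hy hdy
    by_contra hno
    have hyx : y ≠ x := by rintro rfl; exact hxd hdy
    obtain ⟨Yb, aa, Ya, ac, -, -, ea, eb, ec, ef, hv⟩ := hHP {x} Za y da (Cn_singleton x) Cn_comp
      (by rintro _ rfl v hv; exact (hZs v hv).2.2) (by
        grind)
      (by rintro rfl; exact hd'K hy) (fun h => hno h.symm) hyx (fun h => (hZs y h).2.1 hy)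
      hd'x hd'2 ⟨x, rfl, hKc hy hxK hyx⟩ ⟨d, mem_comp hdm, hdy.symm⟩ ⟨x, rfl, hxd'a.symm⟩ ⟨e, heZ, dr.symm⟩
    obtain ⟨z, hzK, hzx, hzy⟩ : ∃ z ∈ K, z ≠ x ∧ z ≠ y := by
      have : ¬ K ⊆ {x, y} := fun h => by
        have := Finset.card_le_card h
        have := Finset.card_le_two (a := x) (b := y)
        omega
      grind
    have bq : x ∈ Yb := by
      obtain ⟨w, hw, _⟩ := ea
      have := aa hw
      grind
    have := hv z (fun h => hzx (aa h)) (fun h => (hZs z (ac h)).2.1 hzK) hzy (by rintro rfl; exact hd'K hzK) x y (.inl bq)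
      (by tauto) (hKc hzK hxK hzx) (hKc hzK hy hzy)
    exact hyx this.symm
  have hlt := hdmax da (Finset.mem_sdiff.2 ⟨hd'1.1, hd'K⟩)
  have : (K.filter fun y => G.Adj d y).card < (K.filter fun y => G.Adj da y).card := by
    refine Finset.card_lt_card (Finset.ssubset_iff_subset_ne.2 ⟨?_, ?_⟩)
    · grind
    · intro he
      have : x ∈ K.filter fun y => G.Adj da y := Finset.mem_filter.2 ⟨hxK, hxd'a.symm⟩
      grind
  omega

structure Good (G : SimpleGraph V) (𝓑 : Set (Set V)) (k : ℕ) : Prop where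
  hp : HP G
  tf : ∀ x y z, G.Adj x y → G.Adj y z → G.Adj x z → False
  cut : ∀ K, G.IsClique K → Cn G Kᶜ
  br : Br G 𝓑
  ord : Ord 𝓑 k

theorem exists_good [Finite V] {k t : ℕ} (hHP : HP G) (hkt : t ≤ k) (hcl : ∀ K : Finset V, G.IsClique ↑K → K.card < t)
    {𝓑 : Set (Set V)} (h𝓑 : Br G 𝓑) (hord : Ord 𝓑 k) :
    ∃ U : Set V, ∃ 𝓑, Good (G.induce U) 𝓑 k := by
  classical
  obtain ⟨U, ⟨𝓑, h𝓑, hord, hU⟩, hcut, htf⟩ := stepC hHP hkt hcl h𝓑 hord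
  have im : ∀ Y ⊆ U, (Subtype.val '' (Subtype.val ⁻¹' Y : Set U)) = Y := by
    simp_all
  refine ⟨U, (fun B => Subtype.val ⁻¹' B) '' 𝓑, hHP.induce U, ?_, ?_, ⟨?_, ?_, ?_⟩, ?_⟩
  · intro x y z hxy hyz hxz
    exact htf x x.2 y y.2 z z.2 (by simpa using hxy) (by simpa using hyz) (by simpa using hxz)
  · intro K hK
    rw [Cn_induce]
    have := hcut (Subtype.val '' K) (by rintro _ ⟨x, _, rfl⟩; exact x.2) (by
      rintro _ ⟨x, hx, rfl⟩ _ ⟨y, hy, rfl⟩ hxy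
      have := hK hx hy (fun h => hxy (by rw [h]))
      simpa using this)
    convert this using 1
    ext z
    simp
  · rintro _ ⟨B, hB, rfl⟩
    rw [Cn_induce, im B (hU B hB)]; exact h𝓑.cn B hB
  · rintro _ ⟨B, hB, rfl⟩
    obtain ⟨b, hb⟩ := h𝓑.ne B hB
    exact ⟨⟨b, hU B hB hb⟩, hb⟩
  · rintro _ ⟨B, hB, rfl⟩ _ ⟨C, hC, rfl⟩
    obtain ⟨b, hb, c, hc, hbc⟩ := h𝓑.touch B hB C hC
    refine ⟨⟨b, hU B hB hb⟩, hb, ⟨c, hU C hC hc⟩, hc, ?_⟩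
    simp_all
  · intro X hX
    obtain ⟨B, hB, hd⟩ := hord (X.image Subtype.val) (lt_of_le_of_lt Finset.card_image_le hX)
    refine ⟨_, ⟨B, hB, rfl⟩, ?_⟩
    grind

end Paper

namespace Paper
variable {V : Type} {G : SimpleGraph V}

def NoSep (G : SimpleGraph V) (J : Set V) (a u : V) : Prop :=
  ∀ K, G.IsClique K → K ⊆ J → a ∉ K → u ∉ K → RR G (J \ K) a u

structure Twin (G : SimpleGraph V) (J : Set V) (a u : V) (Zb Za : Set V) : Prop where
  s1 : Zb ⊆ J
  s2 : Za ⊆ J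
  a1 : a ∉ Zb
  a2 : a ∉ Za
  u1 : u ∉ Zb
  u2 : u ∉ Za
  c1 : Cn G Zb
  c2 : Cn G Za
  an : Anti G Zb Za
  dj : Disjoint Zb Za
  ta1 : Att G a Zb
  ta2 : Att G a Za
  tu1 : Att G u Zb
  tu2 : Att G u Za

theorem Twin.swap {J : Set V} {a u : V} {Zb Za : Set V} (h : Twin G J a u Zb Za) : Twin G J a u Za Zb :=
  ⟨h.s2, h.s1, h.a2, h.a1, h.u2, h.u1, h.c2, h.c1, h.an.symm, h.dj.symm, h.ta2, h.ta1, h.tu2, h.tu1⟩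

theorem clique_sub {Z : Set V} (h : Z.Subsingleton) : G.IsClique Z := h.pairwise _
theorem clique_pair {x y : V} (h : G.Adj x y) : G.IsClique ({x, y} : Set V) := by
  simp_all

theorem tight {J S : Set V} {a u s : V} (haJ : a ∈ J) (haS : a ∉ S) (hS : ¬ RR G (J \ S) a u)
    (hs : RR G (J \ (S \ {s})) a u) : Att G s (comp G (J \ S) a) := by
  obtain ⟨p, b, hp, _, hb, hbT, hpb, _⟩ := hs.exit (T := comp G (J \ S) a) (mem_comp ⟨haJ, haS⟩) hS
  by_cases hbS : b ∈ S
  · have : b = s := by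
      grind
    subst this
    exact ⟨p, hp, hpb.symm⟩
  · exact absurd (comp_step hp ⟨hb.1, hbS⟩ hpb) hbT

theorem comp_anti {s : Set V} {a u : V} (h : ¬ RR G s a u) : Anti G (comp G s a) (comp G s u) := by
  intro p hp q hq hpq
  exact h ((RR.tail hp (comp_sub hq) hpq).trans (RR.symm hq))
theorem comp_disj {s : Set V} {a u : V} (h : ¬ RR G s a u) : Disjoint (comp G s a) (comp G s u) := by
  rw [Set.disjoint_left]
  intro p hp hq
  exact h (RR.trans hp (RR.symm hq))

theorem star_left_end {A Q : Set V} {a x kb kc p : V} (hk : G.Adj kb kc)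
    (hAQ : Anti G A Q) (dAQ : Disjoint A Q) (haA : a ∈ A) (hxA : x ∉ A) (hk1A : kb ∉ A) (hk2A : kc ∉ A)
    (hxQ : x ∉ Q) (hk1Q : kb ∉ Q) (hk2Q : kc ∉ Q) (cq : x ≠ kb) (cs : x ≠ kc) (hpQ : p ∈ Q)
    {Zb Za : Set V} (h : Twin G (A ∪ {x, kb, kc} ∪ Q) a p Zb Za) (hx : x ∈ Zb) (hK : kb ∈ Za ∨ kc ∈ Za)
    (hv : ∀ v, v ∉ Zb → v ∉ Za → v ≠ a → v ≠ p → ∀ pc q, (pc ∈ Zb ∨ pc ∈ Za ∨ pc = a ∨ pc = p) →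
      (q ∈ Zb ∨ q ∈ Za ∨ q = a ∨ q = p) → G.Adj v pc → G.Adj v q → pc = q) :
    ∃ Yb Ya, Yb ⊆ A ∪ {x} ∧ Ya ⊆ A ∪ {kb, kc} ∧ x ∈ Yb ∧ kb ∈ Ya ∧ kc ∈ Ya ∧ Cn G Yb ∧ Cn G Ya ∧
      a ∉ Yb ∧ a ∉ Ya ∧ Att G a Yb ∧ Att G a Ya ∧ Anti G Yb Ya ∧ Disjoint Yb Ya := by
  have hnot : ∀ z ∈ Zb, ∀ w ∈ Za, z ≠ w := fun z hz w hw ad => Set.disjoint_left.1 h.dj hz (ad ▸ hw)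
  have hk1Z : kb ∉ Zb := by
    intro ad
    rcases hK with ac | ac
    · exact hnot _ ad _ ac rfl
    · exact h.an _ ad _ ac hk
  have hk2Z : kc ∉ Zb := by
    intro ad
    rcases hK with ac | ac
    · exact h.an _ ad _ ac hk.symm
    · exact hnot _ ad _ ac rfl
  have hxZ : x ∉ Za := fun ad => hnot _ hx _ ad rfl
  have hnK : ∀ z ∈ Zb, ¬ G.Adj z kb ∧ ¬ G.Adj z kc := by
    intro z hz
    have ea : a ≠ kb := fun h => hk1A (h ▸ haA)
    have eb : a ≠ kc := fun h => hk2A (h ▸ haA)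
    have ec : p ≠ kb := fun h => hk1Q (h ▸ hpQ)
    have ef : p ≠ kc := fun h => hk2Q (h ▸ hpQ)
    constructor
    · intro hzk
      by_cases aa : kb ∈ Za
      · exact h.an _ hz _ aa hzk
      grind [adj_comm]
    · intro hzk
      by_cases aa : kc ∈ Za
      · exact h.an _ hz _ aa hzk
      grind [adj_comm]
  have haQ : ∀ q ∈ Q, ¬ G.Adj a q := fun q hq => hAQ a haA q hq
  have ev : ∀ z ∈ Zb, z ∉ Q → z ∈ A ∨ z = x := by
    intro z hz hzQ
    have aa : z ≠ kb := fun h => hk1Z (h ▸ hz)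
    have ac : z ≠ kc := fun h => hk2Z (h ▸ hz)
    have := h.s1 hz
    simp only [Set.mem_union, Set.mem_insert_iff, Set.mem_singleton_iff] at this; tauto
  have eu : ∀ z ∈ Za, z ∉ Q → z ∈ A ∨ z = kb ∨ z = kc := by
    intro z hz hzQ
    have aa : z ≠ x := fun h => hxZ (h ▸ hz)
    have := h.s2 hz
    grind
  obtain ⟨yc, ds, ew⟩ := h.ta1
  obtain ⟨yb, ex, ey⟩ := h.ta2
  have hy1Q : yc ∉ Q := fun h => haQ _ h ew
  have hy2Q : yb ∉ Q := fun h => haQ _ h ey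
  have rc : RR G (Zb \ Q) yc x := by
    by_contra hc
    obtain ⟨c, d, bl, -, hd, hdT, hcd, -⟩ := (h.c1 yc ds x hx).exit (T := comp G (Zb \ Q) yc)
      (mem_comp ⟨ds, hy1Q⟩) hc
    have hcs := comp_sub bl
    have hdQ : d ∈ Q := by
      by_contra hdQ; exact hdT (comp_step bl ⟨hd, hdQ⟩ hcd)
    rcases ev c hcs.1 hcs.2 with ad | ad
    · exact hAQ c ad d hdQ hcd
    · exact hc (ad ▸ bl)
  have rb : ∃ k, (k = kb ∨ k = kc) ∧ RR G (Za \ Q) yb k := by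
    by_contra hc
    have hkk : ∃ k, (k = kb ∨ k = kc) ∧ k ∈ Za := by
      grind
    obtain ⟨k, al, hkZ⟩ := hkk
    obtain ⟨c, d, bl, -, hd, hdT, hcd, -⟩ := (h.c2 yb ex k hkZ).exit (T := comp G (Za \ Q) yb)
      (mem_comp ⟨ex, hy2Q⟩) (fun ad => hc ⟨k, al, ad⟩)
    have hcs := comp_sub bl
    have hdQ : d ∈ Q := by
      by_contra hdQ; exact hdT (comp_step bl ⟨hd, hdQ⟩ hcd)
    rcases eu c hcs.1 hcs.2 with ad | ad
    · exact hAQ c ad d hdQ hcd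
    · exact hc ⟨c, ad, bl⟩
  obtain ⟨k, hkk, rb⟩ := rb
  set W := (Za \ Q) ∪ {kb, kc} with hW
  have rd : RR G W yb kb := by
    have re : RR G W yb k := rb.mono subset_union_left
    rcases hkk with rfl | rfl
    · exact re
    · exact re.tail (by simp [hW]) hk.symm
  have rf : RR G W yb kc := rd.tail (by simp [hW]) hk
  have hWs : ∀ w ∈ comp G W yb, w = kb ∨ w = kc ∨ (w ∈ Za ∧ w ∉ Q) := by
    intro w hw
    have := comp_sub hw
    simp only [hW, Set.mem_union, Set.mem_diff, Set.mem_insert_iff, Set.mem_singleton_iff] at this; tauto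
  refine ⟨comp G (Zb \ Q) yc, comp G W yb, ?_, ?_, rc, rd, rf, Cn_comp, Cn_comp,
    fun ad => h.a1 (comp_sub ad).1, ?_, ⟨yc, mem_comp ⟨ds, hy1Q⟩, ew⟩, ⟨yb, RR.refl rd.left, ey⟩, ?_, ?_⟩
  · intro z hz
    have := comp_sub hz
    rcases ev z this.1 this.2 with ad | ad
    · exact .inl ad
    · exact .inr ad
  · grind
  · intro ad
    rcases hWs a ad with ad | ad | ad
    · exact hk1A (ad ▸ haA)
    · exact hk2A (ad ▸ haA)
    · exact h.a2 ad.1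
  · intro z hz w hw hzw
    have ap := (comp_sub hz).1
    rcases hWs w hw with rfl | rfl | ad
    · exact (hnK z ap).1 hzw
    · exact (hnK z ap).2 hzw
    · exact h.an z ap w ad.1 hzw
  · rw [Set.disjoint_left]
    intro z hz hw
    have ap := (comp_sub hz).1
    rcases hWs z hw with rfl | rfl | ad
    all_goals grind

theorem star_left [Finite V] (hHP : HP G) (htf : ∀ x y z, G.Adj x y → G.Adj y z → G.Adj x z → False)
    {J S A U : Set V} {a u x kb kc : V} (hSm : ∀ v, v ∈ S ↔ v = x ∨ v = kb ∨ v = kc)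
    (hA : A = comp G (J \ S) a) (hU : U = comp G (J \ S) u) (haJ : a ∈ J) (huJ : u ∈ J) (hns : NoSep G J a u)
    (hxJ : x ∈ J) (hk1J : kb ∈ J) (hk2J : kc ∈ J)
    (haS : a ∉ S) (huS : u ∉ S)
    (hsep : ¬ RR G (J \ S) a u) (hk : G.Adj kb kc) (bq : ¬ G.Adj x kb) (ct : ¬ G.Adj x kc)
    (cq : x ≠ kb) (cs : x ≠ kc)
    (xA : Att G x (A)) (xU : Att G x (U))
    (k1U : Att G kb (U)) (k2U : Att G kc (U))
    (IH : ∀ Ja : Set V, Ja.ncard < J.ncard → ∀ ai ua, ai ∈ Ja → ua ∈ Ja → ai ≠ ua → ¬ G.Adj ai ua →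
      NoSep G Ja ai ua → ∃ Zb Za, Twin G Ja ai ua Zb Za) :
    ∃ Yb Ya, Yb ⊆ A ∪ {x} ∧ Ya ⊆ A ∪ {kb, kc} ∧
      x ∈ Yb ∧ kb ∈ Ya ∧ kc ∈ Ya ∧ Cn G Yb ∧ Cn G Ya ∧
      a ∉ Yb ∧ a ∉ Ya ∧ Att G a Yb ∧ Att G a Ya ∧ Anti G Yb Ya ∧ Disjoint Yb Ya := by
  have hSd : S = {x, kb, kc} := by ext v; rw [hSm]; simp
  have aAU : Anti G A U := by rw [hA, hU]; exact comp_anti hsep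
  have dAU : Disjoint A U := by rw [hA, hU]; exact comp_disj hsep
  have haA : a ∈ A := by rw [hA]; exact mem_comp ⟨haJ, haS⟩
  have huU : u ∈ U := by rw [hU]; exact mem_comp ⟨huJ, huS⟩
  have hAS : ∀ v ∈ A, v ∈ J ∧ v ∉ S := fun v hv => by
    first | rw [hA] at hv | rw [hU] at hv
    have := comp_sub hv; exact this
  have hUS : ∀ v ∈ U, v ∈ J ∧ v ∉ S := fun v hv => by
    first | rw [hA] at hv | rw [hU] at hv
    have := comp_sub hv; exact this
  have hexA : ∀ p ∈ A, ∀ b ∈ J, G.Adj p b → b ∉ A → b ∈ S := by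
    intro p hp b hb hpb hbA
    by_contra hbS; rw [hA] at hp hbA; exact hbA (comp_step hp ⟨hb, hbS⟩ hpb)
  have cA : Cn G A := by rw [hA]; exact Cn_comp
  have cU : Cn G U := by rw [hU]; exact Cn_comp
  obtain ⟨n, g, hg, gc, gn, gind, gx, gK, ginj⟩ : ∃ n g, IsSP G U {y | G.Adj x y} {y | G.Adj kb y ∨ G.Adj kc y} n g := by
    obtain ⟨y, hy, hxy⟩ := xU
    obtain ⟨w, hw, hkw⟩ := k1U
    exact exists_SP (x := y) (y := w) hxy (.inl hkw) (cU y hy w hw)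
  simp only [Set.mem_ofPred_eq] at gc gn gx gK
  obtain ⟨Q, hQ⟩ : ∃ Q, Q = g '' Set.Icc 0 n := ⟨_, rfl⟩
  have cQ : Cn G Q := by rw [hQ]; exact hg.cn le_rfl
  have hQU : Q ⊆ U := by rw [hQ]; rintro _ ⟨i, hi, rfl⟩; exact hg.1 i hi.2
  have hpQ : g 0 ∈ Q := by rw [hQ]; exact ⟨0, by simp, rfl⟩
  have hgnQ : g n ∈ Q := by rw [hQ]; exact ⟨n, by simp, rfl⟩
  have hQx : ∀ q ∈ Q, G.Adj x q → q = g 0 := by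
    rw [hQ]; rintro _ ⟨i, hi, rfl⟩ h; rw [gx i hi.2 h]
  have hQK : ∀ q ∈ Q, (G.Adj kb q ∨ G.Adj kc q) → q = g n := by
    rw [hQ]; rintro _ ⟨i, hi, rfl⟩ h; rw [gK i hi.2 h]
  have dAQ : Disjoint A Q := dAU.mono_right hQU
  have aAQ : Anti G A Q := aAU.mono subset_rfl hQU
  have hQS : ∀ q ∈ Q, q ∉ S := fun q hq => (hUS q (hQU hq)).2
  have hw : ∃ w ∈ U, w ∉ Q := by
    obtain ⟨wd, dt, aa⟩ := k1U
    obtain ⟨we, jl, ac⟩ := k2U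
    grind
  obtain ⟨w, hwU, hwQ⟩ := hw
  obtain ⟨JL, hJL⟩ : ∃ JL, JL = A ∪ S ∪ Q := ⟨_, rfl⟩
  have mb : ∀ v ∈ A, v ∈ JL := fun v hv => by rw [hJL]; exact .inl (.inl hv)
  have mc : ∀ v ∈ S, v ∈ JL := fun v hv => by rw [hJL]; exact .inl (.inr hv)
  have me : ∀ v ∈ Q, v ∈ JL := fun v hv => by rw [hJL]; exact .inr hv
  have mJ : ∀ v ∈ JL, (v ∈ A ∨ v ∈ S) ∨ v ∈ Q := fun v hv => by rw [hJL] at hv; exact hv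
  have hSJ : S ⊆ J := by intro v hv; rcases (hSm v).1 hv with rfl | rfl | rfl <;> assumption
  have hJLJ : JL ⊆ J := by
    grind
  have hwJL : w ∉ JL := by
    grind
  have hcard : JL.ncard < J.ncard := by
    refine Set.ncard_lt_ncard ⟨hJLJ, fun h => hwJL (h (hUS w hwU).1)⟩ (Set.toFinite _)
  have hkQ : Att G kb Q ∨ Att G kc Q := by
    rcases gn with h | h
    · exact .inl ⟨_, hgnQ, h⟩
    · exact .inr ⟨_, hgnQ, h⟩
  have hxS : x ∈ S := (hSm x).2 (.inl rfl)
  have hk1S : kb ∈ S := (hSm kb).2 (.inr (.inl rfl))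
  have hk2S : kc ∈ S := (hSm kc).2 (.inr (.inr rfl))
  have hnsL : NoSep G JL a (g 0) := by
    intro Z hZ hZJ haZ hpZ
    have gox : x ∉ Z → RR G (JL \ Z) a x → RR G (JL \ Z) a (g 0) :=
      fun aa ac => ac.tail ⟨me _ hpQ, hpZ⟩ gc
    by_cases c1 : x ∉ Z ∧ Disjoint Z A
    · obtain ⟨y, hy, hxy⟩ := xA
      refine gox c1.1 (RR.tail (y := y) ((cA a haA y hy).mono ?_) ⟨mc _ hxS, c1.1⟩ hxy.symm)
      intro v hv
      exact ⟨mb _ hv, fun h => Set.disjoint_left.1 c1.2 h hv⟩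
    have hzA : x ∉ Z → ∃ z ∈ Z, z ∈ A := by
      grind
    have hZQ : ∀ q ∈ Q, q ∉ Z := by
      intro q hq hqZ
      by_cases hxZ : x ∈ Z
      · have hne : x ≠ q := fun h => hQS q hq (h ▸ hxS)
        exact hpZ ((hQx q hq (hZ hxZ hqZ hne)) ▸ hqZ)
      · obtain ⟨z, hz, hzA⟩ := hzA hxZ
        have hne : z ≠ q := fun h => Set.disjoint_left.1 dAQ hzA (h ▸ hq)
        exact aAQ z hzA q hq (hZ hz hqZ hne)
    have huZ : u ∉ Z := by
      grind
    obtain ⟨p, b, hpA, hp, hb, hbA, hpb, hr⟩ := (hns Z hZ (hZJ.trans hJLJ) haZ huZ).exit (T := A) haA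
      (fun h => Set.disjoint_left.1 dAU h huU)
    have hbS : b ∈ S := hexA p hpA b hb.1 hpb hbA
    have hab : RR G (JL \ Z) a b := by
      refine RR.tail (y := p) (hr.mono ?_) ⟨mc _ hbS, hb.2⟩ hpb
      intro v hv; exact ⟨mb _ hv.2, hv.1.2⟩
    have goQ : ∀ k, RR G (JL \ Z) a k → Att G k Q → RR G (JL \ Z) a (g 0) := by
      rintro k al ⟨q, hq, hkq⟩
      refine (al.tail (z := q) ⟨me _ hq, hZQ q hq⟩ hkq).trans ((cQ q hq _ hpQ).mono ?_)
      intro v hv; exact ⟨me _ hv, hZQ v hv⟩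
    have key : ∀ k ka, k ∈ S → ka ∈ S → G.Adj k ka → ¬ G.Adj x ka → x ≠ ka → (∀ s ∈ S, s = x ∨ s = k ∨ s = ka) →
        (Att G k Q ∨ Att G ka Q) → RR G (JL \ Z) a k → RR G (JL \ Z) a (g 0) := by
      intro k ka hkS hk'S hkk hxk hxne hSS hQQ hak
      by_cases hkQ : Att G k Q
      · exact goQ k hak hkQ
      have hk'Q : Att G ka Q := hQQ.resolve_left hkQ
      by_cases hk'Z : ka ∈ Z
      swap
      · exact goQ ka (hak.tail ⟨mc _ hk'S, hk'Z⟩ hkk) hk'Q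
      have hxZ : x ∉ Z := fun h => hxk (hZ h hk'Z hxne)
      obtain ⟨z, hz, hzA⟩ := hzA hxZ
      have hzS := (hAS z hzA).2
      have dk : G.Adj z ka := hZ hz hk'Z (fun h => hzS (h ▸ hk'S))
      by_cases hs : RR G (J \ {z, ka, k}) a u
      · obtain ⟨p, b, hpA, hp, hb, hbA, hpb, hr⟩ := hs.exit (T := A) haA
          (fun h => Set.disjoint_left.1 dAU h huU)
        have hbS : b ∈ S := hexA p hpA b hb.1 hpb hbA
        have hbx : b = x := by
          rcases hSS b hbS with h | h | h
          · exact h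
          · exact absurd (by simp [h]) hb.2
          · exact absurd (by simp [h]) hb.2
        subst hbx
        refine gox hxZ (RR.tail (y := p) (hr.mono ?_) ⟨mc _ hbS, hxZ⟩ hpb)
        intro v hv
        refine ⟨mb _ hv.2, fun hvZ => ?_⟩
        have aa : v ≠ z := fun h => hv.1.2 (by simp [h])
        have ac : v ≠ ka := fun h => hv.1.2 (by simp [h])
        exact htf v z ka (hZ hvZ hz aa) dk (hZ hvZ hk'Z ac)
      · exfalso
        have hzk : ¬ G.Adj z k := fun h => htf z k ka h hkk dk
        have hzJ := (hAS z hzA).1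
        have zne : z ≠ a := fun h => haZ (h ▸ hz)
        have zneu : z ≠ u := fun h => huZ (h ▸ hz)
        have kna : k ≠ a := fun h => haS (h ▸ hkS)
        have knu : k ≠ u := fun h => huS (h ▸ hkS)
        have k'na : ka ≠ a := fun h => haS (h ▸ hk'S)
        have k'nu : ka ≠ u := fun h => huS (h ▸ hk'S)
        have haT : a ∉ ({z, ka, k} : Set V) := by simp [zne.symm, kna.symm, k'na.symm]
        have huT : u ∉ ({z, ka, k} : Set V) := by simp [zneu.symm, knu.symm, k'nu.symm]
        have rc : RR G (J \ ({z, ka, k} \ {z})) a u := by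
          refine (hns {ka, k} (clique_pair hkk.symm) ?_ ?_ ?_).mono ?_
          · rintro v (rfl | rfl)
            · exact hSJ hk'S
            · exact hSJ hkS
          · simp [kna.symm, k'na.symm]
          · simp [knu.symm, k'nu.symm]
          · intro v hv; refine ⟨hv.1, fun h => hv.2 ?_⟩
            exact h.1.resolve_left h.2
        have rb : RR G (J \ ({z, ka, k} \ {k})) a u := by
          refine (hns {z, ka} (clique_pair dk) ?_ ?_ ?_).mono ?_
          · rintro v (rfl | rfl)
            · exact hzJ
            · exact hSJ hk'S
          · simp [zne.symm, k'na.symm]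
          · simp [zneu.symm, k'nu.symm]
          · intro v hv; refine ⟨hv.1, fun h => hv.2 ?_⟩
            rcases h.1 with aa | aa | aa
            · exact .inl aa
            · exact .inr aa
            · exact absurd aa h.2
        have ez : ¬ RR G (J \ {z, ka, k}) u a := fun h => hs h.symm
        have hnot : ∀ v ∈ ({z, ka, k} : Set V), ∀ y, v ∉ comp G (J \ {z, ka, k}) y :=
          fun v hv y h => (comp_sub h).2 hv
        exact hHP.false (Zb := comp G (J \ {z, ka, k}) a) (Za := comp G (J \ {z, ka, k}) u) (a := z) (b := k)
          (v := ka) Cn_comp Cn_comp (comp_anti hs) (comp_disj hs) (fun h => hzS (h ▸ hkS)) hzk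
          (hnot _ (by simp) _) (hnot _ (by simp) _) (hnot _ (by simp) _) (hnot _ (by simp) _)
          (tight haJ haT hs rc) (tight huJ huT ez rc.symm) (tight haJ haT hs rb) (tight huJ huT ez rb.symm)
          (hnot _ (by simp) _) (hnot _ (by simp) _) dk.symm hkk.symm
    have au := hb.2
    rcases (hSm b).1 hbS with h | h | h <;> rw [h] at hab au
    · exact gox au hab
    · exact key kb kc hk1S hk2S hk ct cs (fun s hs => (hSm s).1 hs) hkQ hab
    · exact key kc kb hk2S hk1S hk.symm bq cq (fun s hs => ((hSm s).1 hs).imp id Or.symm) hkQ.symm hab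
  have hag : ¬ G.Adj a (g 0) := aAQ a haA _ hpQ
  have hane : a ≠ g 0 := fun h => Set.disjoint_left.1 dAQ haA (h ▸ hpQ)
  obtain ⟨Zb, Za, hT⟩ := IH JL hcard a (g 0) (mb _ haA) (me _ hpQ) hane hag hnsL
  obtain ⟨Yb, de, Ya, df, db, dc, ea, eb, ec, ef, hv⟩ := hHP Zb Za a (g 0) hT.c1 hT.c2 hT.an hT.dj hane hag hT.a1 hT.a2 hT.u1 hT.u2
    hT.ta1 hT.ta2 hT.tu1 hT.tu2
  have bm : Twin G JL a (g 0) Yb Ya := ⟨de.trans hT.s1, df.trans hT.s2, fun h => hT.a1 (de h), fun h => hT.a2 (df h),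
    fun h => hT.u1 (de h), fun h => hT.u2 (df h), db, dc, hT.an.mono de df, hT.dj.mono de df, ea, eb, ec, ef⟩
  have hmeet : ∀ Y, Y ⊆ JL → Cn G Y → Att G a Y → Att G (g 0) Y → ∃ s ∈ S, s ∈ Y := by
    rintro Y hYJ hY ⟨y, hy, hay⟩ ⟨w, hw, hgw⟩
    by_contra hc
    push Not at hc
    have hyA : y ∈ A := by
      rcases mJ _ (hYJ hy) with (h | h) | h
      · exact h
      · exact absurd hy (hc y h)
      · exact absurd hay (aAQ a haA y h)
    have hwA : w ∈ A := by
      refine (hY y hy w hw).closed (T := A) hyA ?_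
      intro c hcA _ d hd hcd
      rcases mJ _ (hYJ hd) with (h | h) | h
      · exact h
      · exact absurd hd (hc d h)
      · exact absurd hcd (aAQ c hcA d h)
    exact aAQ w hwA _ hpQ hgw.symm
  have fin := fun (Zb Za : Set V) (h : Twin G JL a (g 0) Zb Za) (aa : x ∈ Zb) (ac : kb ∈ Za ∨ kc ∈ Za) hv =>
    star_left_end (G := G) (A := A) (Q := Q) (a := a) (x := x) (kb := kb) (kc := kc) (p := g 0) hk aAQ dAQ haA
    (fun h => (hAS x h).2 hxS) (fun h => (hAS kb h).2 hk1S) (fun h => (hAS kc h).2 hk2S)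
    (fun h => hQS x h hxS) (fun h => hQS kb h hk1S) (fun h => hQS kc h hk2S) cq cs hpQ (Zb := Zb) (Za := Za) (by rw [← hSd, ← hJL]; exact h) aa ac hv
  obtain ⟨s1, gq, hs1Y⟩ := hmeet Yb bm.s1 bm.c1 bm.ta1 bm.tu1
  obtain ⟨s2, gr, hs2Y⟩ := hmeet Ya bm.s2 bm.c2 bm.ta2 bm.tu2
  have hss : s1 ≠ s2 := fun h => Set.disjoint_left.1 bm.dj hs1Y (h ▸ hs2Y)
  have hnss := bm.an s1 hs1Y s2 hs2Y
  have bd : ∀ v, v ∉ Ya → v ∉ Yb → v ≠ a → v ≠ g 0 → ∀ pc q, (pc ∈ Ya ∨ pc ∈ Yb ∨ pc = a ∨ pc = g 0) →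
      (q ∈ Ya ∨ q ∈ Yb ∨ q = a ∨ q = g 0) → G.Adj v pc → G.Adj v q → pc = q :=
    fun v aa ac ah aj p q am aq => hv v ac aa ah aj p q (or_left_comm.1 am) (or_left_comm.1 aq)
  rcases (hSm s1).1 gq with aa | aa | aa <;> rcases (hSm s2).1 gr with ac | ac | ac <;> rw [aa] at hs1Y hss hnss <;> rw [ac] at hs2Y hss hnss
  · exact absurd rfl hss
  · exact fin _ _ bm hs1Y (.inl hs2Y) hv
  · exact fin _ _ bm hs1Y (.inr hs2Y) hv
  · exact fin _ _ bm.swap hs2Y (.inl hs1Y) bd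
  · exact absurd rfl hss
  · exact absurd hk hnss
  · exact fin _ _ bm.swap hs2Y (.inr hs1Y) bd
  · exact absurd hk.symm hnss
  · exact absurd rfl hss

end Paper

namespace Paper
variable {V : Type} {G : SimpleGraph V}

theorem star_case2 [Finite V] (hHP : HP G) (htf : ∀ x y z, G.Adj x y → G.Adj y z → G.Adj x z → False)
    {J S A U : Set V} {a u x kb kc : V} (hSm : ∀ v, v ∈ S ↔ v = x ∨ v = kb ∨ v = kc)
    (hA : A = comp G (J \ S) a) (hU : U = comp G (J \ S) u) (haJ : a ∈ J) (huJ : u ∈ J) (hns : NoSep G J a u)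
    (dw : NoSep G J u a)
    (hxJ : x ∈ J) (hk1J : kb ∈ J) (hk2J : kc ∈ J)
    (haS : a ∉ S) (huS : u ∉ S)
    (hsep : ¬ RR G (J \ S) a u) (hk : G.Adj kb kc)
    (cq : x ≠ kb) (cs : x ≠ kc)
    (xA : Att G x A) (xU : Att G x U)
    (k1U : Att G kb U) (k2U : Att G kc U) (k1A : Att G kb A) (k2A : Att G kc A)
    (IH : ∀ Ja : Set V, Ja.ncard < J.ncard → ∀ ai ua, ai ∈ Ja → ua ∈ Ja → ai ≠ ua → ¬ G.Adj ai ua →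
      NoSep G Ja ai ua → ∃ Zb Za, Twin G Ja ai ua Zb Za) : ∃ Zb Za, Twin G J a u Zb Za := by
  have aAU : Anti G A U := by rw [hA, hU]; exact comp_anti hsep
  have dAU : Disjoint A U := by rw [hA, hU]; exact comp_disj hsep
  have cA : Cn G A := by rw [hA]; exact Cn_comp
  have cU : Cn G U := by rw [hU]; exact Cn_comp
  have haA : a ∈ A := by rw [hA]; exact mem_comp ⟨haJ, haS⟩
  have huU : u ∈ U := by rw [hU]; exact mem_comp ⟨huJ, huS⟩
  have hAS : ∀ v ∈ A, v ∈ J ∧ v ∉ S := fun v hv => by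
    rw [hA] at hv; have := comp_sub hv; exact this
  have hUS : ∀ v ∈ U, v ∈ J ∧ v ∉ S := fun v hv => by
    rw [hU] at hv; have := comp_sub hv; exact this
  have hxS : x ∈ S := (hSm x).2 (.inl rfl)
  have hk1S : kb ∈ S := (hSm kb).2 (.inr (.inl rfl))
  have hk2S : kc ∈ S := (hSm kc).2 (.inr (.inr rfl))
  have nA : ∀ s ∈ S, s ∉ A := fun s hs h => (hAS s h).2 hs
  have nU : ∀ s ∈ S, s ∉ U := fun s hs h => (hUS s h).2 hs
  have bq : ¬ G.Adj x kb := fun h => hHP.false (Zb := A) (Za := U) (a := x) (b := kc) (v := kb) cA cU aAU dAU cs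
    (fun ad => htf x kb kc h hk ad) (nA _ hxS) (nU _ hxS) (nA _ hk2S) (nU _ hk2S) xA xU k2A k2U (nA _ hk1S) (nU _ hk1S)
    h.symm hk
  have ct : ¬ G.Adj x kc := fun h => hHP.false (Zb := A) (Za := U) (a := x) (b := kb) (v := kc) cA cU aAU dAU cq
    bq (nA _ hxS) (nU _ hxS) (nA _ hk1S) (nU _ hk1S) xA xU k1A k1U (nA _ hk2S) (nU _ hk2S)
    h.symm hk.symm
  obtain ⟨La, Lb, la, lb, xL, k1L, k2L, c1, c2, jm, jn, tc, td, anL, djL⟩ :=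
    star_left hHP htf hSm hA hU haJ huJ hns hxJ hk1J hk2J haS huS hsep hk bq ct cq cs xA xU k1U k2U IH
  obtain ⟨Ra, Rb, rc, rb, xR, k1R, k2R, db, dc, jo, jp, qb, qc, anR, djR⟩ :=
    star_left hHP htf hSm hU hA huJ haJ dw hxJ hk1J hk2J huS haS (fun h => hsep h.symm) hk bq ct cq cs xU xA k1A k2A IH
  have gv : ∀ v ∈ La, v ∈ A ∨ v = x := fun v hv => la hv
  have gw : ∀ v ∈ Lb, v ∈ A ∨ v = kb ∨ v = kc := fun v hv => lb hv
  have gy : ∀ v ∈ Ra, v ∈ U ∨ v = x := fun v hv => rc hv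
  have gz : ∀ v ∈ Rb, v ∈ U ∨ v = kb ∨ v = kc := fun v hv => rb hv
  have hxa : x ≠ a := fun h => haS (h ▸ hxS)
  have hxu : x ≠ u := fun h => huS (h ▸ hxS)
  have hau : a ∉ U := fun h => Set.disjoint_left.1 dAU haA h
  have hua : u ∉ A := fun h => Set.disjoint_left.1 dAU h huU
  have hSa : ∀ s ∈ S, s ≠ a ∧ s ≠ u := fun s hs => ⟨fun h => haS (h ▸ hs), fun h => huS (h ▸ hs)⟩
  refine ⟨La ∪ Ra, Lb ∪ Rb, ?_, ?_, ?_, ?_, ?_, ?_, c1.union db ⟨x, xL, x, xR, .inl rfl⟩,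
    c2.union dc ⟨kb, k1L, kb, k1R, .inl rfl⟩, ?_, ?_, tc.mono subset_union_left, td.mono subset_union_left,
    qb.mono subset_union_right, qc.mono subset_union_right⟩
  · grind
  · rintro v (hv | hv)
    all_goals grind
  · grind
  · grind
  · grind
  · grind
  · rintro v (hv | hv) w (hw | hw) hvw
    · exact anL v hv w hw hvw
    · rcases gv v hv with h | rfl
      · rcases gz w hw with ad | rfl | rfl
        · exact aAU v h w ad hvw
        · exact anL v hv w k1L hvw
        · exact anL v hv w k2L hvw
      · exact anR v xR w hw hvw
    · rcases gy v hv with h | rfl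
      · rcases gw w hw with ad | rfl | rfl
        · exact aAU w ad v h hvw.symm
        · exact anR v hv w k1R hvw
        · exact anR v hv w k2R hvw
      · exact anL v xL w hw hvw
    · exact anR v hv w hw hvw
  · rw [Set.disjoint_left] at *
    grind

theorem star_two [Finite V] {J : Set V} {a u : V} (haJ : a ∈ J) (hau : a ≠ u) (hnau : ¬ G.Adj a u)
    (hns : NoSep G J a u) : ∃ Zb Za, Zb ⊆ J ∧ Za ⊆ J ∧ a ∉ Zb ∧ a ∉ Za ∧ u ∉ Zb ∧ u ∉ Za ∧ Cn G Zb ∧ Cn G Za ∧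
      Disjoint Zb Za ∧ Att G a Zb ∧ Att G a Za ∧ Att G u Zb ∧ Att G u Za := by
  classical
  let I : Set V := {v | v ∈ J ∧ v ≠ a ∧ v ≠ u}
  let Ga : SimpleGraph V := ⟨fun x y => G.Adj x y ∧ x ∈ I ∧ y ∈ I, ⟨fun x y h => ⟨h.1.symm, h.2.2, h.2.1⟩⟩, ⟨fun x h => h.1.ne rfl⟩⟩
  have bs : Ga ≤ G := fun x y h => h.1
  have hL : Lk Ga {v | v ∈ I ∧ G.Adj a v} {v | v ∈ I ∧ G.Adj u v} 2 := by
    refine menger _ _ _ _ ?_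
    intro S hS
    by_contra hc
    have hsub : (↑S ∩ I : Set V).Subsingleton := by
      have aa : S.card ≤ 1 := by omega
      rw [Finset.card_le_one] at aa
      intro p hp q hq; exact aa p hp.1 q hq.1
    have hr := hns (↑S ∩ I) (clique_sub hsub) (fun v hv => hv.2.1) (fun h => h.2.2.1 rfl) (fun h => h.2.2.2 rfl)
    have hnu : u ∉ {v | v = a ∨ ∃ y, y ∈ I ∧ G.Adj a y ∧ RR Ga (↑S : Set V)ᶜ y v ∧ v ∈ I} := by
      rintro (h | ⟨y, _, _, _, h⟩)
      all_goals grind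
    obtain ⟨p, b, hp, bt, hb, hbT, hpb, -⟩ := hr.exit
      (T := {v | v = a ∨ ∃ y, y ∈ I ∧ G.Adj a y ∧ RR Ga (↑S : Set V)ᶜ y v ∧ v ∈ I}) (.inl rfl) hnu
    have hba : b ≠ a := fun h => hbT (.inl h)
    have hbS : b ≠ u → b ∈ I ∧ b ∈ (↑S : Set V)ᶜ := by
      grind
    rcases hp with rfl | ⟨y, hy, hay, bu, hpI⟩
    · have hbu : b ≠ u := fun h => hnau (h ▸ hpb)
      exact hbT (.inr ⟨b, (hbS hbu).1, hpb, RR.refl (hbS hbu).2, (hbS hbu).1⟩)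
    · by_cases hbu : b = u
      · subst hbu
        exact hS y ⟨hy, hay⟩ p ⟨hpI, hpb.symm⟩ bu
      · exact hbT (.inr ⟨y, hy, hay, bu.tail (hbS hbu).2 ⟨hpb, hpI, (hbS hbu).1⟩, (hbS hbu).1⟩)
  obtain ⟨len, p, hp⟩ := hL
  have hI : ∀ i, ∀ k ≤ len i, p i k ∈ I := by
    intro i k hk
    cases k with
    | zero => exact (hp.st i).1
    | succ k => exact (hp.adj i k (by omega)).2.2
  have hZ : ∀ i, p i '' Set.Icc 0 (len i) ⊆ I := by
    grind
  have cn : ∀ i, Cn G (p i '' Set.Icc 0 (len i)) := fun i => ((hp.isP i).cn le_rfl).monoG bs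
  have ta : ∀ i, Att G a (p i '' Set.Icc 0 (len i)) := fun i => ⟨_, ⟨0, by simp, rfl⟩, (hp.st i).2⟩
  have tu : ∀ i, Att G u (p i '' Set.Icc 0 (len i)) := fun i => ⟨_, ⟨len i, by simp, rfl⟩, (hp.en i).2⟩
  refine ⟨_, _, fun v hv => (hZ 0 hv).1, fun v hv => (hZ 1 hv).1, fun hv => (hZ 0 hv).2.1 rfl,
    fun hv => (hZ 1 hv).2.1 rfl, fun hv => (hZ 0 hv).2.2 rfl, fun hv => (hZ 1 hv).2.2 rfl, cn 0, cn 1, ?_, ta 0, ta 1, tu 0, tu 1⟩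
  rw [Set.disjoint_left]
  rintro _ ⟨k, hk, rfl⟩ ⟨l, hl, h⟩
  exact absurd (hp.inj 1 0 l k hl.2 hk.2 h).1 (by simp)

def Cov (G : SimpleGraph V) (I : Set V) (a u : V) : Prop := ∀ Yb Ya, Yb ⊆ I → Ya ⊆ I → Cn G Yb → Cn G Ya →
  Disjoint Yb Ya → Att G a Yb → Att G a Ya → Att G u Yb → Att G u Ya → I ⊆ Yb ∪ Ya

theorem star_reroute {I : Set V} {a u : V} {m n : ℕ} {f g : ℕ → V} (hcov : Cov G I a u)
    (hf : IsSP G I {v | G.Adj a v} {v | G.Adj u v} m f) (hg : IsSP G I {v | G.Adj a v} {v | G.Adj u v} n g)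
    (hd : ∀ i ≤ m, ∀ j ≤ n, f i ≠ g j) {i j ib jb : ℕ} (hi : i ≤ m) (av : jb ≤ n) (hii : ib < i) (hjj : j < jb)
    (aa : G.Adj (f i) (g j)) (ac : G.Adj (f ib) (g jb)) : i = ib + 1 ∧ jb = j + 1 := by
  obtain ⟨pf, fc, fm, find, fa, fb, finj⟩ := hf
  obtain ⟨pg, gc, gn, gind, ga, gb, ginj⟩ := hg
  have hc := hcov (f '' Set.Icc 0 ib ∪ g '' Set.Icc jb n) (g '' Set.Icc 0 j ∪ f '' Set.Icc i m) ?_ ?_ ?_ ?_ ?_ ?_ ?_ ?_ ?_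
  · constructor
    · by_contra hne
      rcases hc (pf.1 (ib + 1) (by omega)) with (⟨k, hk, h⟩ | ⟨k, hk, h⟩) | (⟨k, hk, h⟩ | ⟨k, hk, h⟩)
      all_goals grind
    · by_contra hne
      rcases hc (pg.1 (j + 1) (by omega)) with (⟨k, hk, h⟩ | ⟨k, hk, h⟩) | (⟨k, hk, h⟩ | ⟨k, hk, h⟩)
      all_goals grind
  · rintro _ (⟨k, hk, rfl⟩ | ⟨k, hk, rfl⟩)
    · exact pf.1 k (by have := hk.2; omega)
    · exact pg.1 k hk.2
  · rintro _ (⟨k, hk, rfl⟩ | ⟨k, hk, rfl⟩)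
    · exact pg.1 k (by have := hk.2; omega)
    · exact pf.1 k hk.2
  · exact (pf.cn (by omega)).union (pg.cn le_rfl) ⟨_, ⟨ib, by simp, rfl⟩, _, ⟨jb, by simp [av], rfl⟩, .inr ac⟩
  · exact (pg.cn (by omega)).union (pf.cn le_rfl) ⟨_, ⟨j, by simp, rfl⟩, _, ⟨i, by simp [hi], rfl⟩, .inr aa.symm⟩
  · rw [Set.disjoint_left]
    grind
  · exact ⟨_, .inl ⟨0, by simp, rfl⟩, fc⟩
  · exact ⟨_, .inl ⟨0, by simp, rfl⟩, gc⟩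
  · exact ⟨_, .inr ⟨n, by simp [av], rfl⟩, gn⟩
  · exact ⟨_, .inr ⟨m, by simp [hi], rfl⟩, fm⟩

theorem star_chord (hHP : HP G) (htf : ∀ x y z, G.Adj x y → G.Adj y z → G.Adj x z → False)
    {I : Set V} {a u : V} {m n : ℕ} {f g : ℕ → V} (haI : a ∉ I) (hcov : Cov G I a u)
    (hf : IsSP G I {v | G.Adj a v} {v | G.Adj u v} m f) (hg : IsSP G I {v | G.Adj a v} {v | G.Adj u v} n g)
    (hd : ∀ i ≤ m, ∀ j ≤ n, f i ≠ g j) {i j ib jb : ℕ} (hi : i ≤ m) (av : jb ≤ n) (hii : ib < i) (hjj : j < jb)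
    (aa : G.Adj (f i) (g j)) (ac : G.Adj (f ib) (g jb)) : False := by
  obtain ⟨rfl, rfl⟩ := star_reroute hcov hf hg hd hi av hii hjj aa ac
  have hre := fun jc (cj : jc < j) (h : G.Adj (f (ib + 1)) (g jc)) =>
    (star_reroute hcov hf hg hd hi av hii (cj.trans hjj) h ac).2
  obtain ⟨pf, fc, fm, find, fa, fb, finj⟩ := hf
  obtain ⟨pg, gc, gn, gind, ga, gb, ginj⟩ := hg
  have pi : IsP G (insert a I) (m + 1) (fun k => if k = 0 then a else f (k - 1)) := by
    refine ⟨fun k hk => ?_, fun k hk => ?_⟩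
    · dsimp only; split_ifs
      · exact .inl rfl
      · exact .inr (pf.1 _ (by omega))
    · dsimp only; rw [if_neg (Nat.succ_ne_zero k), Nat.add_sub_cancel]
      split_ifs with h
      · subst h; exact fc
      · have := pf.2 (k - 1) (by omega)
        rw [(by omega : k - 1 + 1 = k)] at this; exact this
  have pj : IsP G (insert a I) (n + 1) (fun k => if k = 0 then a else g (k - 1)) := by
    refine ⟨fun k hk => ?_, fun k hk => ?_⟩
    · dsimp only; split_ifs
      · exact .inl rfl
      · exact .inr (pg.1 _ (by omega))
    · dsimp only; rw [if_neg (Nat.succ_ne_zero k), Nat.add_sub_cancel]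
      split_ifs with h
      · subst h; exact gc
      · have := pg.2 (k - 1) (by omega)
        rw [(by omega : k - 1 + 1 = k)] at this; exact this
  obtain ⟨F, hF⟩ : ∃ F : ℕ → V, F = fun k => if k = 0 then a else f (k - 1) := ⟨_, rfl⟩
  obtain ⟨H, hH⟩ : ∃ H : ℕ → V, H = fun k => if k = 0 then a else g (k - 1) := ⟨_, rfl⟩
  rw [← hF] at pi; rw [← hH] at pj
  have Fa : F 0 = a := by simp [hF]
  have Hb : H 0 = a := by simp [hH]
  have Fs : ∀ k, F (k + 1) = f k := by intro k; simp [hF]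
  have Hs : ∀ k, H (k + 1) = g k := by intro k; simp [hH]
  have hZ : ∀ v ∈ F '' Set.Icc 0 ib ∪ H '' Set.Icc 0 j, v = a ∨ (∃ k < ib, v = f k) ∨ ∃ k < j, v = g k := by
    rintro _ (⟨k, hk, rfl⟩ | ⟨k, hk, rfl⟩)
    all_goals grind
  have hfa : ∀ k ≤ m, f k ≠ a := fun k hk h => haI (h ▸ pf.1 k hk)
  have hga : ∀ k ≤ n, g k ≠ a := fun k hk h => haI (h ▸ pg.1 k hk)
  have hff := pf.2 ib (by omega)
  have hgg := pg.2 j (by omega)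
  refine hHP.false (Zb := {f (ib + 1)}) (Za := F '' Set.Icc 0 ib ∪ H '' Set.Icc 0 j) (a := f ib) (b := g j) (v := g (j + 1))
    (Cn_singleton _) ((pi.cn (by omega)).union (pj.cn (by omega))
    ⟨a, ⟨0, by simp, Fa⟩, a, ⟨0, by simp, Hb⟩, .inl rfl⟩) ?_ ?_ (hd _ (by omega) _ (by omega))
    (fun h => htf _ _ _ hff aa h) (by simpa using hff.ne) ?_ (by simpa using aa.ne.symm) ?_ ⟨_, rfl, hff⟩ ?_
    ⟨_, rfl, aa.symm⟩ ?_ (by simpa using (hd _ hi _ av).symm) ?_ ac.symm hgg.symm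
  · rintro _ rfl v hv hfv
    rcases hZ v hv with rfl | ⟨k, hk, rfl⟩ | ⟨k, hk, rfl⟩
    · have := fa _ hi hfv.symm; omega
    · have := find _ hi _ (by omega) hfv; omega
    · have := hre k hk hfv; omega
  · rw [Set.disjoint_left]
    grind
  · grind
  · grind
  · refine ⟨F ib, .inl ⟨ib, by simp, rfl⟩, ?_⟩
    have := pi.2 ib (by omega)
    rw [Fs] at this; exact this.symm
  · refine ⟨H j, .inr ⟨j, by simp, rfl⟩, ?_⟩
    have := pj.2 j (by omega)
    rw [Hs] at this; exact this.symm
  grind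

theorem star_case3 [Finite V] (hHP : HP G) (htf : ∀ x y z, G.Adj x y → G.Adj y z → G.Adj x z → False)
    {J : Set V} {a u : V} (haJ : a ∈ J) (hau : a ≠ u) (hnau : ¬ G.Adj a u) (hns : NoSep G J a u)
    (hcov : Cov G {v | v ∈ J ∧ v ≠ a ∧ v ≠ u} a u) : ∃ Zb Za, Twin G J a u Zb Za := by
  obtain ⟨Zb, Za, s1, s2, a1, a2, u1, u2, c1, c2, dj, ta1, ta2, tu1, tu2⟩ := star_two haJ hau hnau hns
  obtain ⟨m, f, hf⟩ := hp_path c1 ta1 tu1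
  obtain ⟨n, g, hg⟩ := hp_path c2 ta2 tu2
  have hd : ∀ i ≤ m, ∀ j ≤ n, f i ≠ g j := fun i hi j hj h => Set.disjoint_left.1 dj (hf.1.1 i hi) (h ▸ hg.1.1 j hj)
  have hfI : IsSP G {v | v ∈ J ∧ v ≠ a ∧ v ≠ u} {v | G.Adj a v} {v | G.Adj u v} m f :=
    ⟨⟨fun i hi => ⟨s1 (hf.1.1 i hi), fun h => a1 (h ▸ hf.1.1 i hi), fun h => u1 (h ▸ hf.1.1 i hi)⟩, hf.1.2⟩, hf.2⟩
  have hgI : IsSP G {v | v ∈ J ∧ v ≠ a ∧ v ≠ u} {v | G.Adj a v} {v | G.Adj u v} n g :=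
    ⟨⟨fun i hi => ⟨s2 (hg.1.1 i hi), fun h => a2 (h ▸ hg.1.1 i hi), fun h => u2 (h ▸ hg.1.1 i hi)⟩, hg.1.2⟩, hg.2⟩
  have haI : a ∉ {v | v ∈ J ∧ v ≠ a ∧ v ≠ u} := fun h => h.2.1 rfl
  have dx : ∀ i ≤ n, ∀ j ≤ m, g i ≠ f j := fun i hi j hj h => hd j hj i hi h.symm
  have cf : Cn G (f '' Set.Icc 0 m) := hf.1.cn le_rfl
  have cg : Cn G (g '' Set.Icc 0 n) := hg.1.cn le_rfl
  have sf : f '' Set.Icc 0 m ⊆ {v | v ∈ J ∧ v ≠ a ∧ v ≠ u} := by rintro _ ⟨i, hi, rfl⟩; exact hfI.1.1 i hi.2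
  have sg : g '' Set.Icc 0 n ⊆ {v | v ∈ J ∧ v ≠ a ∧ v ≠ u} := by rintro _ ⟨i, hi, rfl⟩; exact hgI.1.1 i hi.2
  have af : Att G a (f '' Set.Icc 0 m) := ⟨_, ⟨0, by simp, rfl⟩, hf.2.1⟩
  have ag : Att G a (g '' Set.Icc 0 n) := ⟨_, ⟨0, by simp, rfl⟩, hg.2.1⟩
  have uf : Att G u (f '' Set.Icc 0 m) := ⟨_, ⟨m, by simp, rfl⟩, hf.2.2.1⟩
  have ug : Att G u (g '' Set.Icc 0 n) := ⟨_, ⟨n, by simp, rfl⟩, hg.2.2.1⟩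
  have dfg : Disjoint (f '' Set.Icc 0 m) (g '' Set.Icc 0 n) := by
    grind
  refine ⟨f '' Set.Icc 0 m, g '' Set.Icc 0 n, fun v hv => (sf hv).1, fun v hv => (sg hv).1, fun h => (sf h).2.1 rfl,
    fun h => (sg h).2.1 rfl, fun h => (sf h).2.2 rfl, fun h => (sg h).2.2 rfl, cf, cg, ?_, dfg, af, ag, uf, ug⟩
  rintro _ ⟨i, hi, rfl⟩ _ ⟨j, hj, rfl⟩ hij
  have hi := hi.2
  have hj := hj.2
  have hcI := hcov _ _ sf sg cf cg dfg af ag uf ug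
  have hr := hns {f i, g j} (clique_pair hij) (by
    rintro v (rfl | rfl)
    · exact (hfI.1.1 i hi).1
    · exact (hgI.1.1 j hj).1) (by
    rintro (h | h)
    · grind
    · grind) (by
    rintro (h | h)
    · exact (hfI.1.1 i hi).2.2 h.symm
    · exact (hgI.1.1 j hj).2.2 h.symm)
  have fu : ∀ k ≤ m, f k ≠ u := fun k hk => (hfI.1.1 k hk).2.2
  have gu : ∀ k ≤ n, g k ≠ u := fun k hk => (hgI.1.1 k hk).2.2
  obtain ⟨p, b, hp, -, hb, hbT, hpb, -⟩ := hr.exit (T := {v | v = a ∨ (∃ k < i, v = f k) ∨ ∃ k < j, v = g k}) (.inl rfl) (by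
    grind)
  have hbc : b = u ∨ (∃ k, i < k ∧ k ≤ m ∧ b = f k) ∨ ∃ k, j < k ∧ k ≤ n ∧ b = g k := by
    by_cases hbu : b = u
    · exact .inl hbu
    right
    rcases hcI ⟨hb.1, fun h => hbT (.inl h), hbu⟩ with ⟨k, hk, rfl⟩ | ⟨k, hk, rfl⟩
    all_goals grind
  obtain ⟨-, -, -, find, fa, fb, -⟩ := hf
  obtain ⟨-, -, -, gind, ga, gb, -⟩ := hg
  rcases hp with rfl | ⟨k, hk, rfl⟩ | ⟨k, hk, rfl⟩ <;> rcases hbc with rfl | ⟨l, hl, bh, rfl⟩ | ⟨l, hl, bh, rfl⟩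
  · exact hnau hpb
  · have := fa l bh hpb; omega
  · have := ga l bh hpb; omega
  · have := fb k (by omega) hpb.symm; omega
  · have := find k (by omega) l bh hpb; omega
  · exact star_chord hHP htf haI hcov hfI hgI hd hi bh hk hl hij hpb
  · have := gb k (by omega) hpb.symm; omega
  · exact star_chord hHP htf haI hcov hgI hfI dx hj bh hk hl hij.symm hpb
  · have := gind k (by omega) l bh hpb; omega

theorem star [Finite V] (hHP : HP G) (htf : ∀ x y z, G.Adj x y → G.Adj y z → G.Adj x z → False)
    (N : ℕ) : ∀ (J : Set V), J.ncard = N → ∀ (a u : V), a ∈ J → u ∈ J → a ≠ u → ¬ G.Adj a u → NoSep G J a u →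
    ∃ Zb Za, Twin G J a u Zb Za := by
  induction N using Nat.strong_induction_on with
  | _ N Ib =>
  intro J hJ a u haJ huJ hau hnau hns
  have IH : ∀ Ja : Set V, Ja.ncard < J.ncard → ∀ ai ua, ai ∈ Ja → ua ∈ Ja → ai ≠ ua → ¬ G.Adj ai ua →
      NoSep G Ja ai ua → ∃ Zb Za, Twin G Ja ai ua Zb Za := fun Ja h => Ib _ (hJ ▸ h) Ja rfl
  have dw : NoSep G J u a := fun K aa ac ah aj => (hns K aa ac aj ah).symm
  by_contra hno
  have main : ∀ x ∈ J, x ≠ a → x ≠ u → ∃ k, k ∈ J ∧ k ≠ a ∧ k ≠ u ∧ ¬ RR G (J \ {x, k}) a u := by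
    intro x hxJ hxa hxu
    have bq : ∃ K, G.IsClique K ∧ K ⊆ J \ {x} ∧ a ∉ K ∧ u ∉ K ∧ ¬ RR G ((J \ {x}) \ K) a u := by
      by_contra hc
      push Not at hc
      refine hno ?_
      obtain ⟨Zb, Za, h⟩ := IH (J \ {x}) (Set.ncard_lt_ncard ⟨diff_subset, fun h => (h hxJ).2 rfl⟩ (Set.toFinite _)) a u
        ⟨haJ, fun h => hxa h.symm⟩ ⟨huJ, fun h => hxu h.symm⟩ hau hnau (fun K aa ac ah aj => hc K aa ac ah aj)
      exact ⟨Zb, Za, h.s1.trans diff_subset, h.s2.trans diff_subset, h.a1, h.a2, h.u1, h.u2, h.c1, h.c2, h.an, h.dj, h.ta1, h.ta2, h.tu1, h.tu2⟩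
    obtain ⟨K, hK, hKJ, haK, huK, hsep⟩ := bq
    by_contra hc
    push Not at hc
    have hJK : (J \ {x}) \ K = J \ insert x K := by ext v; simp only [Set.mem_diff, Set.mem_insert_iff, Set.mem_singleton_iff]; tauto
    rw [hJK] at hsep
    have hne : ∃ kb ∈ K, ∃ kc ∈ K, kb ≠ kc := by
      by_contra dh
      push Not at dh
      by_cases ig : ∃ k, k ∈ K
      · obtain ⟨k, hk⟩ := ig
        have al := hKJ hk
        refine hsep ((hc k al.1 (fun h => haK (h ▸ hk)) (fun h => huK (h ▸ hk))).mono ?_)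
        grind
      · refine hsep ((hns {x} (clique_sub Set.subsingleton_singleton) (by simpa using hxJ) (fun h => hxa h.symm) (fun h => hxu h.symm)).mono ?_)
        grind
    obtain ⟨kb, cp, kc, bw, hk12⟩ := hne
    have hadj := hK cp bw hk12
    have hSm : ∀ v, v ∈ insert x K ↔ v = x ∨ v = kb ∨ v = kc := by
      intro v
      constructor
      · rintro (h | h)
        · exact .inl h
        · right
          by_contra cw
          push Not at cw
          exact htf v kb kc (hK h cp cw.1) hadj (hK h bw cw.2)
      grind
    have haS : a ∉ insert x K := by rintro (h | h); exacts [hxa h.symm, haK h]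
    have huS : u ∉ insert x K := by rintro (h | h); exacts [hxu h.symm, huK h]
    have hxk : ∀ k ∈ K, x ≠ k ∧ k ∈ J ∧ k ≠ a ∧ k ≠ u := fun k hk => ⟨fun h => (hKJ hk).2 h.symm, (hKJ hk).1,
      fun h => haK (h ▸ hk), fun h => huK (h ▸ hk)⟩
    have tx : RR G (J \ (insert x K \ {x})) a u := by
      refine (hns K hK (fun v hv => (hKJ hv).1) haK huK).mono ?_
      grind
    have tg : RR G (J \ (insert x K \ {kb})) a u := by
      refine (hc kc (hxk kc bw).2.1 (hxk kc bw).2.2.1 (hxk kc bw).2.2.2).mono ?_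
      grind
    have th : RR G (J \ (insert x K \ {kc})) a u := by
      refine (hc kb (hxk kb cp).2.1 (hxk kb cp).2.2.1 (hxk kb cp).2.2.2).mono ?_
      grind
    have hsep' : ¬ RR G (J \ insert x K) u a := fun h => hsep h.symm
    exact hno (star_case2 hHP htf hSm rfl rfl haJ huJ hns dw hxJ (hxk kb cp).2.1 (hxk kc bw).2.1 haS huS hsep hadj
      (hxk kb cp).1 (hxk kc bw).1 (tight haJ haS hsep tx) (tight huJ huS hsep' tx.symm)
      (tight huJ huS hsep' tg.symm) (tight huJ huS hsep' th.symm) (tight haJ haS hsep tg) (tight haJ haS hsep th) IH)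
  refine hno (star_case3 hHP htf haJ hau hnau hns ?_)
  intro Yb Ya s1 s2 c1 c2 dj ta1 ta2 tu1 tu2 x hx
  obtain ⟨k, hkJ, hka, hku, hsep⟩ := main x hx.1 hx.2.1 hx.2.2
  by_contra hxY
  have hmeet : ∀ Y, Y ⊆ {v | v ∈ J ∧ v ≠ a ∧ v ≠ u} → Cn G Y → Att G a Y → Att G u Y → x ∉ Y → k ∈ Y := by
    rintro Y hY cY ⟨y, hy, hay⟩ ⟨w, hw, huw⟩ hxY
    by_contra hkY
    refine hsep ?_
    have hsub : Y ⊆ J \ {x, k} := by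
      intro v hv
      refine ⟨(hY hv).1, ?_⟩
      rintro (h | h)
      · exact hxY (h ▸ hv)
      · exact hkY (h ▸ hv)
    have aa : RR G (J \ {x, k}) a y := RR.adj ⟨haJ, by
      grind⟩ (hsub hy) hay
    exact (aa.trans ((cY y hy w hw).mono hsub)).tail ⟨huJ, by
      grind⟩ huw.symm
  grind

end Paper

namespace Paper
variable {V : Type} {G : SimpleGraph V}

def big (G : SimpleGraph V) (𝓑 : Set (Set V)) (S : Set V) : Set V :=
  {x | ∃ B ∈ 𝓑, Disjoint B S ∧ ∃ y ∈ B, RR G Sᶜ y x}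
def S2 (G : SimpleGraph V) (S : Set V) : Prop := ∃ K L, G.IsClique K ∧ G.IsClique L ∧ S = K ∪ L
def beta (G : SimpleGraph V) (𝓑 : Set (Set V)) : Set V := {x | ∀ S, S2 G S → x ∈ S ∨ x ∈ big G 𝓑 S}

theorem S2.sub {S T : Set V} (h : S2 G S) (hT : T ⊆ S) : S2 G T := by
  obtain ⟨K, L, hK, hL, rfl⟩ := h
  refine ⟨K ∩ T, L ∩ T, hK.subset Set.inter_subset_left, hL.subset Set.inter_subset_left, ?_⟩
  grind

section
variable {𝓑 : Set (Set V)} {k : ℕ}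

theorem clique_two (htf : ∀ x y z, G.Adj x y → G.Adj y z → G.Adj x z → False) {K : Set V} (hK : G.IsClique K)
    {a b : V} (ha : a ∈ K) (hb : b ∈ K) (hab : a ≠ b) : K = {a, b} := by
  ext c
  constructor
  · intro hc
    by_contra h
    simp only [mem_insert_iff, mem_singleton_iff, not_or] at h
    exact htf _ _ _ (hK ha hb hab) (hK hb hc (Ne.symm h.2)) (hK ha hc (Ne.symm h.1))
  · rintro (rfl | rfl) <;> assumption

theorem clique_card (htf : ∀ x y z, G.Adj x y → G.Adj y z → G.Adj x z → False) {K : Set V} (hK : G.IsClique K) :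
    K.encard ≤ 2 := by
  by_cases h : K.Subsingleton
  · exact (Set.encard_le_one_iff_subsingleton.2 h).trans (by norm_num)
  · rw [Set.not_subsingleton_iff] at h
    obtain ⟨a, ha, b, hb, hab⟩ := h
    rw [clique_two htf hK ha hb hab]
    rw [Set.encard_pair hab]

theorem S2.card (htf : ∀ x y z, G.Adj x y → G.Adj y z → G.Adj x z → False) {S : Set V} (h : S2 G S) :
    S.encard ≤ 4 := by
  obtain ⟨K, L, hK, hL, rfl⟩ := h
  calc _ ≤ K.encard + L.encard := Set.encard_union_le _ _
    _ ≤ 2 + 2 := add_le_add (clique_card htf hK) (clique_card htf hL)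
    _ = 4 := by norm_num

theorem Good.avoid [Finite V] (h : Good G 𝓑 k) (hk : 9 ≤ k) {S T : Set V} (hS : S2 G S) (hT : S2 G T) :
    ∃ B ∈ 𝓑, Disjoint B (S ∪ T) := by
  have hf : (S ∪ T).Finite := Set.toFinite _
  have : (S ∪ T).encard ≤ 8 := (Set.encard_union_le _ _).trans
    ((add_le_add (hS.card h.tf) (hT.card h.tf)).trans (by norm_num))
  obtain ⟨B, hB, hd⟩ := h.ord hf.toFinset (by
    have ac : ((hf.toFinset).card : ℕ∞) ≤ 8 := by rw [← hf.encard_eq_coe_toFinset_card]; exact this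
    have ah : (hf.toFinset).card ≤ 8 := by exact_mod_cast ac
    omega)
  exact ⟨B, hB, by simpa using hd⟩

theorem big_sub {S : Set V} : big G 𝓑 S ⊆ Sᶜ := by rintro x ⟨B, _, _, y, _, h⟩; exact h.right
theorem big_step {S : Set V} {x y : V} (hx : x ∈ big G 𝓑 S) (hy : y ∉ S) (h : G.Adj x y) : y ∈ big G 𝓑 S := by
  obtain ⟨B, hB, hd, z, hz, hr⟩ := hx
  exact ⟨B, hB, hd, z, hz, hr.tail hy h⟩
theorem big_step' {S : Set V} {x y : V} (hx : x ∈ big G 𝓑 S) (h : G.Adj x y) : y ∈ S ∨ y ∈ big G 𝓑 S := by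
  by_cases hy : y ∈ S
  · exact .inl hy
  · exact .inr (big_step hx hy h)
theorem big_rr {S : Set V} {x y : V} (hx : x ∈ big G 𝓑 S) (h : RR G Sᶜ x y) : y ∈ big G 𝓑 S := by
  obtain ⟨B, hB, hd, z, hz, hr⟩ := hx
  exact ⟨B, hB, hd, z, hz, hr.trans h⟩
theorem sub_big {S B : Set V} (hB : B ∈ 𝓑) (hd : Disjoint B S) : B ⊆ big G 𝓑 S :=
  fun x hx => ⟨B, hB, hd, x, hx, RR.refl (Set.disjoint_left.1 hd hx)⟩
theorem big_mono {S T : Set V} (h : S ⊆ T) : big G 𝓑 T ⊆ big G 𝓑 S := by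
  rintro x ⟨B, hB, hd, y, hy, hr⟩
  exact ⟨B, hB, hd.mono_right h, y, hy, hr.mono (Set.compl_subset_compl.2 h)⟩
theorem big_conn (hbr : Br G 𝓑) {S : Set V} {x y : V} (hx : x ∈ big G 𝓑 S) (hy : y ∈ big G 𝓑 S) : RR G Sᶜ x y := by
  obtain ⟨B, hB, hd, z, hz, hr⟩ := hx
  obtain ⟨B', ar, dx, za, ap, bu⟩ := hy
  obtain ⟨a, ha, b, hb, hab⟩ := hbr.touch B hB B' ar
  have ea := (hbr.cn B hB z hz a ha).mono (Set.subset_compl_iff_disjoint_right.2 hd)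
  have eb := (hbr.cn B' ar b hb za ap).mono (Set.subset_compl_iff_disjoint_right.2 dx)
  have ec : RR G Sᶜ a b := by
    rcases hab with rfl | hab
    · exact RR.refl ea.right
    · exact RR.adj ea.right eb.left hab
  exact hr.symm.trans (ea.trans (ec.trans (eb.trans bu)))
theorem big_cn (hbr : Br G 𝓑) {S : Set V} : Cn G (big G 𝓑 S) := by
  intro x hx y hy
  have := (big_conn hbr hx hy).inComp
  exact this.mono fun z hz => big_rr hx hz
theorem big_closed (hbr : Br G 𝓑) {S C : Set V} {y : V} (hy : y ∈ big G 𝓑 S) (hyC : y ∈ C)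
    (hC : ∀ a ∈ C, ∀ b, b ∉ S → G.Adj a b → b ∈ C) : big G 𝓑 S ⊆ C :=
  fun _ hz => (big_conn hbr hy hz).closed hyC fun a ha _ b hb => hC a ha b hb

theorem P1 [Finite V] (h : Good G 𝓑 k) {v a b : V} (ha : a ∈ beta G 𝓑) (hb : b ∈ beta G 𝓑)
    (hva : G.Adj v a) (hvb : G.Adj v b) : a = b := by
  by_contra hab
  have nab : ¬ G.Adj a b := fun hab => h.tf _ _ _ hva hab hvb
  obtain ⟨Zb, Za, t⟩ := star h.hp h.tf _ {v}ᶜ rfl a b hva.ne.symm hvb.ne.symm hab nab (by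
    intro K hK hKJ haK hbK
    have hS : S2 G (K ∪ {v}) := ⟨K, {v}, hK, by simp, rfl⟩
    have ea := (ha _ hS).resolve_left (by rintro (h | h); exacts [haK h, hva.ne.symm h])
    have eb := (hb _ hS).resolve_left (by rintro (h | h); exacts [hbK h, hvb.ne.symm h])
    refine (big_conn h.br ea eb).mono fun z hz => ⟨fun h => hz (.inr h), fun h => hz (.inl h)⟩)
  exact h.hp.false t.c1 t.c2 t.an t.dj hab nab t.a1 t.a2 t.u1 t.u2 t.ta1 t.ta2 t.tu1 t.tu2
    (fun h => t.s1 h rfl) (fun h => t.s2 h rfl) hva hvb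

structure MaxS (G : SimpleGraph V) (𝓑 : Set (Set V)) (x : V) (S : Set V) : Prop where
  s2 : S2 G S
  xS : x ∉ S
  xb : x ∉ big G 𝓑 S
  tA : ∀ s ∈ S, Att G s (comp G Sᶜ x)
  mx : ∀ T, S2 G T → x ∉ T → x ∉ big G 𝓑 T → comp G Sᶜ x ⊆ comp G Tᶜ x → comp G Tᶜ x ⊆ comp G Sᶜ x

theorem MaxS.dis {x : V} {S : Set V} (m : MaxS G 𝓑 x S) {y : V} (h : y ∈ comp G Sᶜ x) : y ∉ big G 𝓑 S :=
  fun ac => m.xb (big_rr ac (RR.symm h))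

theorem exists_MaxS [Finite V] (h : Good G 𝓑 k) (hk : 9 ≤ k) {x : V} (hx : x ∉ beta G 𝓑) : ∃ S, MaxS G 𝓑 x S := by
  classical
  have : ∃ S, S2 G S ∧ x ∉ S ∧ x ∉ big G 𝓑 S := by
    simp only [beta, Set.mem_ofPred_eq] at hx; push Not at hx; exact hx
  obtain ⟨S0, ⟨bb, aa, ac⟩, hmax⟩ := Set.Finite.exists_maximalFor (fun S => (comp G Sᶜ x).ncard)
    {S | S2 G S ∧ x ∉ S ∧ x ∉ big G 𝓑 S} (Set.toFinite _) this
  obtain ⟨S, hS⟩ : ∃ S, S = {s | s ∈ S0 ∧ Att G s (comp G S0ᶜ x)} := ⟨_, rfl⟩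
  have hSS : S ⊆ S0 := by rw [hS]; exact fun _ h => h.1
  have xS : x ∉ S := fun h => aa (hSS h)
  have hc : comp G Sᶜ x = comp G S0ᶜ x := by
    refine Set.Subset.antisymm (fun y hy => ?_) fun y hy => RR.mono hy (Set.compl_subset_compl.2 hSS)
    refine RR.closed hy (mem_comp aa) fun a ha _ b hb hab => comp_step ha (fun ak => hb ?_) hab
    rw [hS]; exact ⟨ak, a, ha, hab.symm⟩
  refine ⟨S, bb.sub hSS, xS, fun hb => ?_, ?_, ?_⟩
  · obtain ⟨C, hC, hd⟩ := h.avoid hk bb bb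
    rw [Set.union_self] at hd
    obtain ⟨c, hcC⟩ := h.br.ne C hC
    have ea := sub_big (G := G) hC hd hcC
    have eb := big_conn h.br hb (big_mono hSS ea)
    have ec : c ∈ comp G S0ᶜ x := hc ▸ eb
    exact ac (big_rr ea (RR.symm ec))
  · grind
  · intro T hT xT xb hsub
    rw [hc] at hsub ⊢
    have := hmax (j := T) ⟨hT, xT, xb⟩ (Set.ncard_le_ncard hsub (Set.toFinite _))
    exact (Set.eq_of_subset_of_ncard_le hsub this (Set.toFinite _)).symm.subset

theorem MaxS.no {x : V} {S T : Set V} (m : MaxS G 𝓑 x S) (hT : S2 G T) (hTA : ∀ y ∈ comp G Sᶜ x, y ∉ T)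
    (xb : x ∉ big G 𝓑 T) {k : V} (hkS : k ∈ S) (hkT : k ∉ T) : False := by
  have hx := mem_comp (G := G) (s := Sᶜ) m.xS
  have hsub : comp G Sᶜ x ⊆ comp G Tᶜ x := Cn.sub_comp Cn_comp hTA hx (mem_comp (hTA x hx))
  obtain ⟨y, hy, hky⟩ := m.tA k hkS
  exact comp_sub (m.mx T hT (hTA x hx) xb hsub (comp_step (hsub hy) hkT hky.symm)) hkS

theorem MaxS.step {x : V} {S : Set V} {y z : V} (h : y ∈ comp G Sᶜ x) (hyz : G.Adj y z) :
    z ∈ comp G Sᶜ x ∨ z ∈ S := by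
  by_cases hz : z ∈ S
  · exact .inr hz
  · exact .inl (comp_step h hz hyz)

theorem MaxS.tB [Finite V] (h : Good G 𝓑 k) (hk : 9 ≤ k) {x : V} {S : Set V} (m : MaxS G 𝓑 x S) :
    ∀ s ∈ S, Att G s (big G 𝓑 S) := by
  intro s hs
  by_contra hn
  obtain ⟨C, hC, hd⟩ := h.avoid hk m.s2 m.s2
  rw [Set.union_self] at hd
  obtain ⟨c, hcC⟩ := h.br.ne C hC
  have hsub : {s | s ∈ S ∧ Att G s (big G 𝓑 S)} ⊆ S := fun _ h => h.1
  refine m.no (m.s2.sub hsub) (fun y hy aw => comp_sub hy (hsub aw)) (fun hx => m.xb ?_) hs (fun h => hn h.2)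
  refine big_closed h.br (big_mono hsub (sub_big hC hd hcC)) (sub_big hC hd hcC) (fun a ha b hb hab => ?_) hx
  rcases big_step' ha hab with h | h
  · exact absurd ⟨h, a, ha, hab.symm⟩ hb
  · exact h

theorem P2 [Finite V] (h : Good G 𝓑 k) (hk : 9 ≤ k) {x w : V} {S S' : Set V} (m : MaxS G 𝓑 x S)
    (ma : MaxS G 𝓑 w S') (hwS : w ∈ S) : False := by
  obtain ⟨Kc, Ka, fh, dl, hSe, dt⟩ : ∃ K L, G.IsClique K ∧ G.IsClique L ∧ S = K ∪ L ∧ w ∈ K := by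
    obtain ⟨K, L, aa, ac, ah⟩ := m.s2
    grind
  obtain ⟨C, hC, hd⟩ := h.avoid hk m.s2 ma.s2
  obtain ⟨c, hcC⟩ := h.br.ne C hC
  have bl : c ∈ big G 𝓑 S := sub_big hC (hd.mono_right Set.subset_union_left) hcC
  have dh : c ∈ big G 𝓑 S' := sub_big hC (hd.mono_right Set.subset_union_right) hcC
  have cw : c ∈ big G 𝓑 (S ∪ S') := sub_big hC hd hcC
  obtain ⟨A, hA⟩ : ∃ A, A = comp G Sᶜ x := ⟨_, rfl⟩
  obtain ⟨Aa, ck⟩ : ∃ Aa, Aa = comp G S'ᶜ w := ⟨_, rfl⟩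
  obtain ⟨B, hB⟩ : ∃ B, B = big G 𝓑 S := ⟨_, rfl⟩
  obtain ⟨B', ar⟩ : ∃ B', B' = big G 𝓑 S' := ⟨_, rfl⟩
  have tB := m.tB h hk
  have ti := ma.tB h hk
  have tA := m.tA
  have tj := ma.tA
  have cB : Cn G B := hB ▸ big_cn h.br
  have ii : Cn G B' := ar ▸ big_cn h.br
  have cA : Cn G A := hA ▸ Cn_comp
  have ij : Cn G Aa := ck ▸ Cn_comp
  have AS : ∀ y ∈ A, y ∉ S := fun y hy => comp_sub (hA ▸ hy)
  have Ac : ∀ y ∈ Aa, y ∉ S' := fun y hy => comp_sub (ck ▸ hy)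
  have BS : ∀ y ∈ B, y ∉ S := fun y hy => big_sub (hB ▸ hy)
  have Bb : ∀ y ∈ B', y ∉ S' := fun y hy => big_sub (ar ▸ hy)
  have AB : ∀ y ∈ A, y ∉ B := fun y hy => hB ▸ m.dis (hA ▸ hy)
  have Ab : ∀ y ∈ Aa, y ∉ B' := fun y hy => ar ▸ ma.dis (ck ▸ hy)
  have sA : ∀ y ∈ A, ∀ z, G.Adj y z → z ∈ A ∨ z ∈ S := fun y hy z hyz => hA ▸ MaxS.step (hA ▸ hy) hyz
  have sb : ∀ y ∈ Aa, ∀ z, G.Adj y z → z ∈ Aa ∨ z ∈ S' := fun y hy z hyz => ck ▸ MaxS.step (ck ▸ hy) hyz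
  have sB : ∀ y ∈ B, ∀ z, G.Adj y z → z ∈ S ∨ z ∈ B := fun y hy z hyz => hB ▸ big_step' (hB ▸ hy) hyz
  have se : ∀ y ∈ B', ∀ z, G.Adj y z → z ∈ S' ∨ z ∈ B' := fun y hy z hyz => ar ▸ big_step' (ar ▸ hy) hyz
  have xA : x ∈ A := hA ▸ mem_comp m.xS
  have wb : w ∈ Aa := ck ▸ mem_comp ma.xS
  have no : ∀ T, S2 G T → (∀ y ∈ A, y ∉ T) → x ∉ big G 𝓑 T → w ∉ T → False :=
    fun T aa ac ah aj => m.no aa (hA ▸ ac) ah hwS aj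
  rw [← hA] at tA; rw [← ck] at tj; rw [← hB] at tB bl; rw [← ar] at ti dh
  have hS'' : ¬ S2 G {y | (y ∈ S ∧ y ∈ S') ∨ (y ∈ S ∧ y ∈ B') ∨ (y ∈ S' ∧ y ∈ B)} := by
    intro ac
    refine no _ ac ?_ ?_ ?_
    · grind
    · intro hx
      refine AB x xA ?_
      refine (big_closed h.br (C := B ∩ B') (y := c) ⟨C, hC, ?_, c, hcC, RR.refl ?_⟩ ⟨bl, dh⟩ ?_ hx).1
      all_goals grind
    grind
  have cl : ∀ {K : Set V}, G.IsClique K → ∀ a ∈ K, ∀ b ∈ K, a = b ∨ G.Adj a b := fun hK a ha b hb => by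
    tauto
  have hK1A : ∀ y ∈ Kc, y ∈ Aa ∨ y ∈ S' := by
    grind
  have K1S : ∀ y ∈ Kc, y ∈ S := fun y hy => hSe ▸ .inl hy
  have K2S : ∀ y ∈ Ka, y ∈ S := fun y hy => hSe ▸ .inr hy
  obtain ⟨n, hnS, hnB⟩ : ∃ n ∈ S, n ∈ B' := by
    by_contra hn; push Not at hn
    refine hS'' (ma.s2.sub ?_)
    grind
  have fi : ∀ y ∈ Kc, y ∉ B' := fun y hy hyB => (hK1A y hy).elim (fun h => Ab y h hyB) (Bb y hyB)
  have fj : n ∈ Ka := (hSe ▸ hnS : n ∈ Kc ∪ Ka).resolve_left fun h => fi n h hnB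
  have hK2B : ∀ y ∈ Ka, y ∈ S' ∨ y ∈ B' := by
    grind
  obtain ⟨ba, hbS, hbB⟩ : ∃ b ∈ S', b ∈ B := by
    by_contra hn; push Not at hn
    refine hS'' (m.s2.sub ?_)
    grind
  obtain ⟨ai, haS, haA⟩ : ∃ a ∈ S', a ∈ A := by
    have c1 : Cn G (insert w (insert n A)) := (cA.insert (tA n hnS)).insert ((tA w hwS).mono (Set.subset_insert _ _))
    obtain ⟨p, q, hp, -, hq, hqA, hpq, -⟩ := (c1 w (.inl rfl) n (.inr (.inl rfl))).exit wb (fun h => Ab n h hnB)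
    have hqS := (sb p hp q hpq).resolve_left hqA
    rcases hq with rfl | rfl | hq
    all_goals grind
  have nf : ¬ (ai = ba ∨ G.Adj ai ba) := by
    grind
  obtain ⟨Kd, Kb, fk, dm, dn, bc, au⟩ : ∃ K L, G.IsClique K ∧ G.IsClique L ∧ S' = K ∪ L ∧ ai ∈ K ∧ ba ∈ L := by
    obtain ⟨K, L, aa, ac, ah⟩ := ma.s2
    grind
  have K1S' : ∀ y ∈ Kd, y ∈ S' := fun y hy => dn ▸ .inl hy
  have K2S' : ∀ y ∈ Kb, y ∈ S' := fun y hy => dn ▸ .inr hy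
  have hK1A' : ∀ y ∈ Kd, y ∈ A ∨ y ∈ S := by
    grind
  have hK2B' : ∀ y ∈ Kb, y ∈ S ∨ y ∈ B := by
    grind
  have hSS : ∀ y, (y ∈ S ∧ y ∈ S') ∨ (y ∈ S ∧ y ∈ B') ∨ (y ∈ S' ∧ y ∈ B) → y ∈ Ka ∨ y ∈ Kb ∨ (y ∈ Kc ∧ y ∈ Kd) := by
    grind
  obtain ⟨j, av, dy, ik, jq⟩ : ∃ j, j ∈ Kc ∧ j ∈ Kd ∧ j ∉ Ka ∧ j ∉ Kb := by
    by_contra hn; push Not at hn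
    refine hS'' (S2.sub (S := Ka ∪ Kb) ⟨Ka, Kb, dl, dm, rfl⟩ fun y hy => ?_)
    grind
  have hwj : w ≠ j := by rintro rfl; exact Ac _ wb (K1S' _ dy)
  have haj : ai ≠ j := by rintro rfl; exact AS _ haA (K1S _ av)
  have il := clique_two h.tf fh dt av hwj
  have ei := clique_two h.tf fk dy bc haj.symm
  have jw : G.Adj j w := fh av dt hwj.symm
  have ja : G.Adj j ai := fk dy bc haj.symm
  have wa : w ≠ ai := by rintro rfl; exact AS _ haA hwS
  have nwa : ¬ G.Adj w ai := fun e => h.tf _ _ _ jw e ja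
  have anAB : ∀ y ∈ A, ∀ z ∈ B, ¬ G.Adj y z := fun y hy z hz e => (sA y hy z e).elim (fun h => AB z h hz) (BS z hz)
  have anAB' : ∀ y ∈ Aa, ∀ z ∈ B', ¬ G.Adj y z := fun y hy z hz e => (sb y hy z e).elim (fun h => Ab z h hz) (Bb z hz)
  by_cases hm : ∃ p, p ∈ Ka ∧ p ∈ Kb
  · obtain ⟨p, hp, bt⟩ := hm
    have hpn : p ≠ n := by rintro rfl; exact Bb _ hnB (K2S' _ bt)
    have hpb : p ≠ ba := by rintro rfl; exact BS _ hbB (K2S _ hp)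
    have io := clique_two h.tf dl hp fj hpn
    have ip := clique_two h.tf dm bt au hpb
    have pn : G.Adj p n := dl hp fj hpn
    have pb : G.Adj p ba := dm bt au hpb
    have hnb : n ≠ ba := by rintro rfl; exact BS _ hbB hnS
    have nnb : ¬ G.Adj n ba := fun e => h.tf _ _ _ pn e pb
    obtain ⟨D, hD⟩ : ∃ D, D = big G 𝓑 (S ∪ S') := ⟨_, rfl⟩
    have DB : D ⊆ B := by rw [hD, hB]; exact big_mono Set.subset_union_left
    have Da : D ⊆ B' := by rw [hD, ar]; exact big_mono Set.subset_union_right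
    have key : ∀ K, G.IsClique K → (∀ y ∈ Ka, Att G y D → y ∈ K) → (∀ y ∈ Kb, Att G y D → y ∈ K) → False := by
      intro K hK aa ac
      have hT : ∀ y, (y ∈ S ∨ y ∈ S') → Att G y D → y = j ∨ y ∈ K := by
        rintro y hy ⟨d, hdD, hyd⟩
        have : (y ∈ S ∧ y ∈ S') ∨ (y ∈ S ∧ y ∈ B') ∨ (y ∈ S' ∧ y ∈ B) := by
          rcases sB d (DB hdD) y hyd.symm with ea | ea <;> rcases se d (Da hdD) y hyd.symm with eb | eb
          all_goals grind
        rcases hSS y this with e | e | ⟨ea, eb⟩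
        · exact .inr (aa y e ⟨d, hdD, hyd⟩)
        · exact .inr (ac y e ⟨d, hdD, hyd⟩)
        · left
          rw [il] at ea; rw [ei] at eb
          rcases ea with rfl | ea
          all_goals grind
      refine no {y | (y ∈ S ∨ y ∈ S') ∧ Att G y D} (S2.sub ⟨{j}, K, by simp, hK, rfl⟩ fun y hy => hT y hy.1 hy.2) ?_ ?_ ?_
      · rintro y hy ⟨-, d, hdD, hyd⟩
        exact anAB y hy d (DB hdD) hyd
      · intro hx
        refine AB x xA (DB (big_closed h.br (C := D) (y := c) ?_ (hD ▸ cw) ?_ hx))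
        · exact big_mono (fun y hy => hy.1) cw
        · intro a ha b hb hab
          rw [hD] at ha ⊢
          exact (big_step' ha hab).resolve_left fun h => hb ⟨h, a, hD ▸ ha, hab.symm⟩
      · rintro ⟨-, d, hdD, hyd⟩
        exact anAB' w wb d (Da hdD) hyd
    have hnD : Att G n D := by
      by_contra hn
      refine key Kb dm (fun y hy hyD => ?_) fun y hy _ => hy
      rw [io] at hy
      rcases hy with rfl | rfl
      exacts [bt, absurd hyD hn]
    have hbD : Att G ba D := by
      by_contra hn
      refine key Ka dl (fun y hy _ => hy) (fun y hy hyD => ?_)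
      rw [ip] at hy
      rcases hy with rfl | rfl
      exacts [hp, absurd hyD hn]
    obtain ⟨y, hy, hwy⟩ := tA w hwS
    refine h.hp.false (Zb := D) (Za := A ∪ Aa) (a := n) (b := ba) (v := p) (hD ▸ big_cn h.br)
      (cA.union ij ⟨y, hy, w, wb, .inr hwy.symm⟩) ?_ ?_ hnb nnb (fun h => BS n (DB h) hnS) ?_
      (fun h => Bb ba (Da h) hbS) ?_ hnD ((tA n hnS).mono Set.subset_union_left) hbD
      ((tj ba hbS).mono Set.subset_union_right) (fun h => BS p (DB h) (K2S _ hp)) ?_ pn pb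
    · rintro y hy z (hz | hz) e
      exacts [anAB z hz y (DB hy) e.symm, anAB' z hz y (Da hy) e.symm]
    · rw [Set.disjoint_left]
      rintro y hy (hz | hz)
      exacts [AB y hz (DB hy), Ab y hz (Da hy)]
    all_goals grind
  · push Not at hm
    obtain ⟨y, hy, hwy⟩ := tA w hwS
    have fl : ∀ z ∈ A, z ∈ S' → z = ai := by
      intro z hz hzS
      rcases dn ▸ hzS with e | e
      · rw [ei] at e
        rcases e with rfl | e
        exacts [absurd (K1S _ av) (AS _ hz), e]
      grind
    have fn : y ∈ Aa := (sb w wb y hwy).resolve_right fun e => nwa (fl y hy e ▸ hwy)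
    have hyn : y ∉ S ∪ S' := by rintro (e | e); exacts [AS y hy e, Ac y fn e]
    obtain ⟨D, hD⟩ : ∃ D, D = comp G (S ∪ S')ᶜ y := ⟨_, rfl⟩
    have yD : y ∈ D := hD ▸ mem_comp hyn
    have DA : D ⊆ A := by
      intro z hz
      rw [hD] at hz
      exact RR.closed hz hy fun a ha _ b hb hab => (sA a ha b hab).resolve_right fun e => hb (.inl e)
    have Db : D ⊆ Aa := by
      intro z hz
      rw [hD] at hz
      exact RR.closed hz fn fun a ha _ b hb hab => (sb a ha b hab).resolve_right fun e => hb (.inr e)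
    by_cases haD : Att G ai D
    · refine h.hp.false (Zb := D) (Za := B ∪ B') (a := w) (b := ai) (v := j) (hD ▸ Cn_comp)
        (cB.union ii ⟨c, bl, c, dh, .inl rfl⟩) ?_ ?_ wa nwa (fun e => AS w (DA e) hwS) ?_
        (fun e => Ac ai (Db e) haS) ?_ ⟨y, yD, hwy⟩ ((tB w hwS).mono Set.subset_union_left) haD
        ((ti ai haS).mono Set.subset_union_right) (fun e => AS j (DA e) (K1S _ av)) ?_ jw ja
      · rintro y hy z (hz | hz) e
        exacts [anAB y (DA hy) z hz e, anAB' y (Db hy) z hz e]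
      · rw [Set.disjoint_left]
        rintro y hy (hz | hz)
        exacts [AB y (DA hy) hz, Ab y (Db hy) hz]
      all_goals grind
    · have hcut := h.cut {w, j} (clique_pair jw.symm)
      have hr := hcut y (by rintro (e | e); exacts [AS y hy (e ▸ hwS), AS y hy (e ▸ K1S _ av)]) c
        (by rintro (e | e); exacts [BS c bl (e ▸ hwS), BS c bl (e ▸ K1S _ av)])
      obtain ⟨p, q, hp, -, hq, hqD, hpq, -⟩ := hr.exit yD (fun e => AB c (DA e) bl)
      have hqS : q ∈ S ∪ S' := by
        by_contra e
        exact hqD (by rw [hD] at hp ⊢; exact comp_step hp e hpq)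
      have qb := sA p (DA hp) q hpq
      have qc := sb p (Db hp) q hpq
      have qa : q ≠ ai := by rintro rfl; exact haD ⟨p, hp, hpq.symm⟩
      have qd : q ∈ S := qb.elim (fun e => absurd (fl q e (hqS.elim (fun ee => absurd ee (AS q e)) id)) qa) id
      rcases hSe ▸ qd with e | e
      · grind
      · have qe : q ∈ S' := qc.elim (fun ee => ((hK2B q e).elim (Ac q ee) (Ab q ee)).elim) id
        rcases dn ▸ qe with ee | ee
        · rw [ei] at ee
          rcases ee with rfl | ee
          exacts [ik e, qa ee]
        · exact hm q e ee

theorem beta_main [Finite V] (h : Good G 𝓑 k) (hk : 9 ≤ k) : ∃ β : Set V,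
    (∀ v a b, a ∈ β → b ∈ β → G.Adj v a → G.Adj v b → a = b) ∧
    (∀ x ∉ β, ∃ K L, G.IsClique K ∧ G.IsClique L ∧ K ⊆ β ∧ L ⊆ β ∧ ∀ z ∈ β, Att G z (comp G βᶜ x) → z ∈ K ∨ z ∈ L) ∧
    ∀ B ∈ 𝓑, ∃ b ∈ B, b ∈ β := by
  have key : ∀ x ∉ beta G 𝓑, ∃ S, S2 G S ∧ x ∉ S ∧ x ∉ big G 𝓑 S ∧ S ⊆ beta G 𝓑 := by
    intro x hx
    obtain ⟨S, m⟩ := exists_MaxS h hk hx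
    refine ⟨S, m.s2, m.xS, m.xb, fun w hw => ?_⟩
    by_contra hwb
    obtain ⟨S', ma⟩ := exists_MaxS h hk hwb
    exact P2 h hk m ma hw
  refine ⟨beta G 𝓑, fun v a b ha hb => P1 h ha hb, fun x hx => ?_, fun B hB => ?_⟩
  · obtain ⟨S, ⟨K, L, hK, hL, rfl⟩, xS, xb, hS⟩ := key x hx
    refine ⟨K, L, hK, hL, fun y hy => hS (.inl hy), fun y hy => hS (.inr hy), fun z hz ⟨d, hd, hzd⟩ => ?_⟩
    by_contra hn
    have iq : z ∉ K ∪ L := hn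
    have hzb := (hz _ ⟨K, L, hK, hL, rfl⟩).resolve_left iq
    refine xb (big_rr (big_step hzb (fun e => comp_sub hd (hS e)) hzd) (RR.symm (RR.mono hd (Set.compl_subset_compl.2 hS))))
  · by_contra hn; push Not at hn
    obtain ⟨x, hx⟩ := h.br.ne B hB
    obtain ⟨S, aa, ac, ah, aj⟩ := key x (hn x hx)
    exact ah (sub_big hB (Set.disjoint_left.2 fun y hy hyS => hn y hy (aj hyS)) hx)

end
end Paper

namespace Paper
variable {V : Type} {G : SimpleGraph V}

def cls (G : SimpleGraph V) (β : Set V) (x : V) : Set V := {y | y ∈ β ∧ (y = x ∨ G.Adj x y)}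
def HG (G : SimpleGraph V) (β : Set V) : SimpleGraph (Set V) where
  Adj c ca := c ≠ ca ∧ ∃ x ∈ β, ∃ y ∈ β, c = cls G β x ∧ ca = cls G β y ∧
    ∃ d ∉ β, Att G x (comp G βᶜ d) ∧ Att G y (comp G βᶜ d)
  symm := ⟨fun _ _ ⟨h, x, hx, y, hy, ea, eb, d, hd, aa, ac⟩ => ⟨h.symm, y, hy, x, hx, eb, ea, d, hd, ac, aa⟩⟩
  loopless := ⟨fun _ h => h.1 rfl⟩

variable {β : Set V}
theorem mem_cls {x : V} (hx : x ∈ β) : x ∈ cls G β x := ⟨hx, .inl rfl⟩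

theorem cls_mate (pa : ∀ v a b, a ∈ β → b ∈ β → G.Adj v a → G.Adj v b → a = b)
    {x y : V} (hx : x ∈ β) (hy : y ∈ β) (h : G.Adj x y) : cls G β x = cls G β y := by
  have key : ∀ x ∈ β, ∀ y ∈ β, G.Adj x y → cls G β x ⊆ cls G β y := by
    rintro x hx y hy h z ⟨hz, rfl | e⟩
    · exact ⟨hz, .inr h.symm⟩
    · exact ⟨hz, .inl (pa x z y hz hy e h)⟩
  grind [adj_comm]

theorem cls_eq (pa : ∀ v a b, a ∈ β → b ∈ β → G.Adj v a → G.Adj v b → a = b)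
    {x y : V} (hx : x ∈ β) (hy : y ∈ β) : cls G β x = cls G β y ↔ x = y ∨ G.Adj x y := by
  constructor
  · intro h
    have : y ∈ cls G β x := h ▸ mem_cls hy
    exact this.2.imp Eq.symm id
  · rintro (rfl | h)
    · rfl
    · exact cls_mate pa hx hy h

theorem HG_rr (pa : ∀ v a b, a ∈ β → b ∈ β → G.Adj v a → G.Adj v b → a = b)
    {B : Set V} {x y : V} (h : RR G B x y) (hx : x ∈ β) (hy : y ∈ β) :
    RR (HG G β) (cls G β '' (B ∩ β)) (cls G β x) (cls G β y) := by
  have : (y ∈ β → RR (HG G β) (cls G β '' (B ∩ β)) (cls G β x) (cls G β y)) ∧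
      (y ∉ β → ∃ z ∈ β, Att G z (comp G βᶜ y) ∧ RR (HG G β) (cls G β '' (B ∩ β)) (cls G β x) (cls G β z)) := by
    refine h.ind (P := fun y => (y ∈ β → RR (HG G β) (cls G β '' (B ∩ β)) (cls G β x) (cls G β y)) ∧
      (y ∉ β → ∃ z ∈ β, Att G z (comp G βᶜ y) ∧ RR (HG G β) (cls G β '' (B ∩ β)) (cls G β x) (cls G β z)))
      ⟨fun _ => RR.refl ⟨x, ⟨h.left, hx⟩, rfl⟩, fun h => absurd hx h⟩ ?_
    rintro a b ha ⟨ib, ie⟩ hb hab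
    by_cases haβ : a ∈ β <;> by_cases hbβ : b ∈ β
    · refine ⟨fun _ => cls_mate pa haβ hbβ hab ▸ ib haβ, fun h => absurd hbβ h⟩
    · exact ⟨fun h => absurd h hbβ, fun _ => ⟨a, haβ, ⟨b, mem_comp hbβ, hab⟩, ib haβ⟩⟩
    · refine ⟨fun _ => ?_, fun h => absurd hbβ h⟩
      obtain ⟨z, hz, hza, hr⟩ := ie haβ
      by_cases e : cls G β z = cls G β b
      · exact e ▸ hr
      · exact hr.tail ⟨b, ⟨hb, hbβ⟩, rfl⟩ ⟨e, z, hz, b, hbβ, rfl, rfl, a, haβ, hza, a, mem_comp haβ, hab.symm⟩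
    · refine ⟨fun h => absurd h hbβ, fun _ => ?_⟩
      obtain ⟨z, hz, hza, hr⟩ := ie haβ
      exact ⟨z, hz, (comp_eq (comp_step (s := βᶜ) (mem_comp haβ) hbβ hab)) ▸ hza, hr⟩
  exact this.1 hy

theorem HG_bramble (pa : ∀ v a b, a ∈ β → b ∈ β → G.Adj v a → G.Adj v b → a = b)
    {𝓑 : Set (Set V)} {k : ℕ} (hbr : Br G 𝓑) (hord : Ord 𝓑 (2 * k)) (hβ : ∀ B ∈ 𝓑, ∃ b ∈ B, b ∈ β) :
    ∃ 𝓒, Br (HG G β) 𝓒 ∧ Ord 𝓒 k := by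
  classical
  refine ⟨(fun B => cls G β '' (B ∩ β)) '' 𝓑, ⟨?_, ?_, ?_⟩, ?_⟩
  · rintro _ ⟨B, hB, rfl⟩ _ ⟨x, hx, rfl⟩ _ ⟨y, hy, rfl⟩
    exact HG_rr pa (hbr.cn B hB x hx.1 y hy.1) hx.2 hy.2
  · aesop
  · rintro _ ⟨B, hB, rfl⟩ _ ⟨C, hC, rfl⟩
    obtain ⟨b, hb, hbβ⟩ := hβ B hB
    obtain ⟨c, hc, hcβ⟩ := hβ C hC
    have hr := HG_rr pa ((hbr.cn B hB).union (hbr.cn C hC) (hbr.touch B hB C hC) b (.inl hb) c (.inr hc)) hbβ hcβ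
    by_cases h : cls G β c ∈ cls G β '' (B ∩ β)
    · exact ⟨_, h, _, ⟨c, ⟨hc, hcβ⟩, rfl⟩, .inl rfl⟩
    · obtain ⟨p, q, hp, -, hq, hqB, hpq, -⟩ := hr.exit (T := cls G β '' (B ∩ β)) ⟨b, ⟨hb, hbβ⟩, rfl⟩ h
      obtain ⟨z, ⟨hz | hz, hzβ⟩, rfl⟩ := hq
      · grind
      · exact ⟨p, hp, _, ⟨z, ⟨hz, hzβ⟩, rfl⟩, .inr hpq⟩
  · intro X hX
    have hfin : ∀ x ∈ β, ∃ F : Finset V, F.card ≤ 2 ∧ (F : Set V) = cls G β x := by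
      intro x hx
      by_cases h : ∃ y ∈ β, G.Adj x y
      · obtain ⟨y, hy, e⟩ := h
        refine ⟨{x, y}, Finset.card_le_two, ?_⟩
        ext z
        simp only [Finset.coe_insert, Finset.coe_singleton, mem_insert_iff, mem_singleton_iff]
        constructor
        · rintro (rfl | rfl)
          exacts [mem_cls hx, ⟨hy, .inr e⟩]
        · rintro ⟨hz, ee | ee⟩
          exacts [.inl ee, .inr (pa x z y hz hy ee e)]
      · refine ⟨{x}, by simp, ?_⟩
        ext z
        simp only [Finset.coe_singleton, mem_singleton_iff]
        exact ⟨fun e => by rw [e]; exact mem_cls hx, fun ⟨hz, e⟩ => e.resolve_right fun ee => h ⟨z, hz, ee⟩⟩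
    let φ : Set V → Finset V := fun c => if h : ∃ F : Finset V, F.card ≤ 2 ∧ (F : Set V) = c then h.choose else ∅
    have hφ : ∀ c, (φ c).card ≤ 2 := by
      intro c
      by_cases h : ∃ F : Finset V, F.card ≤ 2 ∧ (F : Set V) = c
      all_goals grind
    obtain ⟨B, hB, hd⟩ := hord (X.biUnion φ) (by
      have := Finset.card_biUnion_le_card_mul X φ 2 (fun c _ => hφ c)
      omega)
    refine ⟨_, ⟨B, hB, rfl⟩, ?_⟩
    rw [Set.disjoint_left] at hd ⊢
    rintro _ ⟨x, ⟨hxB, hx⟩, rfl⟩ ir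
    refine hd hxB ?_
    simp only [Finset.coe_biUnion, mem_iUnion]
    refine ⟨_, ir, ?_⟩
    have h := hfin x hx
    have : ((φ (cls G β x) : Finset V) : Set V) = cls G β x := by
      grind
    rw [this]; exact mem_cls hx

end Paper

namespace Paper
variable {V : Type} {G : SimpleGraph V}

def Minor {U W : Type} (F : SimpleGraph U) (H : SimpleGraph W) : Prop :=
  ∃ M : U → Set W, (∀ u, (M u).Nonempty ∧ Cn H (M u)) ∧ (∀ u v, u ≠ v → Disjoint (M u) (M v)) ∧
    ∀ u v, F.Adj u v → ∃ a ∈ M u, ∃ b ∈ M v, H.Adj a b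

theorem Minor.mono {U W : Type} {F : SimpleGraph U} {H Ha : SimpleGraph W} (h : Minor F H) (hH : H ≤ Ha) : Minor F Ha := by
  obtain ⟨M, aa, ac, ah⟩ := h
  refine ⟨M, fun u => ⟨(aa u).1, (aa u).2.monoG hH⟩, ac, fun u v huv => ?_⟩
  obtain ⟨a, ha, b, hb, hab⟩ := ah u v huv
  tauto

theorem RR_interval {s : Set V} {g : ℕ → V} {a b : ℕ} (hab : a ≤ b) (aa : ∀ k, a ≤ k → k ≤ b → g k ∈ s)
    (ac : ∀ k, a ≤ k → k < b → G.Adj (g k) (g (k + 1))) : RR G s (g a) (g b) := by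
  induction b, hab using Nat.le_induction with
  | base => exact RR.refl (aa a le_rfl le_rfl)
  | succ b hb ih =>
    exact (ih (fun k hk al => aa k hk (by omega)) (fun k hk al => ac k hk (by omega))).tail (aa _ (by omega) le_rfl)
      (ac b hb (by omega))

def szz (N : ℕ) : ℕ → ℕ
  | 0 => 1
  | d + 1 => N * szz N d + 1

theorem path_or_star {α : Type} [Finite α] {T : SimpleGraph α} (N : ℕ) (d : ℕ) : ∀ (J : Set α) (x : α), x ∈ J → Cn T J →
    szz N d ≤ J.ncard → (∃ r : ℕ → α, r 0 = x ∧ (∀ i ≤ d, r i ∈ J) ∧ (∀ i < d, T.Adj (r i) (r (i + 1))) ∧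
      ∀ i ≤ d, ∀ j ≤ d, r i = r j → i = j) ∨
    ∃ c ∈ J, N ≤ {y | y ∈ J ∧ T.Adj c y}.ncard := by
  induction d with
  | zero =>
    intro J x hx _ _
    exact .inl ⟨fun _ => x, rfl, fun _ _ => hx, fun i hi => by omega, fun i hi j hj _ => by omega⟩
  | succ d ih =>
    intro J x hx hJ hc
    by_cases hst : N ≤ {y | y ∈ J ∧ T.Adj x y}.ncard
    · exact .inr ⟨x, hx, hst⟩
    by_cases hbig : ∃ y, y ∈ J ∧ T.Adj x y ∧ szz N d ≤ (comp T (J \ {x}) y).ncard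
    · obtain ⟨y, hy, hxy, hs⟩ := hbig
      rcases ih (comp T (J \ {x}) y) y (mem_comp (s := J \ {x}) ⟨hy, hxy.ne.symm⟩) Cn_comp hs with ⟨r, rg, rJ, ra, ri⟩ | ⟨c, hc, hN⟩
      · left
        refine ⟨fun i => if i = 0 then x else r (i - 1), by simp, ?_, ?_, ?_⟩
        · intro i hi
          dsimp only; split_ifs
          · exact hx
          · exact (comp_sub (rJ (i - 1) (by omega))).1
        · intro i hi
          rcases i with _ | i
          all_goals grind
        · intro i hi j hj
          rcases i with _ | i <;> rcases j with _ | j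
          · simp
          · intro h; simp at h
            exact absurd h.symm (comp_sub (rJ j (by omega))).2
          · intro h; simp at h
            exact absurd h (comp_sub (rJ i (by omega))).2
          grind
      · right
        refine ⟨c, (comp_sub hc).1, hN.trans (Set.ncard_le_ncard ?_ (Set.toFinite _))⟩
        exact fun z hz => ⟨(comp_sub hz.1).1, hz.2⟩
    · exfalso
      push Not at hbig hst
      have hsub : J ⊆ insert x (⋃ y ∈ (Set.toFinite {y | y ∈ J ∧ T.Adj x y}).toFinset, comp T (J \ {x}) y) := by
        intro z hz
        by_cases hzx : z = x
        · exact .inl hzx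
        · right
          obtain ⟨a, b, ha, -, hb, hbT, hab, hr⟩ := (hJ z hz x hx).exit (T := {x}ᶜ) hzx (by simp)
          have : b = x := by simpa using hbT
          subst this
          simp only [Set.Finite.mem_toFinset, mem_iUnion]
          exact ⟨a, ⟨hr.right.1, hab.symm⟩, hr.symm⟩
      have aa := Set.ncard_le_ncard hsub (Set.toFinite _)
      have ac := Set.ncard_insert_le x (⋃ y ∈ (Set.toFinite {y | y ∈ J ∧ T.Adj x y}).toFinset, comp T (J \ {x}) y)
      have ah := Finset.set_ncard_biUnion_le (Set.toFinite {y | y ∈ J ∧ T.Adj x y}).toFinset (fun y => comp T (J \ {x}) y)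
      have aj : ∑ y ∈ (Set.toFinite {y | y ∈ J ∧ T.Adj x y}).toFinset, (comp T (J \ {x}) y).ncard
          ≤ ∑ y ∈ (Set.toFinite {y | y ∈ J ∧ T.Adj x y}).toFinset, (szz N d - 1) := by
        refine Finset.sum_le_sum fun y hy => ?_
        rw [Set.Finite.mem_toFinset] at hy
        grind
      rw [Finset.sum_const, smul_eq_mul, ← Set.ncard_eq_toFinset_card] at aj
      have am : {y | y ∈ J ∧ T.Adj x y}.ncard * (szz N d - 1) ≤ N * szz N d := Nat.mul_le_mul hst.le (by omega)
      have aq : {y | y ∈ J ∧ T.Adj x y}.ncard * (szz N d - 1) < N * szz N d ∨ szz N d = 0 := by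
        rcases Nat.eq_zero_or_pos (szz N d) with h | h
        · exact .inr h
        · left; calc _ ≤ N * (szz N d - 1) := Nat.mul_le_mul hst.le le_rfl
            _ < N * szz N d := Nat.mul_lt_mul_of_pos_left (by omega) (by omega)
      have ci : 0 < szz N d := by cases d <;> simp [szz]
      simp only [szz] at hc
      omega

theorem cut [Finite V] {A B : Set V} {n : ℕ} {len : Fin n → ℕ} {p : Fin n → ℕ → V} (h : IsLk G A B n len p)
    (jb : Fin n) {l : ℕ} (hl : l < len jb) (hcr : ¬ Lk (G.deleteEdges {s(p jb l, p jb (l + 1))}) A B n) :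
    ∃ (S : Finset V) (τ : Fin n → ℕ) (L : Set V), S.card ≤ n ∧ τ jb = l + 1 ∧
      (∀ j k, k ≤ len j → (p j k ∈ L ↔ k < τ j)) ∧
      ∀ a ∈ L, ∀ b, G.Adj a b → b ∉ S → b ∉ L → a = p jb l ∧ b = p jb (l + 1) := by
  classical
  obtain ⟨Ga, bs⟩ : ∃ Ga, Ga = G.deleteEdges {s(p jb l, p jb (l + 1))} := ⟨_, rfl⟩
  rw [← bs] at hcr
  have hS : ∃ S, Sep Ga A B S ∧ S.card < n := by
    by_contra hn; push Not at hn
    exact hcr (menger Ga A B n hn)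
  obtain ⟨S, hS, hSn⟩ := hS
  have fo : ∀ a b, G.Adj a b → ¬ (a = p jb l ∧ b = p jb (l + 1)) → ¬ (a = p jb (l + 1) ∧ b = p jb l) → Ga.Adj a b := by
    simp_all
  have padj : ∀ j k, k < len j → (j ≠ jb ∨ k ≠ l) → Ga.Adj (p j k) (p j (k + 1)) := by
    intro j k hk hne
    refine fo _ _ (h.adj j k hk) (fun e => ?_) (fun e => ?_)
    · obtain ⟨ea, eb⟩ := h.inj _ _ _ _ hk.le hl.le e.1
      grind
    · obtain ⟨-, eb⟩ := h.inj _ _ _ _ hk.le hl e.1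
      obtain ⟨-, ec⟩ := h.inj _ _ _ _ hk hl.le e.2
      omega
  have hit : ∀ j, j ≠ jb → ∃ k, k ≤ len j ∧ p j k ∈ S := by
    intro j hj
    by_contra hn; push Not at hn
    exact hS _ (h.st j) _ (h.en j) (RR_interval (Nat.zero_le _) (fun k _ hk => by simpa using hn k hk)
      fun k _ hk => padj j k hk (.inl hj))
  choose! σ hσ hσS using hit
  have himg : (Finset.univ.erase jb).image (fun j => p j (σ j)) = S := by
    refine Finset.eq_of_subset_of_card_le (fun v hv => ?_) ?_
    · grind
    · rw [Finset.card_image_of_injOn]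
      · rw [Finset.card_erase_of_mem (Finset.mem_univ _), Finset.card_univ, Fintype.card_fin]; omega
      · intro i hi j hj e
        exact (h.inj _ _ _ _ (hσ i (Finset.ne_of_mem_erase hi)) (hσ j (Finset.ne_of_mem_erase hj)) e).1
  have hmem : ∀ j k, k ≤ len j → p j k ∈ S → j ≠ jb ∧ k = σ j := by
    intro j k hk hs
    rw [← himg] at hs
    obtain ⟨i, hi, e⟩ := Finset.mem_image.1 hs
    obtain ⟨rfl, eb⟩ := h.inj _ _ _ _ (hσ i (Finset.ne_of_mem_erase hi)) hk e
    grind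
  obtain ⟨L, hL⟩ : ∃ L, L = {v | ∃ a ∈ A, RR Ga (↑S : Set V)ᶜ a v} := ⟨_, rfl⟩
  have hiff : ∀ j k, k ≤ len j → (p j k ∈ L ↔ k < if j = jb then l + 1 else σ j) := by
    intro j k hk
    rw [hL]
    by_cases hj : j = jb
    · subst hj
      rw [if_pos rfl]
      have nS : ∀ k ≤ len j, p j k ∈ (↑S : Set V)ᶜ := fun k hk hs => (hmem j k hk hs).1 rfl
      constructor
      · rintro ⟨a, ha, hr⟩
        by_contra hkl
        exact hS a ha _ (h.en j) (hr.trans (RR_interval hk (fun i _ hi => nS i hi) fun i hi bi => padj j i bi (.inr (by omega))))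
      · intro hkl
        exact ⟨_, h.st j, RR_interval (Nat.zero_le _) (fun i _ hi => nS i (by omega)) fun i hi bi => padj j i (by omega) (.inr (by omega))⟩
    · rw [if_neg hj]
      constructor
      · rintro ⟨a, ha, hr⟩
        by_contra hkl
        have bw : k ≠ σ j := by rintro rfl; exact hr.right (hσS j hj)
        refine hS a ha _ (h.en j) (hr.trans (RR_interval hk (fun i hi bi hs => ?_) fun i hi bi => padj j i bi (.inl hj)))
        grind
      · intro hkl
        refine ⟨_, h.st j, RR_interval (Nat.zero_le _) (fun i _ hi hs => ?_) fun i hi bi => padj j i (by omega) (.inl hj)⟩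
        grind
  refine ⟨S, fun j => if j = jb then l + 1 else σ j, L, hSn.le, by simp, hiff, ?_⟩
  intro a ha b hab hbS hbL
  have ao := ha
  rw [hL] at ao
  obtain ⟨c, hc, hr⟩ := ao
  by_contra hne
  refine hbL ?_
  rw [hL]
  refine ⟨c, hc, hr.tail hbS (fo a b hab hne fun e => ?_)⟩
  grind

theorem wall_of_rungs {n : ℕ} {len : Fin n → ℕ} {p : Fin n → ℕ → V} (N : ℕ)
    (hadj : ∀ i, ∀ k < len i, G.Adj (p i k) (p i (k + 1)))
    (hinj : ∀ i j k l, k ≤ len i → l ≤ len j → p i k = p j l → i = j ∧ k = l)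
    (R : ℕ → Fin n) (hR : ∀ i ≤ N, ∀ j ≤ N, R i = R j → i = j) (Q U : ℕ → Set V) (τ : ℕ → Fin n → ℕ)
    (O : ∀ b ≤ 2 * N * N, ∀ ba ≤ 2 * N * N, ∀ i ≤ N, ∀ k ≤ len (R i), p (R i) k ∈ Q ba →
      (ba ≤ b → k < τ b (R i)) ∧ (b < ba → τ b (R i) ≤ k))
    (hU : ∀ b ≤ 2 * N * N, ∀ ba ≤ 2 * N * N, b ≠ ba → Disjoint (U b) (U ba))
    (hUr : ∀ b ≤ 2 * N * N, ∀ i ≤ N, ∀ k ≤ len (R i), p (R i) k ∉ U b)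
    (rung : ∀ b ≤ 2 * N * N, ∀ i < N, ∃ k ≤ len (R i), ∃ ka ≤ len (R (i + 1)), p (R i) k ∈ Q b ∧ p (R (i + 1)) ka ∈ Q b ∧
      RR G (insert (p (R i) k) (insert (p (R (i + 1)) ka) (U b))) (p (R i) k) (p (R (i + 1)) ka)) :
    Minor (Wall N) G := by
  have rung' : ∀ b i, b ≤ 2 * N * N → i < N → ∃ k ≤ len (R i), ∃ ka ≤ len (R (i + 1)), p (R i) k ∈ Q b ∧ p (R (i + 1)) ka ∈ Q b ∧
      ∃ Z : Set V, Cn G Z ∧ p (R i) k ∈ Z ∧ Att G (p (R (i + 1)) ka) Z ∧ ∀ z ∈ Z, z = p (R i) k ∨ z ∈ U b := by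
    intro b i hb hi
    obtain ⟨k, hk, ka, al, aa, ac, hr⟩ := rung b hb i hi
    have hne : p (R i) k ≠ p (R (i + 1)) ka := by
      grind
    refine ⟨k, hk, ka, al, aa, ac, comp G (insert (p (R i) k) (U b)) (p (R i) k), Cn_comp, mem_comp (.inl rfl), ?_,
      fun z hz => (comp_sub hz : z ∈ insert (p (R i) k) (U b))⟩
    obtain ⟨x, y, hx, -, hy, hyT, hxy, bu⟩ := hr.exit (T := {p (R (i + 1)) ka}ᶜ) hne (by simp)
    have : y = p (R (i + 1)) ka := by simpa using hyT
    subst this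
    refine ⟨x, bu.mono ?_, hxy.symm⟩
    rintro z ⟨h | h | h, hz⟩
    exacts [.inl h, absurd h hz, .inr h]
  choose! K hK Ke dz hQ fp Z cZ kZ aZ sZ using rung'
  have lt : ∀ {i j}, i < N → j < 2 * N → j * N + i + 1 ≤ 2 * N * N := by
    intro i j hi hj
    have := Nat.mul_le_mul_right N (Nat.succ_le_of_lt hj)
    grind
  have hle : ∀ {j}, j ≤ 2 * N → j * N ≤ 2 * N * N := fun hj => Nat.mul_le_mul_right N hj
  have mono : ∀ b ba, b < ba → ba ≤ 2 * N * N → ∀ i < N, τ b (R i) < τ ba (R i) ∧ τ b (R i) ≤ len (R i) := by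
    intro b ba hbb ak i hi
    have hk := hK ba i ak hi
    have aa := (O b (by omega) ba ak i hi.le _ hk (hQ ba i ak hi)).2 hbb
    grind
  have mono' : ∀ b ba, b ≤ ba → ba ≤ 2 * N * N → ∀ i < N, τ b (R i) ≤ τ ba (R i) := by
    grind
  obtain ⟨I, hI⟩ : ∃ I : ℕ → ℕ → Set V, ∀ i j, I i j = {v | ∃ k ≤ len (R i), τ (j * N) (R i) ≤ k ∧ k < τ (j * N + N) (R i) ∧ v = p (R i) k} :=
    ⟨_, fun _ _ => rfl⟩
  have hsub : ∀ i j, i < N → j < 2 * N → ∀ z ∈ Z (j * N + i + 1) i, z ∈ I i j ∨ z ∈ U (j * N + i + 1) := by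
    intro i j hi hj z hz
    refine (sZ _ _ (lt hi hj) hi z hz).imp (fun e => ?_) id
    rw [hI, e]
    exact ⟨_, hK _ _ (lt hi hj) hi, (O _ (hle hj.le) _ (lt hi hj) i hi.le _ (hK _ _ (lt hi hj) hi) (hQ _ _ (lt hi hj) hi)).2 (by omega),
      (O _ (by have := lt (i := N - 1) (by omega) hj; omega) _ (lt hi hj) i hi.le _ (hK _ _ (lt hi hj) hi) (hQ _ _ (lt hi hj) hi)).1 (by omega), rfl⟩
  have jN : ∀ j, j < 2 * N → j * N + N ≤ 2 * N * N := fun j hj => by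
    grind
  have cI : ∀ i j, Cn G (I i j) := by
    intro i j
    have key : ∀ k ka, k ≤ ka → τ (j * N) (R i) ≤ k → ka ≤ len (R i) → ka < τ (j * N + N) (R i) → RR G (I i j) (p (R i) k) (p (R i) ka) := by
      intro k ka hkk aa ac ah
      refine RR_interval hkk (fun l hl bh => ?_) fun l hl bh => hadj _ _ (by omega)
      rw [hI]; exact ⟨l, by omega, by omega, by omega, rfl⟩
    intro x hx y hy
    rw [hI] at hx hy
    obtain ⟨k, aa, ac, ah, rfl⟩ := hx
    obtain ⟨ka, bp, bk, co, rfl⟩ := hy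
    rcases le_total k ka with h | h
    · exact key _ _ h ac bp co
    · exact (key _ _ h bk aa ah).symm
  have low : ∀ i j, i < N → j < 2 * N → p (R i) (τ (j * N) (R i)) ∈ I i j := by
    intro i j hi hj
    rw [hI]
    have := mono (j * N) (j * N + N) (by omega) (jN j hj) i hi
    exact ⟨_, this.2, le_rfl, this.1, rfl⟩
  refine ⟨fun u => I u.1 u.2 ∪ Z (u.2 * N + u.1 + 1) u.1, ?_, ?_, ?_⟩
  · rintro ⟨⟨i, hi⟩, ⟨j, hj⟩⟩
    dsimp only
    refine ⟨⟨_, .inl (low i j hi hj)⟩, (cI i j).union (cZ _ _ (lt hi hj) hi) ?_⟩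
    refine ⟨p (R i) (K (j * N + i + 1) i), ?_, _, kZ _ _ (lt hi hj) hi, .inl rfl⟩
    grind
  · rintro ⟨⟨i, hi⟩, ⟨j, hj⟩⟩ ⟨⟨ic, bi⟩, ⟨jc, cj⟩⟩ hne
    dsimp only
    rw [Set.disjoint_left]
    have hs : ∀ i j, i < N → j < 2 * N → ∀ z ∈ I i j ∪ Z (j * N + i + 1) i, z ∈ I i j ∨ z ∈ U (j * N + i + 1) :=
      fun i j hi hj z hz => hz.elim .inl (hsub i j hi hj z)
    intro z hz ap
    have hIU : ∀ i j b, i < N → b ≤ 2 * N * N → z ∈ I i j → z ∉ U b := by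
      intro i j b hi hb hz
      rw [hI] at hz
      obtain ⟨k, hk, -, -, rfl⟩ := hz
      exact hUr b hb i hi.le k hk
    rcases hs i j hi hj z hz with h | h <;> rcases hs ic jc bi cj z ap with ad | ad
    · rw [hI] at h ad
      obtain ⟨k, aa, ac, ah, rfl⟩ := h
      obtain ⟨ka, bp, bk, co, e⟩ := ad
      obtain ⟨ea, rfl⟩ := hinj _ _ _ _ aa bp e
      have eb := hR i hi.le ic bi.le ea
      subst eb
      rcases lt_trichotomy j jc with hjj | rfl | hjj
      · have := mono' (j * N + N) (jc * N) (by rw [← Nat.succ_mul]; exact Nat.mul_le_mul_right N hjj) (hle cj.le) i hi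
        omega
      · exact hne rfl
      · have := mono' (jc * N + N) (j * N) (by rw [← Nat.succ_mul]; exact Nat.mul_le_mul_right N hjj) (hle hj.le) i hi
        omega
    · exact hIU _ _ _ hi (lt bi cj) h ad
    · exact hIU _ _ _ bi (lt hi hj) ad h
    · refine Set.disjoint_left.1 (hU _ (lt hi hj) _ (lt bi cj) fun e => hne ?_) h ad
      have ea : j * N + i = jc * N + ic := by omega
      have eb : j = jc := by
        have := congrArg (· / N) ea
        simp only [Nat.add_comm _ i, Nat.add_comm _ ic, Nat.add_mul_div_right _ _ (show 0 < N by omega), Nat.div_eq_of_lt hi, Nat.div_eq_of_lt bi] at this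
        omega
      subst eb
      grind
  · have main : ∀ u v : Fin N × Fin (2 * N), ((u.1 = v.1 ∧ u.2.val + 1 = v.2.val) ∨ (u.2 = v.2 ∧ u.1.val + 1 = v.1.val ∧ (u.1.val + u.2.val) % 2 = 0)) →
        ∃ a ∈ I u.1 u.2 ∪ Z (u.2 * N + u.1 + 1) u.1, ∃ b ∈ I v.1 v.2 ∪ Z (v.2 * N + v.1 + 1) v.1, G.Adj a b := by
      rintro ⟨⟨i, hi⟩, ⟨j, hj⟩⟩ ⟨⟨ic, bi⟩, ⟨jc, cj⟩⟩ h
      simp only [Fin.mk.injEq] at h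
      dsimp only
      rcases h with ⟨rfl, rfl⟩ | ⟨rfl, rfl, -⟩
      · have e : (j + 1) * N = j * N + N := Nat.succ_mul _ _
        have aa := low i (j + 1) hi cj
        have ac := mono (j * N) (j * N + N) (by omega) (jN j hj) i hi
        have ah := mono (j * N + N) ((j + 1) * N + N) (by omega) (jN _ cj) i hi
        rw [e] at aa
        refine ⟨p (R i) (τ (j * N + N) (R i) - 1), .inl ?_, _, .inl aa, ?_⟩
        · rw [hI]; exact ⟨_, by omega, by omega, by omega, rfl⟩
        · have := hadj (R i) (τ (j * N + N) (R i) - 1) (by omega)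
          rwa [Nat.sub_add_cancel (by omega)] at this
      · obtain ⟨a, ha, hab⟩ := aZ _ _ (lt hi hj) hi
        refine ⟨a, .inr ha, p (R (i + 1)) (Ke (j * N + i + 1) i), .inl ?_, hab.symm⟩
        rw [hI]
        exact ⟨_, dz _ _ (lt hi hj) hi, (O _ (hle hj.le) _ (lt hi hj) (i + 1) hi _ (dz _ _ (lt hi hj) hi) (fp _ _ (lt hi hj) hi)).2 (by omega),
          (O _ (jN j hj) _ (lt hi hj) (i + 1) hi _ (dz _ _ (lt hi hj) hi) (fp _ _ (lt hi hj) hi)).1 (by omega), rfl⟩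
    intro u v huv
    rw [Wall, SimpleGraph.fromRel_adj] at huv
    rcases huv.2 with h | h
    · exact main u v h
    · obtain ⟨a, ha, b, hb, hab⟩ := main v u h
      exact ⟨b, hb, a, ha, hab.symm⟩

end Paper

namespace Paper
variable {V : Type} {G : SimpleGraph V}

def PV {n : ℕ} (len : Fin n → ℕ) (p : Fin n → ℕ → V) : Set V := {v | ∃ j, ∃ k ≤ len j, v = p j k}
def hitS {n : ℕ} (len : Fin n → ℕ) (p : Fin n → ℕ → V) (Q : Set V) : Set (Fin n) := {j | ∃ k ≤ len j, p j k ∈ Q}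

def TT (G : SimpleGraph V) {n : ℕ} (len : Fin n → ℕ) (p : Fin n → ℕ → V) (Q : Set V) : SimpleGraph (Fin n) where
  Adj j jc := j ≠ jc ∧ ∃ k ≤ len j, ∃ ka ≤ len jc, p j k ∈ Q ∧ p jc ka ∈ Q ∧
    RR G (insert (p j k) (insert (p jc ka) (Q \ PV len p))) (p j k) (p jc ka)
  symm := ⟨by
    rintro j jc ⟨hne, k, hk, ka, al, aa, ac, hr⟩
    refine ⟨hne.symm, ka, al, k, hk, ac, aa, ?_⟩
    rw [Set.insert_comm]; exact hr.symm⟩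
  loopless := ⟨fun _ h => h.1 rfl⟩

theorem TT_cn {n : ℕ} {len : Fin n → ℕ} {p : Fin n → ℕ → V}
    (hinj : ∀ i j k l, k ≤ len i → l ≤ len j → p i k = p j l → i = j ∧ k = l)
    {Q : Set V} (hQ : Cn G Q) : Cn (TT G len p Q) (hitS len p Q) := by
  rintro jd ⟨kd, bn, bb⟩ jb ⟨kb, cp, aa⟩
  have key := (hQ _ bb _ aa).ind (P := fun z => (∃ j, ∃ k ≤ len j, p j k ∈ Q ∧ RR (TT G len p Q) (hitS len p Q) jd j ∧
      RR G (insert (p j k) (Q \ PV len p)) (p j k) z) ∧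
      ∀ j, ∀ k ≤ len j, z = p j k → RR (TT G len p Q) (hitS len p Q) jd j) ?_ ?_
  · grind
  · refine ⟨⟨jd, kd, bn, bb, RR.refl ⟨kd, bn, bb⟩, RR.refl (.inl rfl)⟩, fun j k hk e => ?_⟩
    obtain ⟨rfl, -⟩ := hinj _ _ _ _ bn hk e
    exact RR.refl ⟨kd, bn, bb⟩
  · rintro a b ha ⟨⟨j, k, hk, hjQ, hj, hr⟩, -⟩ hb hab
    have ac : ∀ jc, ∀ ka ≤ len jc, b = p jc ka → RR (TT G len p Q) (hitS len p Q) jd jc := by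
      rintro jc ka al rfl
      by_cases hjj : j = jc
      · exact hjj ▸ hj
      · refine hj.tail ⟨ka, al, hb⟩ ⟨hjj, k, hk, ka, al, hjQ, hb, ?_⟩
        exact (hr.mono (Set.insert_subset_insert (Set.subset_insert _ _))).tail (.inr (.inl rfl)) hab
    refine ⟨?_, ac⟩
    by_cases hbP : b ∈ PV len p
    · obtain ⟨jc, ka, al, rfl⟩ := hbP
      exact ⟨jc, ka, al, hb, ac jc ka al rfl, RR.refl (.inl rfl)⟩
    · exact ⟨j, k, hk, hjQ, hj, hr.tail (.inr ⟨hb, hbP⟩) hab⟩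

theorem order_core [Finite V] {A B : Set V} {n : ℕ} {len : Fin n → ℕ} {p : Fin n → ℕ → V} (h : IsLk G A B n len p)
    {ι : Type} (Q : ι → Set V) (I : Finset ι) (s : ℕ) (hI : s * (s * n + 1) + 1 ≤ I.card)
    (hd : ∀ i ∈ I, ∀ j ∈ I, i ≠ j → Disjoint (Q i) (Q j)) (hc : ∀ i ∈ I, Cn G (Q i)) (jb : Fin n)
    (hit : ∀ i ∈ I, ∃ k ≤ len jb, p jb k ∈ Q i)
    (crit : ∀ i ∈ I, ∀ x ∈ Q i, ∀ y ∉ Q i, G.Adj x y → ¬ Lk (G.deleteEdges {s(x, y)}) A B n) :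
    ∃ (c : ℕ → ι) (τ : ℕ → Fin n → ℕ), (∀ b < s, c b ∈ I) ∧ (∀ b < s, ∀ ba < s, c b = c ba → b = ba) ∧
      ∀ b < s, ∀ ba < s, ∀ j, ∀ k ≤ len j, p j k ∈ Q (c ba) → (ba ≤ b → k < τ b j) ∧ (b < ba → τ b j ≤ k) := by
  classical
  have last : ∀ i ∈ I, ∃ k, k ≤ len jb ∧ p jb k ∈ Q i ∧ ∀ ka ≤ len jb, p jb ka ∈ Q i → ka ≤ k := by
    intro i hi
    obtain ⟨kd, bn, bb⟩ := hit i hi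
    obtain ⟨k, hk, hm⟩ := ((Finset.range (len jb + 1)).filter fun k => p jb k ∈ Q i).exists_maximal
      ⟨kd, by simp [bb]; omega⟩
    grind
  choose! l ll lQ lm using last
  have linj : Set.InjOn l I := by
    intro i hi j hj e
    grind
  obtain ⟨M, hM⟩ : ∃ M, M = s * n + 1 := ⟨_, rfl⟩
  rw [← hM] at hI
  have hcard : (I.image l).card = I.card := Finset.card_image_of_injOn linj
  obtain ⟨e, he, hmono⟩ : ∃ e : ℕ → ℕ, (∀ a ≤ s * M, e a ∈ I.image l) ∧ ∀ a b, a < b → b ≤ s * M → e a < e b := by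
    let o := (I.image l).orderEmbOfFin hcard
    refine ⟨fun a => if ha : a < I.card then o ⟨a, ha⟩ else 0, fun a ha => ?_, fun a b hab hb => ?_⟩
    · dsimp only
      rw [dif_pos (by omega)]; exact Finset.orderEmbOfFin_mem _ _ _
    · dsimp only
      rw [dif_pos (by omega), dif_pos (by omega)]
      exact o.strictMono hab
  have : Nonempty ι := by
    obtain ⟨i, -⟩ : I.Nonempty := Finset.card_pos.1 (by omega)
    exact ⟨i⟩
  have : Nonempty V := ⟨p jb 0⟩
  have : ∀ a, a ≤ s * M → ∃ i ∈ I, l i = e a := fun a ha => by simpa using he a ha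
  choose! m mI ml using this
  have hmono' : ∀ a b, a ≤ b → b ≤ s * M → e a ≤ e b := by
    intro a b hab hb
    rcases hab.eq_or_lt with rfl | h
    exacts [le_rfl, (hmono a b h hb).le]
  have minj : ∀ a b, a ≤ s * M → b ≤ s * M → m a = m b → a = b := by
    intro a b ha hb hab
    have aa := ml a ha
    rw [hab, ml b hb] at aa
    rcases lt_trichotomy a b with h | h | h
    all_goals grind
  have hbl : ∀ b < s, b * M + M ≤ s * M := by
    intro b hb
    have := Nat.mul_le_mul_right M (Nat.succ_le_of_lt hb)
    rwa [Nat.succ_mul] at this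
  have jr : 0 < M := by omega
  have cuts : ∀ b < s, ∃ (S : Finset V) (τ : Fin n → ℕ) (L : Set V), S.card ≤ n ∧ τ jb = e (b * M + M - 1) + 1 ∧
      (∀ j k, k ≤ len j → (p j k ∈ L ↔ k < τ j)) ∧
      ∀ x ∈ L, ∀ y, G.Adj x y → y ∉ S → y ∉ L → x = p jb (e (b * M + M - 1)) ∧ y = p jb (e (b * M + M - 1) + 1) := by
    intro b hb
    have ak := hbl b hb
    have aa := mI (b * M + M - 1) (by omega)
    have ac := ml (b * M + M - 1) (by omega)
    have ah := hmono (b * M + M - 1) (s * M) (by omega) le_rfl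
    have aj := ll _ (mI (s * M) le_rfl)
    rw [ml _ le_rfl] at aj
    refine cut h jb (by omega) (crit _ aa _ (ac ▸ lQ _ aa) _ (fun hq => ?_) (h.adj _ _ (by omega)))
    grind
  choose! S τ L hS hτ hL hout using cuts
  have alive : ∀ b < s, ∃ a, b * M ≤ a ∧ a < b * M + M ∧ ∀ ba < s, ∀ v ∈ S ba, v ∉ Q (m a) := by
    intro b hb
    have ak := hbl b hb
    by_contra hn; push Not at hn
    choose! f hf v hv hvQ using hn
    have bd : ∀ a ∈ Finset.Ico (b * M) (b * M + M), v a ∈ (Finset.range s).biUnion S := by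
      intro a ha
      rw [Finset.mem_Ico] at ha
      exact Finset.mem_biUnion.2 ⟨f a, Finset.mem_range.2 (hf a ha.1 ha.2), hv a ha.1 ha.2⟩
    have aa := Finset.card_le_card_of_injOn v bd (by
      intro a ha ai ao e
      rw [Finset.mem_coe, Finset.mem_Ico] at ha ao
      by_contra hne
      refine Set.disjoint_left.1 (hd _ (mI a (by omega)) _ (mI ai (by omega)) fun e => hne (minj a ai (by omega) (by omega) e))
        (hvQ a ha.1 ha.2) (e ▸ hvQ ai ao.1 ao.2))
    have ac : ((Finset.range s).biUnion S).card ≤ s * n := by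
      refine Finset.card_biUnion_le.trans ?_
      calc _ ≤ ∑ b ∈ Finset.range s, n := Finset.sum_le_sum fun b hb => hS b (Finset.mem_range.1 hb)
        _ = s * n := by simp
    rw [Nat.card_Ico] at aa
    omega
  choose! a bc bz hdj using alive
  have hale : ∀ b < s, a b ≤ s * M := fun b hb => by have := hbl b hb; have := bz b hb; omega
  have hmul : ∀ b ba, b < ba → b * M + M ≤ ba * M := by
    intro b ba hb
    have := Nat.mul_le_mul_right M (Nat.succ_le_of_lt hb)
    rwa [Nat.succ_mul] at this
  refine ⟨fun b => m (a b), τ, fun b hb => mI _ (hale b hb), fun b hb ba ak e => ?_, ?_⟩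
  · have := minj _ _ (hale b hb) (hale ba ak) e
    rcases lt_trichotomy b ba with h | h | h
    all_goals grind
  · intro b hb ba ak j k hk hq
    dsimp only at hq
    have iI := mI _ (hale ba ak)
    have hbb := hbl b hb
    have clo : ∀ x ∈ Q (m (a ba)), x ∈ L b → ∀ y ∈ Q (m (a ba)), y ∈ L b := by
      intro x hx hxL y hy
      by_contra hyL
      obtain ⟨u, w, hu, ce, hw, hwL, huw, -⟩ := (hc _ iI x hx y hy).exit (T := L b) hxL hyL
      obtain ⟨ea, eb⟩ := hout b hb u hu w huw (fun hs => hdj ba ak b hb w hs hw) hwL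
      have aa := mI (b * M + M - 1) (by omega)
      have ac := ml (b * M + M - 1) (by omega)
      have ec : m (a ba) = m (b * M + M - 1) := by
        by_contra hne
        exact Set.disjoint_left.1 (hd _ iI _ aa hne) ce (by rw [ea, ← ac]; exact lQ _ aa)
      rw [ec] at hw
      rw [eb] at hw
      have ah := hmono (b * M + M - 1) (s * M) (by omega) le_rfl
      grind
    have bv := hL b hb jb _ (ll _ iI)
    rw [hτ b hb, ml _ (hale ba ak)] at bv
    have hlq := lQ _ iI
    rw [ml _ (hale ba ak)] at hlq
    constructor
    · intro hle
      rw [← hL b hb j k hk]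
      refine clo _ hlq (bv.2 ?_) _ hq
      have : ba * M + M ≤ b * M + M := by
        have := Nat.mul_le_mul_right M hle; omega
      have := bz ba ak
      have := hmono' (a ba) (b * M + M - 1) (by omega) (by omega)
      omega
    · intro hlt
      by_contra al
      have := clo _ hq ((hL b hb j k hk).2 (by omega)) _ hlq
      rw [bv] at this
      have am := hmul b ba hlt
      have aq := bc ba ak
      have := hmono (b * M + M - 1) (a ba) (by omega) (hale ba ak)
      omega

noncomputable def dq (N n : ℕ) : ℕ := Nat.card (Set (Fin n) × SimpleGraph (Fin n)) * ((2 * N * N + 2) * ((2 * N * N + 2) * n + 1) + 1)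

theorem DL [Finite V] (N : ℕ) {A B : Set V} {n : ℕ} {len : Fin n → ℕ} {p : Fin n → ℕ → V} (h : IsLk G A B n len p)
    {ι : Type} (Q : ι → Set V) (I : Finset ι) (hI : dq N n ≤ I.card)
    (hd : ∀ i ∈ I, ∀ j ∈ I, i ≠ j → Disjoint (Q i) (Q j)) (hc : ∀ i ∈ I, Cn G (Q i))
    (hit : ∀ i ∈ I, szz (N + 1) N ≤ (hitS len p (Q i)).ncard)
    (crit : ∀ i ∈ I, ∀ x ∈ Q i, ∀ y ∉ Q i, G.Adj x y → ¬ Lk (G.deleteEdges {s(x, y)}) A B n) :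
    Minor (Wall N) G := by
  classical
  let : Fintype (Set (Fin n) × SimpleGraph (Fin n)) := Fintype.ofFinite _
  obtain ⟨⟨J, T⟩, -, hJT⟩ := Finset.exists_le_card_fiber_of_mul_le_card_of_maps_to (s := I) (t := Finset.univ)
    (f := fun i => (hitS len p (Q i), TT G len p (Q i))) (n := (2 * N * N + 2) * ((2 * N * N + 2) * n + 1) + 1)
    (fun _ _ => Finset.mem_univ _) ⟨(∅, ⊥), Finset.mem_univ _⟩ (by
      rw [Finset.card_univ, ← Nat.card_eq_fintype_card]; exact hI)
  obtain ⟨Ia, iu⟩ : ∃ Ia, Ia = I.filter (fun i => (hitS len p (Q i), TT G len p (Q i)) = (J, T)) := ⟨_, rfl⟩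
  rw [← iu] at hJT
  have hsub : ∀ i ∈ Ia, i ∈ I ∧ hitS len p (Q i) = J ∧ TT G len p (Q i) = T := by
    grind
  obtain ⟨ia, cu⟩ : Ia.Nonempty := by rw [← Finset.card_pos]; omega
  have hJc : szz (N + 1) N ≤ J.ncard := (hsub ia cu).2.1 ▸ hit ia (hsub ia cu).1
  have iv : Cn T J := by
    have := TT_cn (G := G) h.inj (hc ia (hsub ia cu).1)
    rwa [(hsub ia cu).2.1, (hsub ia cu).2.2] at this
  have hz : ∀ N d, 0 < szz N d := by intro N d; cases d <;> simp [szz]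
  obtain ⟨jb, av⟩ : J.Nonempty := by
    have := hz (N + 1) N
    exact Set.nonempty_of_ncard_ne_zero (by omega)
  have hJh : ∀ i ∈ Ia, ∀ j ∈ J, ∃ k ≤ len j, p j k ∈ Q i := by
    intro i hi j hj
    rw [← (hsub i hi).2.1] at hj; exact hj
  obtain ⟨c, τ, cI, cinj, O⟩ := order_core h Q Ia _ hJT (fun i hi j hj => hd i (hsub i hi).1 j (hsub j hj).1)
    (fun i hi => hc i (hsub i hi).1) jb (fun i hi => hJh i hi jb av)
    fun i hi => crit i (hsub i hi).1
  have cd : ∀ b < 2 * N * N + 2, ∀ ba < 2 * N * N + 2, b ≠ ba → Disjoint (Q (c b)) (Q (c ba)) := by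
    grind
  rcases path_or_star (N + 1) N J jb av iv hJc with ⟨R, -, RJ, RT, Ri⟩ | ⟨cb, ej, hst⟩
  · refine wall_of_rungs N h.adj h.inj R Ri (fun b => Q (c b)) (fun b => Q (c b) \ PV len p) τ ?_ ?_ ?_ ?_
    · grind
    · grind
    · exact fun b hb i hi k hk hq => hq.2 ⟨_, k, hk, rfl⟩
    · intro b hb i hi
      have := RT i hi
      rw [← (hsub _ (cI b (by omega))).2.2] at this
      exact this.2
  · obtain ⟨R, hRT, Ri⟩ : ∃ R : ℕ → Fin n, (∀ i ≤ N, T.Adj cb (R i)) ∧ ∀ i ≤ N, ∀ j ≤ N, R i = R j → i = j := by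
      rw [Set.ncard_eq_toFinset_card'] at hst
      obtain ⟨X, hX, hXc⟩ := Finset.exists_subset_card_eq hst
      let o := X.orderEmbOfFin hXc
      refine ⟨fun i => if hi : i < N + 1 then o ⟨i, hi⟩ else cb, fun i hi => ?_, fun i hi j hj e => ?_⟩
      · dsimp only
        rw [dif_pos (by omega)]
        have := hX (Finset.orderEmbOfFin_mem X hXc ⟨i, by omega⟩)
        grind
      · dsimp only at e
        rw [dif_pos (by omega), dif_pos (by omega)] at e
        simpa using o.injective e
    have τm : ∀ b ba, b ≤ ba → ba < 2 * N * N + 2 → τ b cb ≤ τ ba cb := by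
      grind
    obtain ⟨sg, hsg⟩ : ∃ sg : ℕ → Set V, ∀ b, sg b = {v | ∃ k ≤ len cb, τ b cb ≤ k ∧ k < τ (b + 1) cb ∧ v = p cb k} := ⟨_, fun _ => rfl⟩
    have sgP : ∀ b, sg b ⊆ PV len p := by
      intro b v hv
      rw [hsg] at hv
      obtain ⟨k, hk, -, -, e⟩ := hv
      exact ⟨_, k, hk, e⟩
    refine wall_of_rungs N h.adj h.inj R Ri (fun b => Q (c (b + 1))) (fun b => (Q (c (b + 1)) \ PV len p) ∪ sg b) (fun b => τ (b + 1)) ?_ ?_ ?_ ?_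
    · intro b hb ba ak i hi k hk hq
      have := O (b + 1) (by omega) (ba + 1) (by omega) _ k hk hq
      grind
    · intro b hb ba ak hne
      rw [Set.disjoint_left]
      rintro v (hv | hv) (bd | bd)
      · exact Set.disjoint_left.1 (cd (b + 1) (by omega) (ba + 1) (by omega) (by omega)) hv.1 bd.1
      · exact hv.2 (sgP _ bd)
      · exact bd.2 (sgP _ hv)
      · rw [hsg] at hv bd
        obtain ⟨k, hk, aa, ac, rfl⟩ := hv
        obtain ⟨ka, al, bp, bk, e⟩ := bd
        obtain ⟨-, rfl⟩ := h.inj _ _ _ _ hk al e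
        rcases Nat.lt_or_gt_of_ne hne with hlt | hlt
        all_goals grind
    · rintro b hb i hi k hk (hq | hq)
      · exact hq.2 ⟨_, k, hk, rfl⟩
      · rw [hsg] at hq
        obtain ⟨ka, al, -, -, e⟩ := hq
        exact (hRT i hi).ne (h.inj _ _ _ _ hk al e).1.symm
    · have half : ∀ b ≤ 2 * N * N, ∀ i ≤ N, ∃ k ≤ len (R i), p (R i) k ∈ Q (c (b + 1)) ∧ ∃ kd ≤ len cb, τ b cb ≤ kd ∧ kd < τ (b + 1) cb ∧
          RR G (insert (p (R i) k) ((Q (c (b + 1)) \ PV len p) ∪ sg b)) (p (R i) k) (p cb kd) := by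
        intro b hb i hi
        have := hRT i hi
        rw [← (hsub _ (cI (b + 1) (by omega))).2.2] at this
        obtain ⟨-, kd, bn, k, hk, aa, ac, hr⟩ := this
        have ah := (O b (by omega) (b + 1) (by omega) _ kd bn aa).2 (by omega)
        have aj := (O (b + 1) (by omega) (b + 1) (by omega) _ kd bn aa).1 le_rfl
        refine ⟨k, hk, ac, kd, bn, ah, aj, hr.symm.mono ?_⟩
        rintro v (rfl | rfl | hv)
        · refine .inr (.inr ?_)
          rw [hsg]; exact ⟨kd, bn, ah, aj, rfl⟩
        · exact .inl rfl
        · exact .inr (.inl hv)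
      have seg : ∀ b k ka, k ≤ ka → τ b cb ≤ k → ka ≤ len cb → ka < τ (b + 1) cb → RR G (sg b) (p cb k) (p cb ka) := by
        intro b k ka hkk aa ac ah
        refine RR_interval hkk (fun l hl bh => ?_) fun l hl bh => h.adj _ _ (by omega)
        rw [hsg]; exact ⟨l, by omega, by omega, by omega, rfl⟩
      intro b hb i hi
      obtain ⟨k, hk, hkQ, kd, bn, aa, ac, hr⟩ := half b hb i hi.le
      obtain ⟨ka, al, iw, ke, ix, bp, bk, bu⟩ := half b hb (i + 1) hi
      refine ⟨k, hk, ka, al, hkQ, iw, ?_⟩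
      have mid : RR G (sg b) (p cb kd) (p cb ke) := by
        rcases le_total kd ke with hh | hh
        · exact seg b _ _ hh aa ix bk
        · exact (seg b _ _ hh bp bn ac).symm
      refine ((hr.mono ?_).trans (mid.mono ?_)).trans (bu.symm.mono ?_)
      · exact Set.insert_subset_insert (Set.subset_insert _ _)
      · exact fun v hv => .inr (.inr (.inr hv))
      · exact Set.subset_insert _ _

end Paper

namespace Paper
variable {V : Type} {G : SimpleGraph V}

theorem few_bad [Finite V] (N : ℕ) {A B : Set V} {n : ℕ} (h : Lk G A B n) {ι : Type} (Q : ι → Set V) (I : Finset ι)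
    (hd : ∀ i ∈ I, ∀ j ∈ I, i ≠ j → Disjoint (Q i) (Q j)) (hc : ∀ i ∈ I, Cn G (Q i)) :
    Minor (Wall N) G ∨ ∃ len p, IsLk G A B n len p ∧ ∃ S ⊆ I, S.card ≤ dq N n ∧
      ∀ i ∈ I, i ∉ S → (hitS len p (Q i)).ncard < szz (N + 1) N := by
  classical
  obtain ⟨Γ0, hΓ0⟩ : ∃ Γ0 : SimpleGraph V, ∀ x y, Γ0.Adj x y ↔ G.Adj x y ∧ ∃ i ∈ I, x ∈ Q i ∧ y ∈ Q i :=
    ⟨{ Adj := fun x y => G.Adj x y ∧ ∃ i ∈ I, x ∈ Q i ∧ y ∈ Q i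
       symm := ⟨fun x y ⟨h, i, hi, aa, ac⟩ => ⟨h.symm, i, hi, ac, aa⟩⟩
       loopless := ⟨fun x h => h.1.ne rfl⟩ }, fun _ _ => Iff.rfl⟩
  obtain ⟨Γ, ⟨aa, ac, len, p, hp⟩, hm⟩ := (Set.toFinite {Γ : SimpleGraph V | Γ0 ≤ Γ ∧ Γ ≤ G ∧ Lk Γ A B n}).exists_minimal
    ⟨G, fun x y hxy => ((hΓ0 x y).1 hxy).1, le_rfl, h⟩
  by_cases hbig : dq N n ≤ (I.filter fun i => szz (N + 1) N ≤ (hitS len p (Q i)).ncard).card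
  · left
    refine Minor.mono (DL N hp Q _ hbig (fun i hi j hj => hd i (Finset.mem_filter.1 hi).1 j (Finset.mem_filter.1 hj).1) ?_
      (fun i hi => (Finset.mem_filter.1 hi).2) ?_) ac
    · intro i hi x hx y hy
      have hi := (Finset.mem_filter.1 hi).1
      refine (hc i hi x hx y hy).ind (P := fun y => RR Γ (Q i) x y) (RR.refl hx) fun a b ha hp hb hab => hp.tail hb (aa ?_)
      exact (hΓ0 _ _).2 ⟨hab, i, hi, ha.right, hb⟩
    · intro i hi x hx y hy hxy hlk
      have hi := (Finset.mem_filter.1 hi).1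
      have := hm (y := Γ.deleteEdges {s(x, y)}) ⟨fun a b hab => ?_, (SimpleGraph.deleteEdges_le _).trans ac, hlk⟩
        (SimpleGraph.deleteEdges_le _) hxy
      · simp at this
      · rw [SimpleGraph.deleteEdges_adj]
        refine ⟨aa hab, fun e => ?_⟩
        grind
  · right
    refine ⟨len, p, hp.mono ac Set.Subset.rfl Set.Subset.rfl, _, Finset.filter_subset _ _, (not_le.1 hbig).le, fun i hi hn => ?_⟩
    grind

def rst (G : SimpleGraph V) (X : Set V) : SimpleGraph V where
  Adj x y := G.Adj x y ∧ x ∈ X ∧ y ∈ X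
  symm := ⟨fun _ _ h => ⟨h.1.symm, h.2.2, h.2.1⟩⟩
  loopless := ⟨fun _ h => h.1.ne rfl⟩

theorem rst_le (X : Set V) : rst G X ≤ G := fun _ _ h => h.1

theorem sel_fin {n m : ℕ} (J : Set (Fin n)) (h : m + J.ncard ≤ n) : ∃ f : Fin m → Fin n, Function.Injective f ∧ ∀ i, f i ∉ J := by
  classical
  have aa : m ≤ (Finset.univ.filter fun i => i ∉ J).card := by
    have ac := Finset.card_filter_add_card_filter_not (s := (Finset.univ : Finset (Fin n))) (fun i => i ∈ J)
    rw [Set.ncard_eq_toFinset_card'] at h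
    have ah : J.toFinset = Finset.univ.filter fun i => i ∈ J := by ext; simp
    rw [ah] at h
    rw [Finset.card_univ, Fintype.card_fin] at ac
    omega
  obtain ⟨X, hX, hXc⟩ := Finset.exists_subset_card_eq aa
  refine ⟨X.orderEmbOfFin hXc, (X.orderEmbOfFin hXc).injective, fun i => ?_⟩
  have := hX (Finset.orderEmbOfFin_mem X hXc i)
  grind

noncomputable def dD (N : ℕ) : ℕ → ℕ
  | 0 => 0
  | r + 1 => (dD N r + szz (N + 1) N) + (r * dq N (dD N r + szz (N + 1) N) + 1)

theorem demand [Finite V] (N : ℕ) {ι : Type} (A B : ι → Set V) (s : Finset ι) : ∀ X : Set V,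
    (∀ d ∈ s, Lk (rst G X) (A d ∩ X) (B d ∩ X) (dD N s.card)) →
    Minor (Wall N) G ∨ ∃ Z : ι → Set V, (∀ d ∈ s, Z d ⊆ X ∧ Cn G (Z d) ∧ (∃ a ∈ A d, a ∈ Z d) ∧ ∃ b ∈ B d, b ∈ Z d) ∧
      ∀ d ∈ s, ∀ da ∈ s, d ≠ da → Disjoint (Z d) (Z da) := by
  classical
  induction s using Finset.induction_on with
  | empty => exact fun X _ => .inr ⟨fun _ => ∅, by simp, by simp⟩
  | insert ek s fq ih =>
    intro X h
    rw [Finset.card_insert_of_notMem fq] at h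
    obtain ⟨n, hn⟩ : ∃ n, n = dD N s.card + szz (N + 1) N := ⟨_, rfl⟩
    have hDr : dD N (s.card + 1) = n + (s.card * dq N n + 1) := by rw [dD, hn]
    rw [hDr] at h
    obtain ⟨len, p, hp⟩ := h ek (Finset.mem_insert_self _ _)
    obtain ⟨Q, hQ⟩ : ∃ Q : Fin (n + (s.card * dq N n + 1)) → Set V, ∀ i, Q i = {v | ∃ k ≤ len i, v = p i k} := ⟨_, fun _ => rfl⟩
    have hd : ∀ i ∈ Finset.univ, ∀ j ∈ Finset.univ, i ≠ j → Disjoint (Q i) (Q j) := by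
      intro i _ j _ hij
      rw [Set.disjoint_left]
      intro v hv bd
      rw [hQ] at hv bd
      obtain ⟨k, hk, rfl⟩ := hv
      obtain ⟨ka, al, e⟩ := bd
      exact hij (hp.inj _ _ _ _ hk al e).1
    have hc : ∀ i ∈ Finset.univ, Cn (rst G X) (Q i) := by
      intro i _
      refine Cn.of_center (x := p i 0) fun y hy => ?_
      rw [hQ] at hy
      obtain ⟨k, hk, rfl⟩ := hy
      refine RR_interval (Nat.zero_le _) (fun l _ hl => ?_) fun l _ hl => hp.adj _ _ (by omega)
      grind
    by_cases hmin : Minor (Wall N) (rst G X)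
    · exact .inl (hmin.mono (rst_le X))
    have fb : ∀ d, d ∈ s → ∃ (ld : Fin n → ℕ) (pc : Fin n → ℕ → V), IsLk (rst G X) (A d ∩ X) (B d ∩ X) n ld pc ∧
        ∃ S : Finset (Fin (n + (s.card * dq N n + 1))), S.card ≤ dq N n ∧ ∀ i ∉ S, (hitS ld pc (Q i)).ncard < szz (N + 1) N := by
      intro d hds
      rcases few_bad N ((h d (Finset.mem_insert_of_mem hds)).of_le (Nat.le_add_right n _)) Q Finset.univ hd hc with hm | ⟨lc, pc, aa, S, -, ac, ah⟩
      all_goals grind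
    have : Nonempty V := ⟨p ⟨0, by omega⟩ 0⟩
    choose! ld pc bt S hS hSh using fb
    obtain ⟨ia, cu⟩ : ∃ i, i ∉ s.biUnion S := by
      by_contra hn; push Not at hn
      have aa : (Finset.univ : Finset (Fin (n + (s.card * dq N n + 1)))).card ≤ (s.biUnion S).card := Finset.card_le_card fun i _ => hn i
      have ac : (s.biUnion S).card ≤ s.card * dq N n := Finset.card_biUnion_le_card_mul _ _ _ hS
      rw [Finset.card_univ, Fintype.card_fin] at aa
      omega
    have hiS : ∀ d ∈ s, ia ∉ S d := fun d hd hi => cu (Finset.mem_biUnion.2 ⟨d, hd, hi⟩)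
    have hih : ∀ d ∈ s, Lk (rst G (X \ Q ia)) (A d ∩ (X \ Q ia)) (B d ∩ (X \ Q ia)) (dD N s.card) := by
      intro d hd
      have aa := hSh d hd ia (hiS d hd)
      obtain ⟨f, hf, hfJ⟩ := sel_fin (m := dD N s.card) (hitS (ld d) (pc d) (Q ia)) (by omega)
      have hk := (bt d hd).reindex f hf
      have hnot : ∀ i, ∀ k ≤ ld d (f i), pc d (f i) k ∉ Q ia := fun i k hk hq => hfJ i ⟨k, hk, hq⟩
      refine ⟨_, _, ⟨fun i => ⟨(hk.st i).1, (hk.st i).2, hnot i _ (Nat.zero_le _)⟩,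
        fun i => ⟨(hk.en i).1, (hk.en i).2, hnot i _ le_rfl⟩, fun i k hki => ?_, hk.inj⟩⟩
      have := hk.adj i k hki
      exact ⟨this.1, ⟨this.2.1, hnot i k (Nat.le_of_lt hki)⟩, this.2.2, hnot i _ hki⟩
    rcases ih (X \ Q ia) hih with hm | ⟨Z, hZ, hZd⟩
    · exact .inl hm
    · right
      have hQX : Q ia ⊆ X := by
        intro v hv
        rw [hQ] at hv
        obtain ⟨k, hk, rfl⟩ := hv
        rcases Nat.eq_zero_or_pos k with rfl | bn
        · exact (hp.st ia).2
        · have := (hp.adj ia (k - 1) (by omega)).2.2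
          rwa [Nat.sub_add_cancel bn] at this
      have hne : ∀ d ∈ s, d ≠ ek := fun d hd e => fq (e ▸ hd)
      refine ⟨Function.update Z ek (Q ia), ?_, ?_⟩
      · intro d hd
        rcases Finset.mem_insert.1 hd with rfl | hd
        · rw [Function.update_self]
          refine ⟨hQX, (hc ia (Finset.mem_univ _)).monoG (rst_le X), ⟨_, (hp.st ia).1, ?_⟩, ⟨_, (hp.en ia).1, ?_⟩⟩
          · grind
          · rw [hQ]; exact ⟨_, le_rfl, rfl⟩
        grind
      grind

theorem select {ι : Type} [Fintype ι] [DecidableEq ι] (m q : ℕ) (hm : Fintype.card ι * q < m)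
    (Bd : ι → (ι → Fin m) → Finset (Fin m)) (dep : ∀ l f g, (∀ j, j ≠ l → f j = g j) → Bd l f = Bd l g)
    (hq : ∀ l f, (Bd l f).card ≤ q) : ∃ f, ∀ l, f l ∉ Bd l f := by
  classical
  by_contra hn; push Not at hn
  rcases isEmpty_or_nonempty ι with he | ⟨⟨lf⟩⟩
  · simp_all
  have hS : ∀ l, (Finset.univ.filter fun f : ι → Fin m => f l ∈ Bd l f).card ≤ q * m ^ (Fintype.card ι - 1) := by
    intro l
    have := Finset.card_le_mul_card_image (f := fun (f : ι → Fin m) (j : {j // j ≠ l}) => f j)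
      (Finset.univ.filter fun f : ι → Fin m => f l ∈ Bd l f) q ?_
    · refine this.trans (Nat.mul_le_mul_left _ ((Finset.card_le_univ _).trans ?_))
      rw [Fintype.card_fun, Fintype.card_fin]
      simp [Fintype.card_subtype_compl]
    · intro g hg
      obtain ⟨fc, -, rfl⟩ := Finset.mem_image.1 hg
      refine le_trans (Finset.card_le_card_of_injOn (fun f => f l) (t := Bd l fc) ?_ ?_) (hq l fc)
      · intro f hf
        simp only [Finset.coe_filter, Finset.mem_filter, Finset.mem_univ, true_and, Set.mem_ofPred_eq] at hf
        rw [dep l fc f fun j hj => (congrFun hf.2 ⟨j, hj⟩).symm]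
        exact hf.1
      · intro f hf js fr e
        simp only [Finset.coe_filter, Finset.mem_filter, Finset.mem_univ, true_and, Set.mem_ofPred_eq] at hf fr
        funext j
        by_cases hj : j = l
        · exact hj ▸ e
        · exact (congrFun hf.2 ⟨j, hj⟩).trans (congrFun fr.2 ⟨j, hj⟩).symm
  have aa : (Finset.univ : Finset (ι → Fin m)).card ≤ ((Finset.univ : Finset ι).biUnion fun l => Finset.univ.filter fun f : ι → Fin m => f l ∈ Bd l f).card := by
    refine Finset.card_le_card fun f _ => ?_
    obtain ⟨l, hl⟩ := hn f
    exact Finset.mem_biUnion.2 ⟨l, Finset.mem_univ _, Finset.mem_filter.2 ⟨Finset.mem_univ _, hl⟩⟩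
  have ac := aa.trans (Finset.card_biUnion_le_card_mul _ _ _ fun l _ => hS l)
  rw [Finset.card_univ, Finset.card_univ, Fintype.card_fun, Fintype.card_fin, ← mul_assoc] at ac
  have hpos : 0 < Fintype.card ι := Fintype.card_pos_iff.2 ⟨lf⟩
  have ah : m ^ Fintype.card ι = m * m ^ (Fintype.card ι - 1) := by
    rw [← pow_succ']; congr 1; omega
  rw [ah] at ac
  have aj : 0 < m ^ (Fintype.card ι - 1) := pow_pos (by omega) _
  have := Nat.le_of_mul_le_mul_right ac aj
  omega

end Paper

namespace Paper
variable {V : Type} {G : SimpleGraph V}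

theorem bramble_path [Finite V] {𝓑 : Set (Set V)} (h : Br G 𝓑) (hne : 𝓑.Nonempty) :
    ∃ (L : ℕ) (p : ℕ → V), (∀ i < L, G.Adj (p i) (p (i + 1))) ∧ (∀ i ≤ L, ∀ j ≤ L, p i = p j → i = j) ∧ ∀ B ∈ 𝓑, ∃ i ≤ L, p i ∈ B := by
  classical
  by_contra hcon
  push Not at hcon
  have key : ∀ m : ℕ, ∃ L ≥ m, ∃ p : ℕ → V, (∀ i < L, G.Adj (p i) (p (i + 1))) ∧ (∀ i ≤ L, ∀ j ≤ L, p i = p j → i = j) ∧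
      ∃ B ∈ 𝓑, p L ∈ B ∧ ∀ i ≤ L, p i ∈ B → i = L := by
    intro m
    induction m with
    | zero =>
      obtain ⟨B, hB⟩ := hne
      obtain ⟨v, hv⟩ := h.ne B hB
      exact ⟨0, le_rfl, fun _ => v, fun i hi => by omega, fun i hi j hj _ => by omega, B, hB, hv, fun i hi _ => by omega⟩
    | succ m ih =>
      obtain ⟨L, hL, p, aa, ac, B, hB, hLB, ah⟩ := ih
      obtain ⟨B', ar, aj⟩ := hcon L p aa ac
      obtain ⟨y, hy⟩ := h.ne B' ar
      obtain ⟨n, g, ⟨gs, ga⟩, gc, gn, -, -, gY, gi⟩ := exists_SP (X := {p L}) (Y := B') rfl hy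
        ((h.cn B hB).union (h.cn B' ar) (h.touch B hB B' ar) (p L) (.inl hLB) y (.inr hy))
      rw [mem_singleton_iff] at gc
      have hn : 0 < n := by
        grind
      have cross : ∀ i ≤ L, ∀ j, L < j → j ≤ L + n → p i ≠ g (j - L) := by
        grind
      refine ⟨L + n, by omega, fun i => if i ≤ L then p i else g (i - L), ?_, ?_, B', ar, ?_, ?_⟩
      · intro i hi
        dsimp only
        by_cases hiL : i < L
        · grind
        · rw [if_neg (show ¬ i + 1 ≤ L by omega)]
          have := ga (i - L) (by omega)
          rw [show i + 1 - L = i - L + 1 by omega]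
          split_ifs with hh
          · have : i = L := by omega
            subst this
            grind
          · exact this
      · intro i hi j hj
        dsimp only
        split_ifs with ha hb hb
        · exact ac i ha j hb
        · grind
        · grind
        · intro e
          have := gi _ (by omega) _ (by omega) e
          omega
      · dsimp only
        rw [if_neg (by omega), Nat.add_sub_cancel_left]; exact gn
      · intro i hi
        dsimp only
        split_ifs with ha
        · grind
        · intro e
          have := gY _ (by omega) e
          omega
  obtain ⟨L, hL, p, -, hp, -⟩ := key (Nat.card V)
  have := Nat.card_le_card_of_injective (fun i : Fin (L + 1) => p i) (fun i j e => Fin.ext (hp i (by omega) j (by omega) e))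
  simp at this
  omega

theorem hubs_aux {L : ℕ} {p : ℕ → V} (k : ℕ) (hk : 0 < k) (m : ℕ) : ∀ (a : ℕ) (𝓑 : Set (Set V)), (∀ B ∈ 𝓑, ∃ i ≤ L, a ≤ i ∧ p i ∈ B) →
    Ord 𝓑 (m * k) → ∃ (x y : ℕ → ℕ), (∀ i < m, a ≤ x i ∧ y i ≤ L + 1) ∧ (∀ i < m, ∀ j < m, i < j → y i ≤ x j) ∧
      ∀ i < m, Ord {B | B ∈ 𝓑 ∧ ∃ l, x i ≤ l ∧ l < y i ∧ p l ∈ B} k := by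
  classical
  induction m with
  | zero => exact fun a 𝓑 _ _ => ⟨fun _ => 0, fun _ => 0, by simp, by simp, by simp⟩
  | succ m ih =>
    intro a 𝓑 hB ho
    have hle : k ≤ (m + 1) * k := Nat.le_mul_of_pos_left _ (by omega)
    have hex : ∃ b, Ord {B | B ∈ 𝓑 ∧ ∃ l, a ≤ l ∧ l < b ∧ p l ∈ B} k := by
      refine ⟨L + 1, fun X hX => ?_⟩
      obtain ⟨B, aa, ac⟩ := ho X (by omega)
      grind
    have hbL : Nat.find hex ≤ L + 1 := by
      refine Nat.find_min' hex fun X hX => ?_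
      obtain ⟨B, aa, ac⟩ := ho X (by omega)
      grind
    have hbs := Nat.find_spec hex
    have hbm := fun {b} => Nat.find_min hex (m := b)
    generalize Nat.find hex = b at hbL hbs hbm
    have hab : a < b := by
      by_contra hn
      obtain ⟨B, ⟨-, l, aa, ac, -⟩, -⟩ := hbs ∅ (by simpa using hk)
      omega
    obtain ⟨X, hXc, hX⟩ : ∃ X : Finset V, X.card < k ∧ ∀ B ∈ 𝓑, (∃ l, a ≤ l ∧ l < b - 1 ∧ p l ∈ B) → ¬ Disjoint B (↑X : Set V) := by
      have := hbm (b := b - 1) (by omega)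
      rw [Ord] at this; push Not at this
      grind
    have qb : ∀ B ∈ {B | B ∈ 𝓑 ∧ ∀ l, a ≤ l → l < b → p l ∉ B}, ∃ i ≤ L, b ≤ i ∧ p i ∈ B := by
      grind
    have qc : Ord {B | B ∈ 𝓑 ∧ ∀ l, a ≤ l → l < b → p l ∉ B} (m * k) := by
      intro Y hY
      obtain ⟨B, aa, ac⟩ := ho (insert (p (b - 1)) (X ∪ Y)) (by
        have := Finset.card_insert_le (p (b - 1)) (X ∪ Y)
        grind)
      rw [Set.disjoint_left] at ac
      refine ⟨B, ⟨aa, fun l hl hlb hlB => ?_⟩, Set.disjoint_left.2 fun v hv hvY => ac hv ?_⟩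
      · by_cases bh : l = b - 1
        · subst bh; exact ac hlB (by simp)
        · refine hX B aa ⟨l, hl, by omega, hlB⟩ (Set.disjoint_left.2 fun v hv hvY => ac hv ?_)
          rw [Finset.mem_coe] at hvY ⊢; simp [hvY]
      · rw [Finset.mem_coe] at hvY ⊢; simp [hvY]
    obtain ⟨x, y, aa, ac, ah⟩ := ih b _ qb qc
    refine ⟨fun i => if i = 0 then a else x (i - 1), fun i => if i = 0 then b else y (i - 1), ?_, ?_, ?_⟩
    · grind
    · grind
    · intro i hi
      rcases i with _ | i
      · simpa using hbs
      · intro Y hY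
        obtain ⟨B, ⟨fi, jt⟩, ju⟩ := ah i (by omega) Y hY
        grind

theorem hubs [Finite V] {𝓑 : Set (Set V)} (h : Br G 𝓑) (m k : ℕ) (hm : 0 < m) (hk : 0 < k) (ho : Ord 𝓑 (m * k)) :
    ∃ C : Fin m → Set V, (∀ i, Cn G (C i) ∧ (C i).Nonempty) ∧ (∀ i j, i ≠ j → Disjoint (C i) (C j)) ∧ ∀ i j, i ≠ j → Lk G (C i) (C j) k := by
  classical
  have hne : 𝓑.Nonempty := by
    obtain ⟨B, hB, -⟩ := ho ∅ (by simpa using ⟨hm, hk⟩)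
    exact ⟨B, hB⟩
  obtain ⟨L, p, aa, ac, ah⟩ := bramble_path h hne
  obtain ⟨x, y, aj, am, aq⟩ := hubs_aux (L := L) (p := p) k hk m 0 𝓑 (fun B hB => by
    grind) ho
  have lt : ∀ i j : Fin m, (i : ℕ) < j → Disjoint {v | ∃ l, x i ≤ l ∧ l < y i ∧ v = p l} {v | ∃ l, x j ≤ l ∧ l < y j ∧ v = p l} := by
    intro i j hij
    rw [Set.disjoint_left]
    grind
  refine ⟨fun i => {v | ∃ l, x i ≤ l ∧ l < y i ∧ v = p l}, fun i => ⟨?_, ?_⟩, ?_, ?_⟩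
  · have key : ∀ l lc, l ≤ lc → x i ≤ l → lc < y i → RR G {v | ∃ l, x i ≤ l ∧ l < y i ∧ v = p l} (p l) (p lc) := by
      intro l lc hll ha hb
      have := aj i i.2
      exact RR_interval hll (fun k hk al => ⟨k, by omega, by omega, rfl⟩) fun k hk al => aa k (by omega)
    rintro _ ⟨l, ha, hb, rfl⟩ _ ⟨lc, ao, ak, rfl⟩
    rcases le_total l lc with hll | hll
    · exact key l lc hll ha ak
    · exact (key lc l hll ao hb).symm
  · obtain ⟨B, ⟨-, l, ha, hb, -⟩, -⟩ := aq i i.2 ∅ (by simpa using hk)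
    exact ⟨_, l, ha, hb, rfl⟩
  · grind
  · intro i j _
    refine menger G _ _ k fun S hS => ?_
    by_contra hlt
    obtain ⟨B, ⟨hB, l, ha, hb, hl⟩, hBS⟩ := aq i i.2 S (by omega)
    obtain ⟨B', ⟨ar, lc, ao, ak, bh⟩, jv⟩ := aq j j.2 S (by omega)
    refine hS (p l) ⟨l, ha, hb, rfl⟩ (p lc) ⟨lc, ao, ak, rfl⟩
      (((h.cn B hB).union (h.cn B' ar) (h.touch B hB B' ar) _ (.inl hl) _ (.inr bh)).mono ?_)
    grind

theorem shorten {g : ℕ → V} {L : ℕ} {C Ca : Set V} (ha : ∀ k < L, G.Adj (g k) (g (k + 1))) (bb : g 0 ∈ C) (hL : g L ∈ Ca)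
    (hd : Disjoint C Ca) (hn : ∀ x ∈ C, ∀ y ∈ Ca, ¬ G.Adj x y) :
    ∃ a b, a + 1 < b ∧ b ≤ L ∧ g a ∈ C ∧ g b ∈ Ca ∧ ∀ k, a < k → k < b → g k ∉ C ∧ g k ∉ Ca := by
  classical
  have aa : g (Nat.findGreatest (fun k => g k ∈ C) L) ∈ C := Nat.findGreatest_spec (P := fun k => g k ∈ C) (Nat.zero_le L) bb
  have ac : ∀ k, Nat.findGreatest (fun k => g k ∈ C) L < k → k ≤ L → g k ∉ C := fun k hk al => Nat.findGreatest_is_greatest hk al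
  have ah := Nat.findGreatest_le (P := fun k => g k ∈ C) L
  generalize Nat.findGreatest (fun k => g k ∈ C) L = a at aa ac ah
  have haL : a < L := by
    grind
  have hex : ∃ b, a < b ∧ g b ∈ Ca := ⟨L, haL, hL⟩
  have aj := Nat.find_spec hex
  have am := Nat.find_min' hex ⟨haL, hL⟩
  have aq := fun {k} => Nat.find_min hex (m := k)
  generalize Nat.find hex = b at aj am aq
  refine ⟨a, b, ?_, am, aa, aj.2, fun k hk al => ⟨ac k hk (by omega), fun hc => aq al ⟨hk, hc⟩⟩⟩
  grind

theorem dD_mono (N : ℕ) : Monotone (dD N) := monotone_nat_of_le_succ fun n => by rw [dD]; omega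

theorem grid (N : ℕ) : ∃ g : ℕ, ∀ (W : Type) [Finite W] (H : SimpleGraph W) (𝓑 : Set (Set W)), Br H 𝓑 → Ord 𝓑 g → Minor (Wall N) H := by
  classical
  obtain ⟨w, hw⟩ : ∃ w, w = Fintype.card (Fin N × Fin (2 * N)) := ⟨_, rfl⟩
  obtain ⟨na, jx⟩ : ∃ na, na = szz (N + 1) N := ⟨_, rfl⟩
  obtain ⟨n, hn⟩ : ∃ n, n = dD N (w * w) + w * na + 1 := ⟨_, rfl⟩
  obtain ⟨q, hq⟩ : ∃ q, q = dq N n := ⟨_, rfl⟩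
  obtain ⟨m, hm⟩ : ∃ m, m = w * (w + w * (w * q)) + 1 := ⟨_, rfl⟩
  refine ⟨m * n, fun W _ H 𝓑 hB ho => ?_⟩
  obtain ⟨C, hC, hCd, hCl⟩ := hubs hB m n (by omega) (by omega) ho
  by_contra hmin
  have : Nonempty W := ⟨(hC ⟨0, by omega⟩).2.some⟩
  have fb : ∀ a b : Fin m, ∃ (len : Fin n → ℕ) (p : Fin n → ℕ → W) (S : Finset (Fin m)), S.card ≤ q ∧ (a ≠ b → IsLk H (C a) (C b) n len p ∧
      ∀ i ∉ S, (hitS len p (C i)).ncard < na) := by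
    intro a b
    by_cases hab : a = b
    · exact ⟨fun _ => 0, fun _ _ => Classical.arbitrary W, ∅, by simp, fun h => absurd hab h⟩
    · rcases few_bad N (hCl a b hab) C Finset.univ (fun i _ j _ => hCd i j) (fun i _ => (hC i).1) with h | ⟨len, p, aa, S, -, ac, ah⟩
      all_goals grind
  choose len p S hS hp using fb
  obtain ⟨f, hf⟩ := select (ι := Fin N × Fin (2 * N)) m (w + w * (w * q)) (by rw [← hw]; omega)
    (fun l f => (Finset.univ.erase l).image f ∪ (Finset.univ.erase l).biUnion fun i => (Finset.univ.erase l).biUnion fun j => S (f i) (f j))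
    (by
      intro l f g hfg
      have e : ∀ j ∈ Finset.univ.erase l, f j = g j := fun j hj => hfg j (Finset.ne_of_mem_erase hj)
      congr 1
      · grind
      · exact Finset.biUnion_congr rfl fun i hi => Finset.biUnion_congr rfl fun j hj => by rw [e i hi, e j hj])
    (by
      intro l f
      have dd : (Finset.univ.erase l).card ≤ w := hw ▸ Finset.card_le_univ _
      refine (Finset.card_union_le _ _).trans (Nat.add_le_add (Finset.card_image_le.trans dd) ?_)
      refine (Finset.card_biUnion_le_card_mul _ _ (w * q) fun i _ => ?_).trans (Nat.mul_le_mul_right _ dd)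
      exact (Finset.card_biUnion_le_card_mul _ _ q fun j _ => hS _ _).trans (Nat.mul_le_mul_right _ dd))
  have finj : ∀ i j, i ≠ j → f i ≠ f j := by
    grind
  have fbad : ∀ i j l, l ≠ i → l ≠ j → f l ∉ S (f i) (f j) := by
    grind
  obtain ⟨X, hX⟩ : ∃ X : Set W, X = {v | ∀ l, v ∉ C (f l)} := ⟨_, rfl⟩
  obtain ⟨D, hD⟩ : ∃ D : Finset ((Fin N × Fin (2 * N)) × (Fin N × Fin (2 * N))), D = Finset.univ.filter fun d => d.1 ≠ d.2 ∧ ∀ x ∈ C (f d.1), ∀ y ∈ C (f d.2), ¬ H.Adj x y :=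
    ⟨_, rfl⟩
  have hlk : ∀ d ∈ D, Lk (rst H X) ({v | Att H v (C (f d.1))} ∩ X) ({v | Att H v (C (f d.2))} ∩ X) (dD N D.card) := by
    rintro ⟨i, j⟩ hd
    rw [hD, Finset.mem_filter] at hd
    obtain ⟨-, hij, hna⟩ := hd
    dsimp only at hij hna ⊢
    have hDc : D.card ≤ w * w := by
      refine (Finset.card_le_univ _).trans ?_
      rw [Fintype.card_prod, hw]
    refine Lk.of_le ?_ (dD_mono N hDc)
    obtain ⟨hl, hbd⟩ := hp (f i) (f j) (finj i j hij)
    obtain ⟨J, hJ⟩ : ∃ J : Set (Fin n), J = ⋃ l ∈ (Finset.univ.filter fun l => l ≠ i ∧ l ≠ j), hitS (len (f i) (f j)) (p (f i) (f j)) (C (f l)) := ⟨_, rfl⟩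
    have hJc : J.ncard ≤ w * na := by
      rw [hJ]
      refine (Finset.set_ncard_biUnion_le _ _).trans ?_
      refine (Finset.sum_le_card_nsmul _ _ na fun l hl => ?_).trans ?_
      · grind
      · rw [smul_eq_mul]; exact Nat.mul_le_mul_right _ (hw ▸ Finset.card_le_univ _)
    obtain ⟨σ, hσ, hσJ⟩ := sel_fin (m := dD N (w * w)) J (by omega)
    have hl := hl.reindex σ hσ
    have hnot : ∀ a l, l ≠ i → l ≠ j → ∀ k ≤ len (f i) (f j) (σ a), p (f i) (f j) (σ a) k ∉ C (f l) := by
      intro a l aa ac k hk hc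
      refine hσJ a ?_
      rw [hJ]; simp only [mem_iUnion]
      exact ⟨l, Finset.mem_filter.2 ⟨Finset.mem_univ _, aa, ac⟩, k, hk, hc⟩
    have := fun a => shorten (hl.adj a) (hl.st a) (hl.en a) (hCd _ _ (finj i j hij)) hna
    choose α β aa ac ah aj am using this
    have hXm : ∀ a k, α a < k → k < β a → p (f i) (f j) (σ a) k ∈ X := by
      intro a k hk al
      have := ac a
      rw [hX]
      intro l
      by_cases ea : l = i
      all_goals grind
    refine ⟨fun a => β a - α a - 2, fun a k => p (f i) (f j) (σ a) (α a + 1 + k), ?_, ?_, ?_, ?_⟩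
    · intro a
      have := aa a
      have := ac a
      exact ⟨⟨_, ah a, (hl.adj a _ (by omega)).symm⟩, hXm a _ (by omega) (by omega)⟩
    · intro a
      have := aa a
      have := ac a
      have e : α a + 1 + (β a - α a - 2) = β a - 1 := by omega
      have := hl.adj a (β a - 1) (by omega)
      rw [show β a - 1 + 1 = β a by omega] at this
      rw [e]
      exact ⟨⟨_, aj a, this⟩, hXm a _ (by omega) (by omega)⟩
    · intro a k hk
      have := ac a
      exact ⟨hl.adj a _ (by omega), hXm a _ (by omega) (by omega), hXm a _ (by omega) (by omega)⟩
    · intro a ai k ka hk al e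
      have := ac a
      have := ac ai
      have := aa a
      have := aa ai
      have := hl.inj a ai _ _ (by omega) (by omega) e
      grind
  rcases demand (G := H) N (fun d : (Fin N × Fin (2 * N)) × (Fin N × Fin (2 * N)) => {v | Att H v (C (f d.1))}) (fun d => {v | Att H v (C (f d.2))}) D X hlk with
    hmm | ⟨Z, hZ, hZd⟩
  · exact hmin hmm
  · refine hmin ⟨fun u => C (f u) ∪ ⋃ v ∈ {v | (u, v) ∈ D}, Z (u, v), fun u => ⟨⟨_, .inl (hC (f u)).2.some_mem⟩, ?_⟩, ?_, ?_⟩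
    · obtain ⟨c, hc⟩ := (hC (f u)).2
      refine Cn.of_center (x := c) fun y hy => ?_
      rcases hy with hy | hy
      · exact ((hC (f u)).1 c hc y hy).mono Set.subset_union_left
      · simp only [mem_iUnion] at hy
        obtain ⟨v, hv, hy⟩ := hy
        obtain ⟨-, ac, ⟨a, ⟨b, hb, hab⟩, ha⟩, -⟩ := hZ _ hv
        refine (((hC (f u)).1.union ac ⟨b, hb, a, ha, .inr hab.symm⟩) c (.inl hc) y (.inr hy)).mono ?_
        refine Set.union_subset_union_right _ fun z hz => ?_
        simp only [mem_iUnion]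
        exact ⟨v, hv, hz⟩
    · intro u v huv
      rw [Set.disjoint_left]
      rintro z (hz | hz) (ap | ap)
      · exact Set.disjoint_left.1 (hCd _ _ (finj u v huv)) hz ap
      · simp only [mem_iUnion] at ap
        grind
      · simp only [mem_iUnion] at hz
        grind
      · simp only [mem_iUnion] at hz ap
        obtain ⟨y, hy, hz⟩ := hz
        obtain ⟨ya, aw, ap⟩ := ap
        exact Set.disjoint_left.1 (hZd _ hy _ aw fun e => huv (congrArg Prod.fst e)) hz ap
    · intro u v huv
      by_cases hd : (u, v) ∈ D
      · obtain ⟨-, -, -, b, ⟨c, hc, hbc⟩, hb⟩ := hZ _ hd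
        refine ⟨b, .inr ?_, c, .inl hc, hbc⟩
        simp only [mem_iUnion]
        exact ⟨v, hd, hb⟩
      · rw [hD, Finset.mem_filter] at hd
        push Not at hd
        obtain ⟨x, hx, y, hy, hxy⟩ := hd (Finset.mem_univ _) huv.ne
        grind

end Paper

namespace Paper
variable {V : Type} {G : SimpleGraph V}

theorem sub_iso {α β : Type} {S : SimpleGraph α} {F : SimpleGraph β} (h : IsSubdivision S F) :
    ∀ {γ : Type} {S' : SimpleGraph γ}, Nonempty (S' ≃g S) → IsSubdivision S' F := by
  induction h with
  | base h => exact fun ⟨e⟩ => .base ⟨e.trans h.some⟩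
  | step u v huv _ ih => exact fun e => .step u v huv (ih e)

theorem subdiv_adj {S : SimpleGraph V} {x z : V} (a b : Option V) : (subdivideEdge S x z).Adj a b ↔
    a ≠ b ∧ ((∃ p q, a = some p ∧ b = some q ∧ S.Adj p q ∧ ¬(p = x ∧ q = z) ∧ ¬(p = z ∧ q = x)) ∨
      (a = none ∧ (b = some x ∨ b = some z)) ∨ (b = none ∧ (a = some x ∨ a = some z))) := by
  rw [subdivideEdge, fromRel_adj]
  grind [adj_comm]

theorem subdiv_congr {α β : Type} {S : SimpleGraph α} {F : SimpleGraph β} (e : S ≃g F) (x z : α) :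
    Nonempty (subdivideEdge S x z ≃g subdivideEdge F (e x) (e z)) := by
  refine ⟨⟨Equiv.optionCongr e.toEquiv, ?_⟩⟩
  intro a b
  rw [subdiv_adj, subdiv_adj]
  rcases a with _ | a <;> rcases b with _ | b <;> simp
  intros; exact e.map_adj_iff

theorem sub_step {α β : Type} {S : SimpleGraph α} {F : SimpleGraph β} (h : IsSubdivision S F) :
    ∀ x z, S.Adj x z → IsSubdivision (subdivideEdge S x z) F := by
  induction h with
  | base h =>
    obtain ⟨e⟩ := h
    exact fun x z hxz => .step (e x) (e z) (e.map_adj_iff.2 hxz) (.base (subdiv_congr e x z))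
  | step u v huv _ ih => exact fun x z hxz => .step u v huv (ih x z hxz)

structure Mdl {W : Type} (G : SimpleGraph V) (F : SimpleGraph W) (A : W → Set V) : Prop where
  ne : ∀ u, (A u).Nonempty
  cn : ∀ u, Cn G (A u)
  dj : ∀ u v x, x ∈ A u → x ∈ A v → u = v
  ed : ∀ u v, F.Adj u v → ∃ a ∈ A u, ∃ b ∈ A v, G.Adj a b

theorem Mdl.del {W : Type} {F : SimpleGraph W} {A : W → Set V} (h : Mdl G F A) {u : W} {x : V} (hx : x ∈ A u) (hne : (A u \ {x}).Nonempty)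
    (hc : Cn G (A u \ {x})) (he : ∀ w, F.Adj u w → ∃ a ∈ A u, a ≠ x ∧ ∃ b ∈ A w, G.Adj a b) : Mdl G F (fun w => A w \ {x}) := by
  have eq : ∀ w, w ≠ u → A w \ {x} = A w := fun w hw => diff_singleton_eq_self fun cm => hw (h.dj _ _ _ cm hx)
  refine ⟨fun w => ?_, fun w => ?_, fun a b y hy aw => h.dj a b y hy.1 aw.1, fun a b hab => ?_⟩
  · by_cases hw : w = u
    · subst hw; exact hne
    · rw [eq w hw]; exact h.ne w
  · by_cases hw : w = u
    · subst hw; exact hc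
    · rw [eq w hw]; exact h.cn w
  · by_cases ha : a = u
    · subst ha
      obtain ⟨p, hp, hpx, q, hq, hpq⟩ := he b hab
      exact ⟨p, ⟨hp, hpx⟩, q, ⟨hq, fun e => hab.ne (h.dj _ _ _ hx (e ▸ hq))⟩, hpq⟩
    · by_cases hb : b = u
      · grind [adj_comm]
      · obtain ⟨p, hp, q, hq, hpq⟩ := h.ed a b hab
        grind

theorem noncut [Finite V] {A : Set V} (hA : Cn G A) {r s : V} (hr : r ∈ A) (hs : s ∈ A) (hrs : s ≠ r) :
    ∃ y ∈ A, y ≠ r ∧ Cn G (A \ {y}) := by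
  obtain ⟨y, ⟨hyA, hyr⟩, hmax⟩ := (toFinite {y | y ∈ A ∧ y ≠ r}).exists_maximalFor (fun y => (comp G (A \ {y}) r).ncard) _ ⟨s, hs, hrs⟩
  refine ⟨y, hyA, hyr, ?_⟩
  have bu : r ∈ A \ {y} := ⟨hr, hyr.symm⟩
  refine Cn.of_center (x := r) fun w hw => ?_
  by_contra hcon
  have hwr : w ≠ r := fun e => hcon (by subst e; exact RR.refl bu)
  have sub : comp G (A \ {y}) r ⊆ comp G (A \ {w}) r := by
    intro a ha
    have ao : RR G (A \ {y}) r a := ha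
    refine RR.mono (s := comp G (A \ {y}) r) (Cn_comp r (mem_comp bu) a ha) fun b hb => ⟨(comp_sub hb).1, fun e => hcon ?_⟩
    rw [mem_singleton_iff] at e; exact e ▸ hb
  have hy : y ∈ comp G (A \ {w}) r := by
    obtain ⟨a, b, aa, ac, ah, aj, am, aq⟩ := (hA r hr y hyA).exit (T := {y}ᶜ) (fun e => hyr e.symm) (by simp)
    have : b = y := by simpa using aj
    subst this
    have ci : RR G (A \ {b}) r a := aq.mono fun v hv => hv
    exact (sub ci).tail ⟨hyA, fun e => hw.2 e.symm⟩ am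
  have hlt : (comp G (A \ {y}) r).ncard < (comp G (A \ {w}) r).ncard :=
    Set.ncard_lt_ncard ⟨sub, fun hh => (comp_sub (hh hy)).2 rfl⟩
  grind

structure TM {W : Type} (G : SimpleGraph V) (F : SimpleGraph W) (A : W → Set V) : Prop where
  md : Mdl G F A
  tree : ∀ u, ∀ y ∈ A u, ∀ a b, a ≠ b → G.Adj y a → G.Adj y b → ¬ RR G (A u \ {y}) a b
  none : ∀ u v, u ≠ v → ∀ a ∈ A u, ∀ b ∈ A v, G.Adj a b → F.Adj u v
  uniq : ∀ u v, u ≠ v → ∀ a ∈ A u, ∀ ai ∈ A u, ∀ b ∈ A v, ∀ ba ∈ A v, G.Adj a b → G.Adj ai ba → a = ai ∧ b = ba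
  leaf : ∀ u, ∀ y ∈ A u, Cn G (A u \ {y}) → (A u \ {y}).Nonempty → ∃ v, v ≠ u ∧ ∃ z ∈ A v, G.Adj y z

theorem TM.base {W : Type} {F : SimpleGraph W} {A : W → Set V} (h : TM G F A) (hs : ∀ u, ∀ x ∈ A u, ∀ y ∈ A u, x = y) :
    IsSubdivision (G.induce (⋃ u, A u)) F := by
  choose a ha using h.md.ne
  refine .base ⟨(Iso.symm ⟨Equiv.ofBijective (fun u => ⟨a u, mem_iUnion.2 ⟨u, ha u⟩⟩) ⟨?_, ?_⟩, ?_⟩)⟩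
  · intro u v e
    exact h.md.dj u v (a u) (ha u) (by have e : a u = a v := congrArg Subtype.val e; rw [e]; exact ha v)
  · rintro ⟨x, hx⟩
    obtain ⟨u, hu⟩ := mem_iUnion.1 hx
    grind
  · intro u v
    simp only [Equiv.ofBijective_apply, comap_adj, Function.Embedding.subtype_apply]
    constructor
    · intro hadj
      refine h.none u v ?_ _ (ha u) _ (ha v) hadj
      rintro rfl; exact hadj.ne rfl
    · intro hadj
      obtain ⟨p, hp, q, hq, hpq⟩ := h.md.ed u v hadj
      grind

theorem TM.pick [Finite V] {W : Type} {F : SimpleGraph W} {A : W → Set V} (h : TM G F A)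
    (ah : ∀ u a b c d, F.Adj u a → F.Adj u b → F.Adj u c → F.Adj u d → a ≠ b → c ≠ d → a = c ∨ a = d ∨ b = c ∨ b = d)
    {u : W} {p q : V} (hp : p ∈ A u) (hq : q ∈ A u) (hpq : p ≠ q) :
    ∃ x ∈ A u, ∃ y ∈ A u, x ≠ y ∧ Cn G (A u \ {y}) ∧ ∃ v, v ≠ u ∧ ∃ z ∈ A v, G.Adj y x ∧ G.Adj y z ∧ ∀ w, ∀ b ∈ A w, G.Adj y b → b = x ∨ b = z := by
  obtain ⟨la, bv, nd, c1⟩ := noncut (h.md.cn u) hp hq hpq.symm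
  obtain ⟨lb, cx, nc, c2⟩ := noncut (h.md.cn u) bv hp nd.symm
  have key : ∃ y ∈ A u, Cn G (A u \ {y}) ∧ (A u \ {y}).Nonempty ∧ ∀ v vc z za, v ≠ u → vc ≠ u → z ∈ A v → za ∈ A vc → G.Adj y z → G.Adj y za → z = za := by
    by_contra hcon
    push Not at hcon
    obtain ⟨v, vc, z, za, ea, eb, ec, ef, eg, eh, el⟩ := hcon la bv c1 ⟨lb, cx, nc⟩
    obtain ⟨w, wc, b, ba, fs, iy, fd, fe, ff, fg, iz⟩ := hcon lb cx c2 ⟨la, bv, nc.symm⟩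
    have d : ∀ l ∈ A u, ∀ v vc z za, v ≠ u → z ∈ A v → za ∈ A vc → G.Adj l z → G.Adj l za → z ≠ za → v ≠ vc := by
      rintro l hl v vc z za ea ec ef eg eh el rfl
      exact el (h.uniq u v ea.symm l hl l hl z ec za ef eg eh).2
    have da : ∀ v vc z za, v ≠ u → z ∈ A v → za ∈ A vc → G.Adj la z → G.Adj lb za → v ≠ vc := by
      rintro v vc z za ea ec ef eg eh rfl
      exact nc (h.uniq u v ea.symm la bv lb cx z ec za ef eg eh).1.symm
    rcases ah u v vc w wc (h.none u v ea.symm _ bv _ ec eg) (h.none u vc eb.symm _ bv _ ef eh) (h.none u w fs.symm _ cx _ fd ff)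
      (h.none u wc iy.symm _ cx _ fe fg) (d la bv _ _ _ _ ea ec ef eg eh el) (d lb cx _ _ _ _ fs fd fe ff fg iz) with e | e | e | e
    · exact da _ _ _ _ ea ec fd eg ff e
    · exact da _ _ _ _ ea ec fe eg fg e
    · exact da _ _ _ _ eb ef fd eh ff e
    · exact da _ _ _ _ eb ef fe eh fg e
  obtain ⟨y, hy, hc, hne, huq⟩ := key
  obtain ⟨v, hv, z, hz, hyz⟩ := h.leaf u y hy hc hne
  obtain ⟨r, hr, hry⟩ := hne
  obtain ⟨x, xa, aa, ac, ah, aj, am, -⟩ := (h.md.cn u r hr y hy).exit (T := {y}ᶜ) hry (by simp)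
  have : xa = y := by simpa using aj
  subst this
  refine ⟨x, ac, xa, hy, aa, hc, v, hv, z, hz, am.symm, hyz, fun w b hb hyb => ?_⟩
  by_cases hw : w = u
  · subst hw
    refine .inl ?_
    by_contra hbx
    exact h.tree w xa hy b x hbx hyb am.symm (hc b ⟨hb, hyb.ne'⟩ x ⟨ac, aa⟩)
  grind

theorem sub_suppress {U : Set V} {x y z : V} (hx : x ∈ U) (hy : y ∈ U) (hz : z ∈ U) (hxy : x ≠ y) (hzy : z ≠ y) (hxz : ¬ G.Adj x z) (ax : G.Adj y x) (az : G.Adj y z)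
    (hn : ∀ b ∈ U, G.Adj y b → b = x ∨ b = z) :
    Nonempty (G.induce U ≃g subdivideEdge ((G ⊔ edge x z).induce (U \ {y})) ⟨x, hx, hxy⟩ ⟨z, hz, hzy⟩) := by
  refine ⟨(Iso.symm ⟨Equiv.ofBijective (fun o : Option ↑(U \ {y}) => (o.elim ⟨y, hy⟩ fun v => ⟨v.1, v.2.1⟩ : ↑U)) ⟨?_, ?_⟩, ?_⟩)⟩
  · rintro (_ | ⟨a, ha, ao⟩) (_ | ⟨b, hb, ak⟩) e
    · rfl
    all_goals grind
  · rintro ⟨a, ha⟩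
    by_cases e : a = y
    · subst e; exact ⟨.none, rfl⟩
    · exact ⟨some ⟨a, ha, e⟩, rfl⟩
  · rintro (_ | ⟨a, ha, ao⟩) (_ | ⟨b, hb, ak⟩)
    · rw [subdiv_adj]; simp
    · rw [subdiv_adj]
      simp only [Equiv.ofBijective_apply, comap_adj, Function.Embedding.subtype_apply, Option.elim]
      grind
    · rw [subdiv_adj]
      simp only [Equiv.ofBijective_apply, comap_adj, Function.Embedding.subtype_apply, Option.elim]
      grind [adj_comm]
    · rw [subdiv_adj]
      simp only [Equiv.ofBijective_apply, comap_adj, Function.Embedding.subtype_apply, Option.elim]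
      constructor
      · intro h
        refine ⟨fun e => h.ne (congrArg Subtype.val (Option.some.inj e)), .inl ⟨_, _, rfl, rfl, .inl h, ?_, ?_⟩⟩
        · grind
        grind [adj_comm]
      grind

theorem TM.step {W : Type} {F : SimpleGraph W} {A : W → Set V} (h : TM G F A) {u v : W} {x y z : V} (hx : x ∈ A u) (hy : y ∈ A u) (hxy : x ≠ y)
    (hc : Cn G (A u \ {y})) (hvu : v ≠ u) (hz : z ∈ A v) (ax : G.Adj y x) (az : G.Adj y z) (hn : ∀ w, ∀ b ∈ A w, G.Adj y b → b = x ∨ b = z) :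
    TM (G ⊔ edge x z) F (fun w => A w \ {y}) := by
  obtain ⟨Ga, bs⟩ : ∃ Ga, Ga = G ⊔ edge x z := ⟨_, rfl⟩
  have hle : G ≤ Ga := bs ▸ le_sup_left
  have adj : ∀ a b, Ga.Adj a b → G.Adj a b ∨ (a = x ∧ b = z) ∨ (a = z ∧ b = x) := by
    grind
  have hxz : x ≠ z := fun e => hvu (h.md.dj _ _ _ hz (e ▸ hx))
  have adxz : Ga.Adj x z := by rw [bs, sup_adj, edge_adj]; exact .inr ⟨.inl ⟨rfl, rfl⟩, hxz⟩
  rw [← bs]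
  have nA : ∀ w, w ≠ u → y ∉ A w := fun w hw hyw => hw (h.md.dj _ _ _ hyw hy)
  have eq : ∀ w, w ≠ u → A w \ {y} = A w := fun w hw => diff_singleton_eq_self (nA w hw)
  have zy : z ≠ y := fun e => nA v hvu (e ▸ hz)
  have fib : ∀ w a b, a ∈ A w → b ∈ A w → Ga.Adj a b → G.Adj a b := by
    intro w a b ha hb hab
    rcases adj a b hab with hh | ⟨rfl, rfl⟩ | ⟨rfl, rfl⟩
    · exact hh
    · exact absurd ((h.md.dj _ _ _ hz hb).trans (h.md.dj _ _ _ ha hx)) hvu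
    · exact absurd ((h.md.dj _ _ _ hz ha).trans (h.md.dj _ _ _ hb hx)) hvu
  have rr : ∀ w (s : Set V) a b, s ⊆ A w → RR Ga s a b → RR G s a b := by
    intro w s a b hs hab
    refine hab.ind (RR.refl hab.left) fun c d hc ih hd hcd => ih.tail hd (fib w c d (hs hc.right) (hs hd) hcd)
  have cross : ∀ p q, p ≠ q → ∀ a ∈ A p \ {y}, ∀ b ∈ A q \ {y}, Ga.Adj a b → G.Adj a b ∨ (a = x ∧ b = z ∧ p = u ∧ q = v) ∨ (a = z ∧ b = x ∧ p = v ∧ q = u) := by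
    intro p q hpq a ha b hb hab
    rcases adj a b hab with hh | ⟨rfl, rfl⟩ | ⟨rfl, rfl⟩
    · exact .inl hh
    · exact .inr (.inl ⟨rfl, rfl, h.md.dj _ _ _ ha.1 hx, h.md.dj _ _ _ hb.1 hz⟩)
    · exact .inr (.inr ⟨rfl, rfl, h.md.dj _ _ _ ha.1 hz, h.md.dj _ _ _ hb.1 hx⟩)
  refine ⟨⟨fun w => ?_, fun w => ?_, fun a b c hc cc => h.md.dj a b c hc.1 cc.1, ?_⟩, ?_, ?_, ?_, ?_⟩
  · by_cases hw : w = u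
    · subst hw; exact ⟨x, hx, hxy⟩
    · rw [eq w hw]; exact h.md.ne w
  · by_cases hw : w = u
    · subst hw; exact hc.monoG hle
    · rw [eq w hw]; exact (h.md.cn w).monoG hle
  · intro p q hpq
    obtain ⟨a, ha, b, hb, hab⟩ := h.md.ed p q hpq
    by_cases ea : a = y
    · subst ea
      obtain rfl := h.md.dj _ _ _ ha hy
      rcases hn q b hb hab with rfl | rfl
      · exact absurd (h.md.dj _ _ _ hx hb) hpq.ne
      · exact ⟨x, ⟨hx, hxy⟩, b, ⟨hb, zy⟩, adxz⟩
    · by_cases eb : b = y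
      · subst eb
        obtain rfl := h.md.dj _ _ _ hb hy
        rcases hn p a ha hab.symm with rfl | rfl
        · exact absurd (h.md.dj _ _ _ ha hx) hpq.ne
        · exact ⟨a, ⟨ha, zy⟩, x, ⟨hx, hxy⟩, adxz.symm⟩
      · exact ⟨a, ⟨ha, ea⟩, b, ⟨hb, eb⟩, hle hab⟩
  · intro w c hc a b hab hca hcb hr
    have ha := hr.left
    have hb := hr.right
    exact h.tree w c hc.1 a b hab (fib w c a hc.1 ha.1.1 hca) (fib w c b hc.1 hb.1.1 hcb)
      ((rr w _ a b (fun i hi => hi.1.1) hr).mono fun i hi => ⟨hi.1.1, hi.2⟩)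
  · intro p q hpq a ha b hb hab
    rcases cross p q hpq a ha b hb hab with hh | ⟨rfl, rfl, rfl, rfl⟩ | ⟨rfl, rfl, rfl, rfl⟩
    · exact h.none p q hpq a ha.1 b hb.1 hh
    · exact h.none _ _ hpq y hy _ hz az
    · exact h.none _ _ hpq _ hz y hy az.symm
  · have hno : ∀ a ∈ A u \ {y}, ∀ b ∈ A v, ¬ G.Adj a b := fun a ha b hb hab =>
      ha.2 (h.uniq u v hvu.symm a ha.1 y hy b hb z hz hab az).1
    intro p q hpq a ha ai ao b hb ba ak hab cz
    rcases cross p q hpq a ha b hb hab with hh | ⟨rfl, rfl, rfl, rfl⟩ | ⟨rfl, rfl, rfl, rfl⟩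
    · rcases cross p q hpq ai ao ba ak cz with je | ⟨rfl, rfl, rfl, rfl⟩ | ⟨rfl, rfl, rfl, rfl⟩
      · exact h.uniq p q hpq a ha.1 ai ao.1 b hb.1 ba ak.1 hh je
      · grind
      · exact absurd hh.symm (hno _ hb _ ha.1)
    · grind
    grind [adj_comm]
  · intro w c hcw hC hN
    by_cases hw : w = u
    · subst hw
      by_cases hcx : c = x
      · grind
      · have aa : Cn G ((A w \ {y}) \ {c}) := fun a ha b hb => rr w _ a b (fun i hi => hi.1.1) (hC a ha b hb)
        have ac := aa.insert (x := y) ⟨x, ⟨⟨hx, hxy⟩, fun e => hcx e.symm⟩, ax⟩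
        have e : insert y ((A w \ {y}) \ {c}) = A w \ {c} := by
          ext i
          by_cases hi : i = y
          · subst hi; simp [hy]; exact fun e => hcw.2 e.symm
          · simp [hi]
        rw [e] at ac
        obtain ⟨q, hq, za, ap, hcz⟩ := h.leaf w c hcw.1 ac (hN.mono fun i hi => ⟨hi.1.1, hi.2⟩)
        exact ⟨q, hq, za, ⟨ap, fun e => nA q hq (e ▸ ap)⟩, hle hcz⟩
    · rw [eq w hw] at hC hN
      rw [eq w hw] at hcw
      obtain ⟨q, hq, za, ap, hcz⟩ := h.leaf w c hcw (fun a ha b hb => rr w _ a b (fun i hi => hi.1) (hC a ha b hb)) hN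
      by_cases e : za = y
      · subst e
        rcases hn w c hcw hcz.symm with rfl | rfl
        · exact absurd (h.md.dj _ _ _ hcw hx) hw
        · exact ⟨u, fun e => hw e.symm, x, ⟨hx, hxy⟩, adxz.symm⟩
      · exact ⟨q, hq, za, ⟨ap, e⟩, hle hcz⟩

theorem TM.sub [Finite V] {W : Type} {F : SimpleGraph W}
    (ah : ∀ u a b c d, F.Adj u a → F.Adj u b → F.Adj u c → F.Adj u d → a ≠ b → c ≠ d → a = c ∨ a = d ∨ b = c ∨ b = d) (n : ℕ) :
    ∀ (G : SimpleGraph V) (A : W → Set V), TM G F A → (⋃ u, A u).ncard = n → IsSubdivision (G.induce (⋃ u, A u)) F := by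
  induction n using Nat.strong_induction_on with
  | _ n ih =>
    intro G A h hcard
    by_cases hs : ∀ u, ∀ x ∈ A u, ∀ y ∈ A u, x = y
    · exact h.base hs
    push Not at hs
    obtain ⟨u, p, hp, q, hq, hpq⟩ := hs
    obtain ⟨x, hx, y, hy, hxy, hc, v, hvu, z, hz, ax, az, hn⟩ := h.pick ah hp hq hpq
    have ad := h.step hx hy hxy hc hvu hz ax az hn
    have hU : (⋃ w, A w \ {y}) = (⋃ w, A w) \ {y} := (iUnion_diff _ _).symm
    have hyU : y ∈ ⋃ w, A w := mem_iUnion.2 ⟨u, hy⟩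
    have hlt : (⋃ w, A w \ {y}).ncard < n := by
      rw [hU, ← hcard]; exact Set.ncard_diff_singleton_lt_of_mem hyU
    have hI := ih _ hlt _ _ ad rfl
    have hxU : x ∈ ⋃ w, A w := mem_iUnion.2 ⟨u, hx⟩
    have hzU : z ∈ ⋃ w, A w := mem_iUnion.2 ⟨v, hz⟩
    have zy : z ≠ y := az.ne'
    have hxz : ¬ G.Adj x z := fun e => hxy (h.uniq u v hvu.symm x hx y hy z hz z hz e az).1
    rw [hU] at hI
    refine sub_iso (sub_step hI ⟨x, hxU, hxy⟩ ⟨z, hzU, zy⟩ ?_) (sub_suppress hxU hyU hzU hxy zy hxz ax az fun b hb hyb => ?_)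
    · have : (G ⊔ edge x z).Adj x z := by
        rw [sup_adj, edge_adj]; exact .inr ⟨.inl ⟨rfl, rfl⟩, fun e => hvu (h.md.dj _ _ _ hz (e ▸ hx))⟩
      exact this
    · obtain ⟨w, hw⟩ := mem_iUnion.1 hb
      exact hn w b hw hyb

end Paper

namespace Paper
variable {V : Type} {G : SimpleGraph V}

theorem min_fn {α : Type*} (P : α → Prop) (f : α → ℕ) (h : ∃ a, P a) : ∃ a, P a ∧ ∀ b, P b → f a ≤ f b := by
  obtain ⟨a, ha, hm⟩ := (measure f).wf.has_min {a | P a} h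
  exact ⟨a, ha, fun b hb => not_lt.1 (hm b hb)⟩

theorem Cn.del {A : Set V} (hA : Cn G A) {x z : V} (hx : x ∈ A) (h : ∀ a ∈ A, G.Adj a x → RR G (A \ {x}) z a) : Cn G (A \ {x}) := by
  refine Cn.of_center (x := z) fun a ha => ?_
  obtain ⟨p, q, aa, ac, ah, aj, am, aq⟩ := (hA a ha.1 x hx).exit (T := {x}ᶜ) ha.2 (by simp)
  have : q = x := by simpa using aj
  subst this
  exact (h p ac am).trans (RR.mono aq fun v hv => hv).symm

theorem min_model [Finite V] {W : Type} (F : SimpleGraph W) (β Va : Set V)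
    (pa : ∀ v a b, a ∈ β → b ∈ β → G.Adj v a → G.Adj v b → a = b)
    (two : ∀ x ∈ Va, x ∉ β → ∀ a ∈ Va, ∀ b ∈ Va, ∀ c ∈ Va, G.Adj x a → G.Adj x b → G.Adj x c → a = b ∨ a = c ∨ b = c)
    (hA : ∃ A, Mdl G F A ∧ (∀ u, ∀ a ∈ A u, ∀ b ∈ β, a ∈ β → G.Adj a b → b ∈ A u) ∧ ∀ u, A u ⊆ Va) :
    ∃ A, Mdl G F A ∧ (∀ u, ∀ y ∈ A u, ∀ a b, a ≠ b → G.Adj y a → G.Adj y b → ¬ RR G (A u \ {y}) a b) ∧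
      ∀ u v, u ≠ v → (∃ a b, a ≠ b ∧ F.Adj u a ∧ F.Adj u b) → (∃ a b, a ≠ b ∧ F.Adj v a ∧ F.Adj v b) →
        ∀ x ∈ A u, ∀ y ∈ A v, G.Adj x y → F.Adj u v ∧ ∀ xa ∈ A u, ∀ ya ∈ A v, G.Adj xa ya → x = xa ∧ y = ya := by
  obtain ⟨A, ⟨hM, hmate, hV⟩, hmin⟩ := min_fn _ (fun A : W → Set V => (⋃ u, A u).ncard) hA
  have nodel : ∀ u x, x ∈ A u → x ∉ β → (A u \ {x}).Nonempty → Cn G (A u \ {x}) →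
      ¬ ∀ w, F.Adj u w → ∃ a ∈ A u, a ≠ x ∧ ∃ b ∈ A w, G.Adj a b := by
    intro u x hx hxb hne hc he
    have hU : (⋃ w, A w \ {x}) = (⋃ w, A w) \ {x} := (iUnion_diff _ _).symm
    have hxU : x ∈ ⋃ w, A w := mem_iUnion.2 ⟨u, hx⟩
    have := hmin (fun w => A w \ {x}) ⟨hM.del hx hne hc he, fun w a ha b hb hab h => ⟨hmate w a ha.1 b hb hab h, fun e => hxb (e ▸ hb)⟩,
      fun w => Set.diff_subset.trans (hV w)⟩
    have ac := Set.ncard_diff_singleton_lt_of_mem hxU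
    rw [← hU] at ac
    omega
  have te : ∀ u x, x ∈ A u → x ∉ β → ∀ u1 u2 ub a b c, a ∈ A u1 → b ∈ A u2 → c ∈ A ub → G.Adj x a → G.Adj x b → G.Adj x c → a = b ∨ a = c ∨ b = c :=
    fun u x hx hxb u1 u2 ub a b c ha hb hc => two x (hV _ hx) hxb a (hV _ ha) b (hV _ hb) c (hV _ hc)
  have tk : ∀ u, ∀ y ∈ A u, y ∉ β → ∀ a b, a ≠ b → G.Adj y a → G.Adj y b → ¬ RR G (A u \ {y}) a b := by
    intro u y hy hyb a b hab hya jf hr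
    have hn : ∀ w c, c ∈ A w → G.Adj y c → c = a ∨ c = b := by
      intro w c hc hyc
      rcases te u y hy hyb w u u c a b hc hr.left.1 hr.right.1 hyc hya jf with e | e | e
      all_goals grind
    refine nodel u y hy hyb ⟨a, hr.left⟩ ((hM.cn u).del hy (z := a) fun c hc hcy => ?_) fun w hw => ?_
    · rcases hn u c hc hcy.symm with rfl | rfl
      · exact RR.refl hr.left
      · exact hr
    · obtain ⟨p, hp, q, hq, hpq⟩ := hM.ed u w hw
      refine ⟨p, hp, ?_, q, hq, hpq⟩
      rintro rfl
      rcases hn w q hq hpq with rfl | rfl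
      · exact hw.ne (hM.dj _ _ _ hr.left.1 hq)
      · exact hw.ne (hM.dj _ _ _ hr.right.1 hq)
  have tl : ∀ u, ∀ y ∈ A u, ∀ a b, a ∉ β → a ≠ b → G.Adj y a → G.Adj y b → ¬ RR G (A u \ {y}) a b := by
    intro u y hy a b hab hne hya hyb hr
    obtain ⟨w, q, aa, ac, ah, aj, am, aq⟩ := hr.symm.exit (T := {a}ᶜ) (fun e => hne e.symm) (by simp)
    have : q = a := by simpa using aj
    subst this
    refine tk u q ah.1 hab y w (fun e => ac.2 e.symm) hya.symm am.symm ?_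
    exact (RR.adj (s := A u \ {q}) ⟨hy, hya.ne⟩ ⟨hr.right.1, fun e => hne e.symm⟩ hyb).trans (RR.mono aq fun v hv => ⟨hv.1.1, hv.2⟩)
  have cr : ∀ u v, u ≠ v → (∃ a b, a ≠ b ∧ F.Adj u a ∧ F.Adj u b) → ∀ x ∈ A u, ∀ y ∈ A v, x ∉ β → G.Adj x y →
      (F.Adj u v → ∃ xa ∈ A u, ∃ ya ∈ A v, G.Adj xa ya ∧ ¬ (x = xa ∧ y = ya)) → False := by
    rintro u v huv ⟨p, q, hpq, hup, huq⟩ x hx y hy hxb hxy hex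
    have hz : ∃ z ∈ A u, G.Adj x z := by
      by_contra hno
      push Not at hno
      have sing : ∀ a ∈ A u, a = x := by
        intro a ha
        by_contra hax
        obtain ⟨c, d, aa, ac, ah, aj, am, -⟩ := (hM.cn u a ha x hx).exit (T := {x}ᶜ) hax (by simp)
        have : d = x := by simpa using aj
        subst this
        exact hno c ac am.symm
      have nb : ∀ w, F.Adj u w → ∃ b ∈ A w, G.Adj x b := by
        intro w hw
        obtain ⟨a, ha, b, hb, hab⟩ := hM.ed u w hw
        exact ⟨b, hb, sing a ha ▸ hab⟩
      obtain ⟨bo, bj, bq⟩ := nb p hup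
      obtain ⟨bx, au, ct⟩ := nb q huq
      have b12 : bo ≠ bx := fun e => hpq (hM.dj _ _ _ bj (e ▸ au))
      by_cases hF : F.Adj u v
      · obtain ⟨xa, cm, ya, aw, ha, hne⟩ := hex hF
        obtain rfl := sing xa cm
        have hne : y ≠ ya := fun e => hne ⟨rfl, e⟩
        have tc := te u xa hx hxb v v p y ya bo hy aw bj hxy ha bq
        have td := te u xa hx hxb v v q y ya bx hy aw au hxy ha ct
        have db : bo ∈ A v := by rcases tc with e | e | e; exacts [absurd e hne, e ▸ hy, e ▸ aw]
        have dc : bx ∈ A v := by rcases td with e | e | e; exacts [absurd e hne, e ▸ hy, e ▸ aw]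
        exact hpq ((hM.dj _ _ _ bj db).trans (hM.dj _ _ _ au dc).symm)
      · rcases te u x hx hxb p q v bo bx y bj au hy bq ct hxy with e | e | e
        · exact b12 e
        · subst e; exact hF (hM.dj _ _ _ bj hy ▸ hup)
        · subst e; exact hF (hM.dj _ _ _ au hy ▸ huq)
    obtain ⟨z, hz, hxz⟩ := hz
    have hzy : z ≠ y := fun e => huv (hM.dj _ _ _ hz (e ▸ hy))
    have hn : ∀ w c, c ∈ A w → G.Adj x c → c = z ∨ c = y := by
      grind
    refine nodel u x hx hxb ⟨z, hz, hxz.ne'⟩ ((hM.cn u).del hx (z := z) fun c hc hcx => ?_) fun w hw => ?_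
    · rcases hn u c hc hcx.symm with rfl | rfl
      · exact RR.refl ⟨hz, hxz.ne'⟩
      · exact absurd (hM.dj _ _ _ hc hy) huv
    · obtain ⟨a, ha, b, hb, hab⟩ := hM.ed u w hw
      by_cases hax : a = x
      · subst hax
        rcases hn w b hb hab with rfl | rfl
        · exact absurd (hM.dj _ _ _ hz hb) hw.ne
        · obtain rfl := hM.dj _ _ _ hy hb
          obtain ⟨xa, cm, ya, aw, ao, hne⟩ := hex hw
          refine ⟨xa, cm, ?_, ya, aw, ao⟩
          rintro rfl
          rcases hn v ya aw ao with rfl | rfl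
          · exact huv (hM.dj _ _ _ hz aw)
          · exact hne ⟨rfl, rfl⟩
      · exact ⟨a, ha, hax, b, hb, hab⟩
  refine ⟨A, hM, ?_, ?_⟩
  · intro u y hy a b hab hya hyb hr
    by_cases ha : a ∈ β
    · by_cases hb : b ∈ β
      · grind
      · exact tl u y hy b a hb hab.symm hyb hya hr.symm
    grind
  · intro u v huv du dv x hx y hy hxy
    have key : (F.Adj u v → ∃ xa ∈ A u, ∃ ya ∈ A v, G.Adj xa ya ∧ ¬ (x = xa ∧ y = ya)) → False := by
      intro hex
      by_cases hxb : x ∈ β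
      · by_cases hyb : y ∈ β
        · exact huv (hM.dj _ _ _ (hmate u x hx y hyb hxb hxy) hy)
        · refine cr v u huv.symm dv y hy x hx hyb hxy.symm fun hF => ?_
          obtain ⟨xa, cm, ya, aw, aa, ac⟩ := hex hF.symm
          exact ⟨ya, aw, xa, cm, aa.symm, fun e => ac ⟨e.2, e.1⟩⟩
      grind
    grind

theorem trim [Finite V] {W : Type} {F : SimpleGraph W} {A : W → Set V} (hM : Mdl G F A)
    (htree : ∀ u, ∀ y ∈ A u, ∀ a b, a ≠ b → G.Adj y a → G.Adj y b → ¬ RR G (A u \ {y}) a b)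
    (hcr : ∀ u v, u ≠ v → ∀ x ∈ A u, ∀ y ∈ A v, G.Adj x y → F.Adj u v ∧ ∀ xa ∈ A u, ∀ ya ∈ A v, G.Adj xa ya → x = xa ∧ y = ya) :
    ∃ Aa, TM G F Aa := by
  obtain ⟨B, ⟨hB, hBA⟩, hmin⟩ := min_fn (fun B => Mdl G F B ∧ ∀ u, B u ⊆ A u) (fun A : W → Set V => (⋃ u, A u).ncard) ⟨A, hM, fun _ => subset_rfl⟩
  refine ⟨B, hB, ?_, ?_, ?_, ?_⟩
  · exact fun u y hy a b hab hya hyb hr => htree u y (hBA _ hy) a b hab hya hyb (hr.mono (Set.diff_subset_diff_left (hBA u)))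
  · grind
  · exact fun u v huv a ha ai ao b hb ba ak hab cz => (hcr u v huv a (hBA _ ha) b (hBA _ hb) hab).2 ai (hBA _ ao) ba (hBA _ ak) cz
  · intro u y hy hc hne
    by_contra hno
    push Not at hno
    have hU : (⋃ w, B w \ {y}) = (⋃ w, B w) \ {y} := (iUnion_diff _ _).symm
    have hyU : y ∈ ⋃ w, B w := mem_iUnion.2 ⟨u, hy⟩
    have := hmin (fun w => B w \ {y}) ⟨hB.del hy hne hc fun w hw => ?_, fun w => Set.diff_subset.trans (hBA w)⟩
    · have ac := Set.ncard_diff_singleton_lt_of_mem hyU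
      rw [← hU] at ac
      omega
    · obtain ⟨a, ha, b, hb, hab⟩ := hB.ed u w hw
      exact ⟨a, ha, fun e => hno w hw.ne' b hb (e ▸ hab), b, hb, hab⟩

theorem wall_adj {n : ℕ} (a b : Fin n × Fin (2 * n)) : (Wall n).Adj a b ↔
    (a.1.val = b.1.val ∧ (a.2.val + 1 = b.2.val ∨ b.2.val + 1 = a.2.val)) ∨
    (a.2.val = b.2.val ∧ ((a.1.val + 1 = b.1.val ∧ (a.1.val + a.2.val) % 2 = 0) ∨ (b.1.val + 1 = a.1.val ∧ (b.1.val + b.2.val) % 2 = 0))) := by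
  rw [Wall, fromRel_adj]
  grind

theorem wall_deg {n : ℕ} (u a b c d : Fin n × Fin (2 * n)) (ha : (Wall n).Adj u a) (hb : (Wall n).Adj u b) (hc : (Wall n).Adj u c) (hd : (Wall n).Adj u d)
    (hab : a ≠ b) (hcd : c ≠ d) : a = c ∨ a = d ∨ b = c ∨ b = d := by
  obtain ⟨ca, cc⟩ : ∃ ca : Fin n × Fin (2 * n) → ℕ, ca = fun a => if a.1 = u.1 then (if a.2 < u.2 then 0 else 1) else 2 := ⟨_, rfl⟩
  have lt : ∀ a, ca a < 3 := by intro a; rw [cc]; dsimp only; split_ifs <;> omega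
  have inj : ∀ a b, (Wall n).Adj u a → (Wall n).Adj u b → a ≠ b → ca a ≠ ca b := by
    intro a b ha hb hab e
    refine hab ?_
    rw [wall_adj] at ha hb
    grind
  grind

theorem lift_wall [Finite V] (t : ℕ) (β Va : Set V)
    (pa : ∀ v a b, a ∈ β → b ∈ β → G.Adj v a → G.Adj v b → a = b)
    (two : ∀ x ∈ Va, x ∉ β → ∀ a ∈ Va, ∀ b ∈ Va, ∀ c ∈ Va, G.Adj x a → G.Adj x b → G.Adj x c → a = b ∨ a = c ∨ b = c)
    (hA : ∃ A, Mdl G (Wall (t + 2)) A ∧ (∀ u, ∀ a ∈ A u, ∀ b ∈ β, a ∈ β → G.Adj a b → b ∈ A u) ∧ ∀ u, A u ⊆ Va) :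
    ContainsWallSubdiv G t := by
  obtain ⟨A, hM, htr, hcr⟩ := min_model _ β Va pa two hA
  obtain ⟨ι, hι⟩ : ∃ ι : Fin t × Fin (2 * t) → Fin (t + 2) × Fin (2 * (t + 2)), ι = fun p => (⟨p.1.1 + 1, by omega⟩, ⟨p.2.1 + 1, by omega⟩) := ⟨_, rfl⟩
  have inj : ∀ u v, ι u = ι v → u = v := by
    grind
  have adj : ∀ u v, (Wall (t + 2)).Adj (ι u) (ι v) ↔ (Wall t).Adj u v := by
    intro u v
    rw [wall_adj, wall_adj, hι]
    dsimp only
    omega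
  have dg : ∀ u, ∃ a b, a ≠ b ∧ (Wall (t + 2)).Adj (ι u) a ∧ (Wall (t + 2)).Adj (ι u) b := by
    intro u
    refine ⟨(⟨u.1.1 + 1, by omega⟩, ⟨u.2.1, by omega⟩), (⟨u.1.1 + 1, by omega⟩, ⟨u.2.1 + 2, by omega⟩), ?_, ?_, ?_⟩
    · simp [Prod.ext_iff, Fin.ext_iff]
    · rw [wall_adj, hι]; dsimp only; omega
    · rw [wall_adj, hι]; dsimp only; omega
  obtain ⟨Aa, ck⟩ := trim (G := G) (F := Wall t) (A := fun u => A (ι u))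
    ⟨fun u => hM.ne _, fun u => hM.cn _, fun u v x hx hy => inj _ _ (hM.dj _ _ _ hx hy), fun u v huv => hM.ed _ _ ((adj u v).2 huv)⟩
    (fun u => htr (ι u)) (fun u v huv x hx y hy hxy => by
      have := hcr _ _ (fun e => huv (inj _ _ e)) (dg u) (dg v) x hx y hy hxy
      exact ⟨(adj u v).1 this.1, this.2⟩)
  exact ⟨_, _, TM.sub wall_deg _ G Aa ck rfl, _, ⟨Iso.refl⟩⟩

end Paper

namespace Paper
variable {V : Type} {G : SimpleGraph V} {β : Set V}

theorem att2 (pa : ∀ v a b, a ∈ β → b ∈ β → G.Adj v a → G.Adj v b → a = b)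
    (pd : ∀ x ∉ β, ∃ K L, G.IsClique K ∧ G.IsClique L ∧ K ⊆ β ∧ L ⊆ β ∧ ∀ z ∈ β, Att G z (comp G βᶜ x) → z ∈ K ∨ z ∈ L)
    {d x y z : V} (hd : d ∉ β) (hx : x ∈ β) (hy : y ∈ β) (hz : z ∈ β) (ax : Att G x (comp G βᶜ d)) (ay : Att G y (comp G βᶜ d)) (az : Att G z (comp G βᶜ d))
    (hxy : cls G β x ≠ cls G β y) : cls G β z = cls G β x ∨ cls G β z = cls G β y := by
  obtain ⟨K, L, hK, hL, -, -, h⟩ := pd d hd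
  have same : ∀ M : Set V, G.IsClique M → ∀ a ∈ β, ∀ b ∈ β, a ∈ M → b ∈ M → cls G β a = cls G β b := by
    intro M hM a ha b hb aa ac
    rw [cls_eq pa ha hb]
    tauto
  grind

theorem path_D (pa : ∀ v a b, a ∈ β → b ∈ β → G.Adj v a → G.Adj v b → a = b)
    (pd : ∀ x ∉ β, ∃ K L, G.IsClique K ∧ G.IsClique L ∧ K ⊆ β ∧ L ⊆ β ∧ ∀ z ∈ β, Att G z (comp G βᶜ x) → z ∈ K ∨ z ∈ L)
    {d x y : V} (hd : d ∉ β) (hx : x ∈ β) (hy : y ∈ β) (ax : Att G x (comp G βᶜ d)) (ay : Att G y (comp G βᶜ d))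
    (hxy : cls G β x ≠ cls G β y) : ∃ P ⊆ comp G βᶜ d, Cn G P ∧ (∃ v ∈ P, Att G v (cls G β x)) ∧ (∃ v ∈ P, Att G v (cls G β y)) ∧
      ∀ v ∈ P, ∃ p q, ∀ w, w ∈ β ∨ w ∈ P → G.Adj v w → w = p ∨ w = q := by
  obtain ⟨a, ha, hxa⟩ := ax
  obtain ⟨b, hb, hyb⟩ := ay
  obtain ⟨n, g, hP, gc, gn, hind, gX, gY, gi⟩ := exists_SP (X := {v | Att G v (cls G β x)}) (Y := {v | Att G v (cls G β y)})
    ⟨x, mem_cls hx, hxa.symm⟩ ⟨y, mem_cls hy, hyb.symm⟩ (Cn_comp (G := G) (s := βᶜ) (x := d) a ha b hb)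
  refine ⟨{v | ∃ i ≤ n, v = g i}, ?_, ?_, ⟨g 0, ⟨0, Nat.zero_le _, rfl⟩, gc⟩, ⟨g n, ⟨n, le_rfl, rfl⟩, gn⟩, ?_⟩
  · rintro _ ⟨i, hi, rfl⟩; exact hP.1 i hi
  · have key : ∀ i ≤ n, RR G {v | ∃ i ≤ n, v = g i} (g 0) (g i) := fun i hi =>
      RR_interval (Nat.zero_le i) (fun k _ hk => ⟨k, by omega, rfl⟩) fun k _ hk => hP.2 k (by omega)
    refine Cn.of_center (x := g 0) ?_
    grind
  · rintro _ ⟨i, hi, rfl⟩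
    by_cases he : ∃ e ∈ β, G.Adj (g i) e
    · obtain ⟨e, he, hge⟩ := he
      have bi : i = 0 ∨ i = n := by
        have ae : Att G e (comp G βᶜ d) := ⟨g i, hP.1 i hi, hge.symm⟩
        rcases att2 pa pd hd hx hy he ⟨a, ha, hxa⟩ ⟨b, hb, hyb⟩ ae hxy with h | h
        · exact .inl (gX i hi ⟨e, h ▸ mem_cls he, hge⟩)
        · exact .inr (gY i hi ⟨e, h ▸ mem_cls he, hge⟩)
      refine ⟨e, if i = 0 then g 1 else g (n - 1), fun w hw hgw => ?_⟩
      rcases hw with hw | ⟨j, hj, rfl⟩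
      all_goals grind
    · push Not at he
      refine ⟨g (i - 1), g (i + 1), fun w hw hgw => ?_⟩
      rcases hw with hw | ⟨j, hj, rfl⟩
      · exact absurd hgw (he w hw)
      · rcases hind i hi j hj hgw with h | h
        · right; rw [h]
        · left; congr 1; omega

theorem lift_model [Nonempty V] (pa : ∀ v a b, a ∈ β → b ∈ β → G.Adj v a → G.Adj v b → a = b)
    (pd : ∀ x ∉ β, ∃ K L, G.IsClique K ∧ G.IsClique L ∧ K ⊆ β ∧ L ⊆ β ∧ ∀ z ∈ β, Att G z (comp G βᶜ x) → z ∈ K ∨ z ∈ L)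
    {W : Type} {F : SimpleGraph W} (hF : ∀ u, ∃ v, F.Adj u v) (hm : Minor F (HG G β)) :
    ∃ Va : Set V, (∀ x ∈ Va, x ∉ β → ∀ a ∈ Va, ∀ b ∈ Va, ∀ c ∈ Va, G.Adj x a → G.Adj x b → G.Adj x c → a = b ∨ a = c ∨ b = c) ∧
      ∃ A, Mdl G F A ∧ (∀ u, ∀ a ∈ A u, ∀ b ∈ β, a ∈ β → G.Adj a b → b ∈ A u) ∧ ∀ u, A u ⊆ Va := by
  classical
  obtain ⟨M, hM, hMd, hMe⟩ := hm
  obtain ⟨good, hgood⟩ : ∃ good : Set V → Prop, good = fun D => ∃ d ∉ β, D = comp G βᶜ d ∧ ∃ x ∈ β, ∃ y ∈ β, cls G β x ≠ cls G β y ∧ Att G x D ∧ Att G y D := ⟨_, rfl⟩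
  have ch : ∀ D : Set V, ∃ (x y : V) (P : Set V), good D → x ∈ β ∧ y ∈ β ∧ Att G x D ∧ Att G y D ∧ cls G β x ≠ cls G β y ∧ P ⊆ D ∧ Cn G P ∧
      (∃ v ∈ P, Att G v (cls G β x)) ∧ (∃ v ∈ P, Att G v (cls G β y)) ∧ ∀ v ∈ P, ∃ p q, ∀ w, w ∈ β ∨ w ∈ P → G.Adj v w → w = p ∨ w = q := by
    intro D
    by_cases hg : good D
    · have ft := hg
      rw [hgood] at ft
      obtain ⟨d, hd, rfl, x, hx, y, hy, hxy, ax, ay⟩ := ft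
      obtain ⟨P, aa, ac, ah, aj, am⟩ := path_D pa pd hd hx hy ax ay hxy
      grind
    · exact ⟨Classical.arbitrary V, Classical.arbitrary V, ∅, fun h => absurd h hg⟩
  choose X Y P hXb hYb hXa hYa hXY hPD hPc hPX hPY hPn using ch
  have gsub : ∀ D, good D → D ⊆ βᶜ := by
    intro D hD
    rw [hgood] at hD
    obtain ⟨d, hd, rfl, -⟩ := hD
    exact comp_sub
  have gcomp : ∀ D, good D → ∀ v ∈ D, D = comp G βᶜ v := by
    intro D hD v hv
    rw [hgood] at hD
    obtain ⟨d, hd, rfl, -⟩ := hD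
    exact (comp_eq hv).symm
  have Pβ : ∀ D, good D → ∀ v ∈ P D, v ∉ β := fun D hD v hv => gsub D hD (hPD D hD hv)
  have edge : ∀ c ca, (HG G β).Adj c ca → ∃ D, good D ∧ ((cls G β (X D) = c ∧ cls G β (Y D) = ca) ∨ (cls G β (X D) = ca ∧ cls G β (Y D) = c)) := by
    rintro c ca ⟨hne, x, hx, y, hy, rfl, rfl, d, hd, ax, ay⟩
    have hg : good (comp G βᶜ d) := by rw [hgood]; exact ⟨d, hd, rfl, x, hx, y, hy, hne, ax, ay⟩
    refine ⟨_, hg, ?_⟩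
    have aa := att2 pa pd hd hx hy (hXb _ hg) ax ay (hXa _ hg) hne
    have ac := att2 pa pd hd hx hy (hYb _ hg) ax ay (hYa _ hg) hne
    grind
  obtain ⟨A, hA⟩ : ∃ A : W → Set V, A = fun u => {v | (v ∈ β ∧ cls G β v ∈ M u) ∨ ∃ D, good D ∧ v ∈ P D ∧ cls G β (X D) ∈ M u} := ⟨_, rfl⟩
  have mA : ∀ u v, v ∈ A u ↔ (v ∈ β ∧ cls G β v ∈ M u) ∨ ∃ D, good D ∧ v ∈ P D ∧ cls G β (X D) ∈ M u := by
    intro u v; rw [hA]; rfl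
  have Mdj : ∀ u v c, c ∈ M u → c ∈ M v → u = v := by
    intro u v c aa ac
    by_contra hne
    exact Set.disjoint_left.1 (hMd u v hne) aa ac
  have mcls : ∀ x y, x ∈ β → y ∈ cls G β x → y ∈ β ∧ cls G β y = cls G β x := by
    rintro x y hx ⟨hy, e⟩
    refine ⟨hy, (cls_eq pa hy hx).2 ?_⟩
    exact e.imp_right fun h => h.symm
  have Mcls : ∀ u c, c ∈ M u → ∃ x ∈ β, c = cls G β x := by
    intro u c hc
    obtain ⟨v, huv⟩ := hF u
    obtain ⟨a, ha, b, hb, hab⟩ := hMe u v huv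
    have : ∃ b, (HG G β).Adj c b := by
      by_cases e : a = c
      · subst e; exact ⟨b, hab⟩
      · obtain ⟨p, q, aa, -, -, -, am, -⟩ := ((hM u).2 c hc a ha).exit (T := {c}) rfl e
        grind
    grind
  have sameR : ∀ u z w, z ∈ β → w ∈ β → cls G β z = cls G β w → cls G β z ∈ M u → RR G (A u) z w := by
    intro u z w hz hw e hzu
    have aa : z ∈ A u := (mA u z).2 (.inl ⟨hz, hzu⟩)
    have ac : w ∈ A u := (mA u w).2 (.inl ⟨hw, e ▸ hzu⟩)
    rcases (cls_eq pa hz hw).1 e with rfl | h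
    · exact RR.refl aa
    · exact RR.adj aa ac h
  have R : ∀ u D z, good D → cls G β (X D) ∈ M u → z ∈ β → cls G β z ∈ M u → (∃ v ∈ P D, Att G v (cls G β z)) → ∀ p ∈ P D, RR G (A u) z p := by
    rintro u D z hD hXu hz hzu ⟨v, hv, e, he, hve⟩ p hp
    have hsub : P D ⊆ A u := fun q hq => (mA u q).2 (.inr ⟨D, hD, hq, hXu⟩)
    obtain ⟨aa, ac⟩ := mcls z e hz he
    exact ((sameR u z e hz aa ac.symm hzu).tail (hsub hv) hve.symm).trans ((hPc D hD v hv p hp).mono hsub)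
  refine ⟨β ∪ {v | ∃ D, good D ∧ v ∈ P D}, ?_, A, ⟨?_, ?_, ?_, ?_⟩, ?_, ?_⟩
  · rintro x (hx | ⟨D, hD, hx⟩) hxb a ha b hb c hc hxa jy hxc
    · exact absurd hx hxb
    have loc : ∀ a, a ∈ β ∪ {v | ∃ D, good D ∧ v ∈ P D} → G.Adj x a → a ∈ β ∨ a ∈ P D := by
      rintro a (ha | ⟨D', cy, ha⟩) hxa
      · exact .inl ha
      · have ea := gcomp D hD x (hPD D hD hx)
        have eb := gcomp D' cy a (hPD D' cy ha)
        have ec : a ∈ comp G βᶜ x := comp_step (mem_comp hxb) (Pβ D' cy a ha) hxa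
        grind
    obtain ⟨p, q, h⟩ := hPn D hD x hx
    grind
  · intro u
    obtain ⟨c, hc⟩ := (hM u).1
    obtain ⟨x, hx, rfl⟩ := Mcls u c hc
    exact ⟨x, (mA u x).2 (.inl ⟨hx, hc⟩)⟩
  · intro u
    obtain ⟨cb, ej⟩ := (hM u).1
    obtain ⟨xc, jz, rfl⟩ := Mcls u cb ej
    have key : ∀ c ∈ M u, ∀ v ∈ β, cls G β v = c → RR G (A u) xc v := by
      intro c hc
      refine ((hM u).2 _ ej c hc).ind (P := fun c => ∀ v ∈ β, cls G β v = c → RR G (A u) xc v) ?_ ?_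
      · grind
      · intro a b ha ih hb hab v hv e
        subst e
        obtain ⟨D, hD, ⟨ea, eb⟩ | ⟨ea, eb⟩⟩ := edge _ _ hab
        · have hXu : cls G β (X D) ∈ M u := ea ▸ ha.right
          obtain ⟨p, hp, bt⟩ := hPX D hD
          exact (ih _ (hXb D hD) ea).trans ((R u D _ hD hXu (hXb D hD) hXu ⟨p, hp, bt⟩ p hp).trans
            (R u D v hD hXu hv hb (eb ▸ hPY D hD) p hp).symm)
        · have hXu : cls G β (X D) ∈ M u := ea ▸ hb
          obtain ⟨p, hp, bt⟩ := hPY D hD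
          exact (ih _ (hYb D hD) eb).trans ((R u D _ hD hXu (hYb D hD) (eb ▸ ha.right) ⟨p, hp, bt⟩ p hp).trans
            (R u D v hD hXu hv hb (ea ▸ hPX D hD) p hp).symm)
    refine Cn.of_center (x := xc) fun v hv => ?_
    rcases (mA u v).1 hv with ⟨aa, ac⟩ | ⟨D, hD, aa, ac⟩
    · exact key _ ac v aa rfl
    · exact (key _ ac _ (hXb D hD) rfl).trans (R u D _ hD ac (hXb D hD) ac (hPX D hD) v aa)
  · intro u v x hx cm
    rcases (mA u x).1 hx with ⟨aa, ac⟩ | ⟨D, hD, aa, ac⟩ <;> rcases (mA v x).1 cm with ⟨bp, bk⟩ | ⟨D', cy, bp, bk⟩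
    · exact Mdj _ _ _ ac bk
    · grind
    · grind
    · have : D = D' := (gcomp D hD x (hPD D hD aa)).trans (gcomp D' cy x (hPD D' cy bp)).symm
      grind
  · intro u v huv
    obtain ⟨a, ha, b, hb, hab⟩ := hMe u v huv
    obtain ⟨D, hD, h⟩ := edge _ _ hab
    obtain ⟨p, hp, e, he, hpe⟩ := hPY D hD
    obtain ⟨ea, eb⟩ := mcls _ _ (hYb D hD) he
    rcases h with ⟨rfl, rfl⟩ | ⟨rfl, rfl⟩
    · exact ⟨p, (mA u p).2 (.inr ⟨D, hD, hp, ha⟩), e, (mA v e).2 (.inl ⟨ea, eb ▸ hb⟩), hpe⟩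
    · exact ⟨e, (mA u e).2 (.inl ⟨ea, eb ▸ ha⟩), p, (mA v p).2 (.inr ⟨D, hD, hp, hb⟩), hpe.symm⟩
  · intro u a ha b hb haβ hab
    rcases (mA u a).1 ha with ⟨aa, ac⟩ | ⟨D, hD, aa, ac⟩
    · exact (mA u b).2 (.inl ⟨hb, cls_mate pa haβ hb hab ▸ ac⟩)
    · exact absurd haβ (Pβ D hD a aa)
  · intro u v hv
    rcases (mA u v).1 hv with ⟨aa, ac⟩ | ⟨D, hD, aa, ac⟩
    · exact .inl aa
    · exact .inr ⟨D, hD, aa⟩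

end Paper

namespace Paper

theorem clique_contains {V : Type} {G : SimpleGraph V} {t : ℕ} {K : Finset V} (hK : G.IsClique ↑K) (h : t ≤ K.card) :
    ContainsInduced G (completeGraph (Fin t)) := by
  obtain ⟨L, hL, hc⟩ := Finset.exists_subset_card_eq h
  refine ⟨↑L, ⟨⟨(L.equivFinOfCardEq hc).symm, ?_⟩⟩⟩
  intro a b
  simp only [comap_adj, completeGraph, top_adj, Function.Embedding.subtype_apply, SimpleGraph.induce]
  refine ⟨fun h e => ?_, fun h => hK (hL (Subtype.prop _)) (hL (Subtype.prop _)) fun e => h ?_⟩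
  · subst e; exact h.ne rfl
  · exact (L.equivFinOfCardEq hc).symm.injective (Subtype.ext e)

theorem main_wall (t : ℕ) : ∃ c : ℕ, ∀ (V : Type) [Finite V] (G : SimpleGraph V),
    T1Free G → ¬HasTreewidthAtMost G c → (∀ K : Finset V, G.IsClique ↑K → K.card < t) → ContainsWallSubdiv G t := by
  obtain ⟨g, hg⟩ := grid (t + 2)
  refine ⟨3 * (t + 2 * g + 9), fun V _ G hT htw hcl => ?_⟩
  obtain ⟨𝓑, hB, ho⟩ := tw_bramble (by omega) htw
  obtain ⟨U, 𝓒, hgd⟩ := exists_good (hp_of_T1Free hT) (by omega) hcl hB ho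
  obtain ⟨β, pa, pd, hβ⟩ := beta_main hgd (by omega)
  obtain ⟨𝓓, hD, hDo⟩ := HG_bramble (k := g) pa hgd.br (fun X hX => hgd.ord X (by omega)) hβ
  have hm := hg _ _ _ hD hDo
  haveI : Nonempty U := by
    obtain ⟨B, hB, -⟩ := hgd.ord ∅ (by simp)
    exact ⟨(hgd.br.ne B hB).some⟩
  obtain ⟨Va, two, hA⟩ := lift_model pa pd (fun u => by
    by_cases h : u.2.val + 1 < 2 * (t + 2)
    · exact ⟨(u.1, ⟨u.2.val + 1, h⟩), (wall_adj _ _).2 (.inl ⟨rfl, .inl rfl⟩)⟩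
    · have := u.2.isLt
      exact ⟨(u.1, ⟨u.2.val - 1, by omega⟩), (wall_adj _ _).2 (.inl ⟨rfl, .inr (by simp only; omega)⟩)⟩) hm
  exact contains_induce (lift_wall t β Va pa two hA)

end Paper

namespace Paper

/-- the family `𝓣₁` is helpful. -/
theorem statement1 (t : ℕ) (ht : 0 < t) :
    ∃ c : ℕ, ∀ (V : Type) [Fintype V] (G : SimpleGraph V),
      T1Free G → ¬HasTreewidthAtMost G c →
        ContainsInduced G (completeGraph (Fin t)) ∨
        ContainsInduced G (completeBipartiteGraph (Fin t) (Fin t)) ∨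
        ContainsWallSubdiv G t ∨ ContainsLineWallSubdiv G t := by
  obtain ⟨c, hc⟩ := main_wall t
  refine ⟨c, fun V _ G hT htw => ?_⟩
  by_cases h : ∃ K : Finset V, G.IsClique ↑K ∧ t ≤ K.card
  · obtain ⟨K, aa, ac⟩ := h
    exact .inl (clique_contains aa ac)
  · push Not at h
    exact .inr (.inr (.inl (hc V G hT htw h)))

end Paper
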